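/- arXiv:1406.0766 — 5 statements merged into one kernel-verified Lean document; each statement's English description precedes it below -/
import Mathlib

section
/- Let d ≥ 1 and n ≥ 1 be integers, let G be a d-regular bipartite simple graph on 2n vertices, let 1 ≤ k ≤ n, and set p = k/n. Then m_k(G) ≥ exp(2n·Γ_d(p))/(2n); equivalently, ln m_k(G)/(2n) ≥ Γ_d(p) − ln(2n)/(2n). -/
/-- The number of `k`-matchings of a simple graph `G`: the number of sets of `k`
pairwise disjoint edges of `G`. -/
noncomputable def matchCount {V : Type*} (G : SimpleGraph V) (k : ℕ) : ℕ :=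
  Nat.card {s : Finset (Sym2 V) // ↑s ⊆ G.edgeSet ∧ s.card = k ∧
    ∀ e ∈ s, ∀ f ∈ s, e ≠ f → ∀ v : V, v ∈ e → v ∉ f}

/-- The entropy function `Γ_d(p)` of the infinite `d`-regular tree.
(In Lean, `Real.log 0 = 0`, which implements the convention `0 · ln 0 = 0`.) -/
noncomputable def Gammad (d : ℕ) (p : ℝ) : ℝ :=
  (1 / 2) * (p * Real.log ((d : ℝ) / p) + ((d : ℝ) - p) * Real.log (1 - p / d)
    - 2 * (1 - p) * Real.log (1 - p))

/-- A set of pairwise disjoint edges. -/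
def IsEdgeMatching {V : Type*} (s : Finset (Sym2 V)) : Prop :=
  ∀ e ∈ s, ∀ f ∈ s, e ≠ f → ∀ v : V, v ∈ e → v ∉ f

section MatchingSum

open scoped Classical in
/-- The monomer-dimer partition function: the sum over all matchings formed by edges in `F` with
both ends in `S` of the product of the activities `μ v` of the vertices of `S` left uncovered. -/
noncomputable def matchingSum {V R : Type*} [DecidableEq V] [CommRing R]
    (F : Finset (Sym2 V)) (μ : V → R) (S : Finset V) : R :=
  ∑ s ∈ F.powerset, if IsEdgeMatching s ∧ ∀ e ∈ s, ∀ v ∈ e, v ∈ S then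
    ∏ v ∈ S with ∀ e ∈ s, v ∉ e, μ v else 0

variable {V R : Type*} [DecidableEq V] [CommRing R]

lemma isEdgeMatching_insert {s : Finset (Sym2 V)} {e : Sym2 V} (he : e ∉ s) :
    IsEdgeMatching (insert e s) ↔ IsEdgeMatching s ∧ ∀ f ∈ s, ∀ v ∈ e, v ∉ f := by
  unfold IsEdgeMatching
  constructor
  · intro h
    refine ⟨fun f hf g hg => h f (by simp [hf]) g (by simp [hg]), fun f hf v hv => ?_⟩
    exact h e (by simp) f (by simp [hf]) (fun h => he (h ▸ hf)) v hv
  · rintro ⟨h1, h2⟩ f hf g hg hne v hvf hvg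
    rw [Finset.mem_insert] at hf hg
    rcases hf with rfl | hf <;> rcases hg with rfl | hg
    · exact hne rfl
    · exact h2 g hg v hvf hvg
    · exact h2 f hf v hvg hvf
    · exact h1 f hf g hg hne v hvf hvg

@[simp]
lemma matchingSum_empty (μ : V → R) (S : Finset V) : matchingSum ∅ μ S = ∏ v ∈ S, μ v := by
  simp [matchingSum, IsEdgeMatching]

lemma matchingSum_insert {F : Finset (Sym2 V)} {a b : V} (h : s(a, b) ∉ F) (μ : V → R)
    (S : Finset V) :
    matchingSum (insert s(a, b) F) μ S =
      matchingSum F μ S + if a ∈ S ∧ b ∈ S then matchingSum F μ ((S.erase a).erase b) else 0 := by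
  classical
  unfold matchingSum
  rw [Finset.sum_powerset_insert h]
  congr 1
  have key : ∀ t ∈ F.powerset, (IsEdgeMatching (insert s(a, b) t) ∧
      ∀ e ∈ insert s(a, b) t, ∀ v ∈ e, v ∈ S) ↔ (a ∈ S ∧ b ∈ S) ∧ (IsEdgeMatching t ∧
        ∀ e ∈ t, ∀ v ∈ e, v ∈ (S.erase a).erase b) := by
    intro t ht
    have hn : s(a, b) ∉ t := fun h' => h (Finset.mem_powerset.1 ht h')
    rw [isEdgeMatching_insert hn]
    simp only [Finset.mem_insert, forall_eq_or_imp, Sym2.mem_iff, Finset.mem_erase]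
    simp only [forall_eq]
    constructor
    · rintro ⟨⟨h1, h2⟩, ⟨h3, h4⟩, h5⟩
      refine ⟨⟨h3, h4⟩, h1, fun e he v hv => ⟨?_, ?_, h5 e he v hv⟩⟩
      · rintro rfl; exact (h2 e he).2 hv
      · rintro rfl; exact (h2 e he).1 hv
    · rintro ⟨⟨h3, h4⟩, h1, h2⟩
      refine ⟨⟨h1, fun f hf => ⟨fun hv => ?_, fun hv => ?_⟩⟩, ⟨h3, h4⟩,
        fun e he v hv => (h2 e he v hv).2.2⟩
      · exact (h2 f hf _ hv).2.1 rfl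
      · exact (h2 f hf _ hv).1 rfl
  split_ifs with hS
  · refine Finset.sum_congr rfl fun t ht => ?_
    rw [if_congr ((key t ht).trans (and_iff_right hS)) rfl rfl]
    congr 1
    refine Finset.prod_congr ?_ fun _ _ => rfl
    ext v
    simp only [Finset.mem_filter, Finset.mem_insert, forall_eq_or_imp, Sym2.mem_iff,
      Finset.mem_erase]
    tauto
  · refine Finset.sum_eq_zero fun t ht => if_neg fun h' => hS ((key t ht).1 h').1

@[simp]
lemma matchingSum_empty_right (F : Finset (Sym2 V)) (μ : V → R) : matchingSum F μ ∅ = 1 := by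
  induction F using Finset.induction_on with
  | empty => simp
  | insert e F he ih =>
    induction e using Sym2.ind with | _ a b =>
    simpa [matchingSum_insert he] using ih

/-- Expansion of the partition function according to the edge covering a vertex. -/
lemma matchingSum_expand (F : Finset (Sym2 V)) (hF : ∀ e ∈ F, ¬ e.IsDiag) (μ : V → R)
    {S : Finset V} {u : V} (hu : u ∈ S) :
    matchingSum F μ S = μ u * matchingSum F μ (S.erase u) +
      ∑ w ∈ S.erase u, if s(u, w) ∈ F then matchingSum F μ ((S.erase u).erase w) else 0 := by
  induction F using Finset.induction_on generalizing S with
  | empty => simp [Finset.mul_prod_erase S μ hu]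
  | insert e F he ih =>
    have ih' : ∀ {S : Finset V}, u ∈ S → _ := fun {S} hS =>
      ih (fun e he => hF e (Finset.mem_insert_of_mem he)) (S := S) hS
    by_cases hue : u ∈ e
    · obtain ⟨b, rfl⟩ := hue
      have hub : u ≠ b := by
        have := hF _ (Finset.mem_insert_self _ _)
        simpa using this
      have h1 : ∀ T : Finset V, u ∉ T →
          matchingSum (insert s(u, b) F) μ T = matchingSum F μ T := by
        intro T hT
        rw [matchingSum_insert he, if_neg (fun h => hT h.1), add_zero]
      rw [matchingSum_insert he, ih' hu, h1 _ (by simp), add_assoc]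
      congr 1
      have h2 : (if u ∈ S ∧ b ∈ S then matchingSum F μ ((S.erase u).erase b) else 0) =
          ∑ w ∈ S.erase u, if w = b then matchingSum F μ ((S.erase u).erase w) else 0 := by
        rw [Finset.sum_ite_eq']
        simp [hu, hub.symm]
      rw [h2, ← Finset.sum_add_distrib]
      refine Finset.sum_congr rfl fun w hw => ?_
      rw [h1 _ (by simp)]
      by_cases hwb : w = b
      · subst hwb; simp [he]
      · have : s(u, w) ≠ s(u, b) := by
          exact fun h => hwb (Sym2.congr_right.1 h)
        simp [hwb, this]
    · induction e using Sym2.ind with | _ a b =>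
      have hua : u ≠ a := by rintro rfl; simp at hue
      have hub : u ≠ b := by rintro rfl; simp at hue
      have h3 : ∀ w, s(u, w) ∈ insert s(a, b) F ↔ s(u, w) ∈ F := by
        intro w
        rw [Finset.mem_insert, or_iff_right]
        intro h; exact hue (h ▸ Sym2.mem_mk_left u w)
      simp only [h3, matchingSum_insert he]
      rw [ih' hu]
      have e2 : ((S.erase u).erase a).erase b = ((S.erase a).erase b).erase u := by
        rw [Finset.erase_right_comm (a := u), Finset.erase_right_comm (a := u)]
      by_cases hS : a ∈ S ∧ b ∈ S
      · rw [if_pos hS, if_pos (by simp [hS, hua.symm, hub.symm]),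
          ih' (S := (S.erase a).erase b) (by simp [hu, hua, hub]), e2]
        have h4 : ∀ w ∈ S.erase u, (if s(u, w) ∈ F then matchingSum F μ ((S.erase u).erase w) +
            (if a ∈ (S.erase u).erase w ∧ b ∈ (S.erase u).erase w then
              matchingSum F μ ((((S.erase u).erase w).erase a).erase b) else 0) else 0) =
            (if s(u, w) ∈ F then matchingSum F μ ((S.erase u).erase w) else 0) +
            if w ∈ ((S.erase a).erase b).erase u then (if s(u, w) ∈ F then
              matchingSum F μ ((((S.erase a).erase b).erase u).erase w) else 0) else 0 := by
          intro w hw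
          rw [Finset.mem_erase] at hw
          have e3 : (((S.erase u).erase w).erase a).erase b =
            (((S.erase a).erase b).erase u).erase w := by
            ext; simp only [Finset.mem_erase]; tauto
          rw [e3]
          have : (a ∈ (S.erase u).erase w ∧ b ∈ (S.erase u).erase w) ↔
              w ∈ ((S.erase a).erase b).erase u := by
            simp only [Finset.mem_erase]
            grind
          simp only [this]
          split_ifs <;> simp
        rw [Finset.sum_congr rfl h4, Finset.sum_add_distrib, ← Finset.sum_filter,
          ← Finset.sum_filter (p := fun w => w ∈ ((S.erase a).erase b).erase u)]
        have h5 : (S.erase u).filter (fun w => w ∈ ((S.erase a).erase b).erase u) =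
            ((S.erase a).erase b).erase u := by
          ext; simp only [Finset.mem_filter, Finset.mem_erase]; tauto
        rw [h5]
        simp only [Finset.sum_filter]
        ring
      · have hS' : ¬ (a ∈ S.erase u ∧ b ∈ S.erase u) := by
          simp only [Finset.mem_erase]; tauto
        rw [if_neg hS, if_neg hS']
        simp only [add_zero]
        congr 1
        refine Finset.sum_congr rfl fun w hw => ?_
        rw [if_neg (show ¬ (a ∈ (S.erase u).erase w ∧ b ∈ (S.erase u).erase w) by
          simp only [Finset.mem_erase]; tauto), add_zero]

lemma matchingSum_congr (F : Finset (Sym2 V)) {μ ν : V → R} {S : Finset V}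
    (h : ∀ v ∈ S, μ v = ν v) : matchingSum F μ S = matchingSum F ν S := by
  unfold matchingSum
  refine Finset.sum_congr rfl fun s _ => ?_
  congr 1
  exact Finset.prod_congr rfl fun v hv => h v (Finset.mem_filter.1 hv).1

lemma matchingSum_update_add (F : Finset (Sym2 V)) (hF : ∀ e ∈ F, ¬ e.IsDiag) (μ : V → R)
    {S : Finset V} {u : V} (hu : u ∈ S) (y : R) :
    matchingSum F (Function.update μ u (μ u + y)) S =
      matchingSum F μ S + y * matchingSum F μ (S.erase u) := by
  have h : ∀ T : Finset V, u ∉ T →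
      matchingSum F (Function.update μ u (μ u + y)) T = matchingSum F μ T := by
    intro T hT
    refine matchingSum_congr F fun v hv => Function.update_of_ne ?_ _ _
    rintro rfl; exact hT hv
  rw [matchingSum_expand F hF _ hu, matchingSum_expand F hF μ hu, h _ (by simp),
    Function.update_self]
  rw [Finset.sum_congr rfl fun w _ => by rw [h ((S.erase u).erase w) (by simp)]]
  ring

lemma matchingSum_pos (F : Finset (Sym2 V)) {μ : V → ℝ} (hμ : ∀ v, 0 < μ v) (S : Finset V) :
    0 < matchingSum F μ S := by
  induction F using Finset.induction_on generalizing S with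
  | empty => simpa using Finset.prod_pos fun v _ => hμ v
  | insert e F he ih =>
    induction e using Sym2.ind with | _ a b =>
    rw [matchingSum_insert he]
    have := ih S
    have := ih ((S.erase a).erase b)
    split_ifs <;> linarith

/-- In a bipartite graph, the events that `u` and `v` are uncovered are positively correlated
when `u` and `v` lie on different sides, and negatively correlated otherwise. -/
lemma matchingSum_correlation {α : Type*} (c : V → α) (hc : ∀ x y z : V, c x ≠ c y → c y ≠ c z →
      c x = c z) (F : Finset (Sym2 V)) (hF : ∀ a b, s(a, b) ∈ F → c a ≠ c b) (μ : V → ℝ)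
    (S : Finset V) : ∀ u ∈ S, ∀ v ∈ S, u ≠ v →
      (c u ≠ c v → matchingSum F μ (S.erase u) * matchingSum F μ (S.erase v) ≤
        matchingSum F μ S * matchingSum F μ ((S.erase u).erase v)) ∧
      (c u = c v → matchingSum F μ S * matchingSum F μ ((S.erase u).erase v) ≤
        matchingSum F μ (S.erase u) * matchingSum F μ (S.erase v)) := by
  have hF' : ∀ e ∈ F, ¬ e.IsDiag := by
    intro e he
    induction e using Sym2.ind with | _ a b =>
    intro h
    exact hF a b he (congrArg c (by simpa using h))
  induction S using Finset.strongInduction with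
  | H S ih =>
  intro u hu v hv huv
  set Z := matchingSum F μ with hZ
  have hvu : v ∈ S.erase u := by simp [hv, huv.symm]
  have e0 : (S.erase v).erase u = (S.erase u).erase v := Finset.erase_right_comm
  have x1 : Z S = μ u * Z (S.erase u) + ((∑ w ∈ (S.erase u).erase v,
      if s(u, w) ∈ F then Z ((S.erase u).erase w) else 0) +
      if s(u, v) ∈ F then Z ((S.erase u).erase v) else 0) := by
    rw [hZ, matchingSum_expand F hF' μ hu, ← Finset.sum_erase_add _ _ hvu]
  have x2 : Z (S.erase v) = μ u * Z ((S.erase u).erase v) + ∑ w ∈ (S.erase u).erase v,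
      if s(u, w) ∈ F then Z (((S.erase u).erase v).erase w) else 0 := by
    rw [hZ, matchingSum_expand F hF' μ (show u ∈ S.erase v by simp [hu, huv]), e0]
  have IH := ih (S.erase u) (Finset.erase_ssubset hu)
  rw [x1, x2]
  constructor
  · intro hcuv
    have h1 : ∑ w ∈ (S.erase u).erase v, Z (S.erase u) *
        (if s(u, w) ∈ F then Z (((S.erase u).erase v).erase w) else 0) ≤
        ∑ w ∈ (S.erase u).erase v,
        (if s(u, w) ∈ F then Z ((S.erase u).erase w) else 0) * Z ((S.erase u).erase v) := by
      refine Finset.sum_le_sum fun w hw => ?_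
      split_ifs with hw'
      · have hw1 := Finset.mem_erase.1 hw
        have := (IH w hw1.2 v hvu hw1.1).2 (hc _ _ _ (hF _ _ hw').symm hcuv)
        rwa [Finset.erase_right_comm (a := w)] at this
      · simp
    rw [← Finset.mul_sum, ← Finset.sum_mul] at h1
    split_ifs
    · nlinarith [mul_self_nonneg (Z ((S.erase u).erase v))]
    · nlinarith
  · intro hcuv
    have h1 : ∑ w ∈ (S.erase u).erase v,
        (if s(u, w) ∈ F then Z ((S.erase u).erase w) else 0) * Z ((S.erase u).erase v) ≤
        ∑ w ∈ (S.erase u).erase v, Z (S.erase u) *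
        (if s(u, w) ∈ F then Z (((S.erase u).erase v).erase w) else 0) := by
      refine Finset.sum_le_sum fun w hw => ?_
      split_ifs with hw'
      · have hw1 := Finset.mem_erase.1 hw
        have := (IH w hw1.2 v hvu hw1.1).1 (fun h => hF _ _ hw' (hcuv.trans h.symm))
        rwa [Finset.erase_right_comm (a := w)] at this
      · simp
    rw [← Finset.mul_sum, ← Finset.sum_mul] at h1
    rw [if_neg (fun h => hF _ _ h hcuv)]
    nlinarith

/-- The Heilmann–Lieb theorem: no zeros when all activities lie in the right half-plane. -/
lemma matchingSum_ne_zero (F : Finset (Sym2 V)) (hF : ∀ e ∈ F, ¬ e.IsDiag) {μ : V → ℂ}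
    (hμ : ∀ v, 0 < (μ v).re) (S : Finset V) : matchingSum F μ S ≠ 0 := by
  suffices h : matchingSum F μ S ≠ 0 ∧
      ∀ u ∈ S, 0 < (matchingSum F μ S / matchingSum F μ (S.erase u)).re from h.1
  induction S using Finset.strongInduction with
  | H S ih =>
  have h2 : ∀ u ∈ S, 0 < (matchingSum F μ S / matchingSum F μ (S.erase u)).re := by
    intro u hu
    obtain ⟨hne, hre⟩ := ih _ (Finset.erase_ssubset hu)
    rw [matchingSum_expand F hF μ hu, add_div, mul_div_cancel_right₀ _ hne, Finset.sum_div,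
      Complex.add_re, Complex.re_sum]
    refine add_pos_of_pos_of_nonneg (hμ u) (Finset.sum_nonneg fun w hw => ?_)
    split_ifs
    · rw [← inv_div, Complex.inv_re]
      exact div_nonneg (hre w hw).le (Complex.normSq_nonneg _)
    · simp
  refine ⟨?_, h2⟩
  rcases S.eq_empty_or_nonempty with rfl | ⟨u, hu⟩
  · simp
  · intro h0
    simpa [h0] using h2 u hu

end MatchingSum

section Capacity

lemma mul_le_add_of_forall_mul_rpow_le {a b c d α T : ℝ} (ha : 0 < a) (hd : 0 < d) (hb : 0 ≤ b)
    (hc : 0 ≤ c) (hbc : b * c ≤ a * d) (hα : 0 < α) (hα1 : α ≤ 1)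
    (h : ∀ y z : ℝ, 0 < y → 0 < z → T * (y ^ α * z ^ α) ≤ a + b * y + c * z + d * (y * z)) :
    α ^ α * (1 - α) ^ (1 - α) * T ≤ a + d := by
  rcases hα1.lt_or_eq with hα1 | rfl
  · have hβ : 0 < 1 - α := by linarith
    obtain ⟨b', c', hb', hc', hbb, hcc, hbc'⟩ : ∃ b' c' : ℝ, 0 < b' ∧ 0 < c' ∧ b ≤ b' ∧ c ≤ c' ∧
        b' * c' = a * d := by
      rcases hb.eq_or_lt with rfl | hb
      · refine ⟨a * d / (c + 1), c + 1, by positivity, by positivity, by positivity, by linarith, ?_⟩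
        field_simp
      · refine ⟨b, a * d / b, hb, by positivity, le_rfl, ?_, by field_simp⟩
        rw [le_div_iff₀ hb]; linarith
    have hy : 0 < α * a / ((1 - α) * b') := by positivity
    have hz : 0 < α * a / ((1 - α) * c') := by positivity
    have h1 := h _ _ hy hz
    have hyz : α * a / ((1 - α) * b') * (α * a / ((1 - α) * c')) =
        (α / (1 - α)) ^ 2 * (a / d) := by
      have : α * a / ((1 - α) * b') * (α * a / ((1 - α) * c')) =
        α ^ 2 * a ^ 2 / ((1 - α) ^ 2 * (b' * c')) := by field_simp
      rw [this, hbc']; field_simp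
    have h2 : a + b * (α * a / ((1 - α) * b')) + c * (α * a / ((1 - α) * c')) +
        d * ((α / (1 - α)) ^ 2 * (a / d)) ≤ a / (1 - α) ^ 2 := by
      calc _ ≤ a + b' * (α * a / ((1 - α) * b')) + c' * (α * a / ((1 - α) * c')) +
            d * ((α / (1 - α)) ^ 2 * (a / d)) := by gcongr
        _ = _ := by field_simp; ring
    rw [← Real.mul_rpow hy.le hz.le, hyz] at h1
    have hq : 0 < (α / (1 - α)) ^ 2 * (a / d) := by positivity
    set q := (α / (1 - α)) ^ 2 * (a / d) with hqdef
    have h3 : (a / (1 - α)) ^ (1 - α) * (d / α) ^ α ≤ a + d := by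
      have := Real.geom_mean_le_arith_mean2_weighted hβ.le hα.le
        (show 0 ≤ a / (1 - α) by positivity) (show 0 ≤ d / α by positivity) (by ring)
      rwa [mul_div_cancel₀ _ hβ.ne', mul_div_cancel₀ _ hα.ne'] at this
    have h4 : α ^ α * (1 - α) ^ (1 - α) * (a / (1 - α) ^ 2) =
        (a / (1 - α)) ^ (1 - α) * (d / α) ^ α * q ^ α := by
      have e1 : d / α * q = a / (1 - α) * (α / (1 - α)) := by rw [hqdef]; field_simp
      rw [mul_assoc _ ((d / α) ^ α), ← Real.mul_rpow (by positivity) hq.le, e1,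
        Real.mul_rpow (by positivity) (by positivity), ← mul_assoc,
        ← Real.rpow_add (by positivity), sub_add_cancel, Real.rpow_one,
        Real.div_rpow hα.le hβ.le, Real.rpow_sub hβ, Real.rpow_one]
      field_simp
    have hqα : 0 < q ^ α := Real.rpow_pos_of_pos hq _
    have hK : 0 < α ^ α * (1 - α) ^ (1 - α) := by positivity
    refine le_trans ?_ h3
    refine le_of_mul_le_mul_right ?_ hqα
    rw [← h4, mul_assoc]
    exact mul_le_mul_of_nonneg_left (h1.trans h2) hK.le
  · simp only [Real.rpow_one, sub_self, Real.rpow_zero, one_mul] at h ⊢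
    by_contra! hT
    have hTd : 0 < T - d := by linarith
    have hw : 0 < (a + b + c) / (T - d) + 1 := by positivity
    have h1 := h _ _ hw hw
    set w := (a + b + c) / (T - d) + 1 with hwdef
    have h2 : (T - d) * w = a + b + c + (T - d) := by rw [hwdef]; field_simp
    have h3 : 1 ≤ w := by
      rw [hwdef]; have : 0 ≤ (a + b + c) / (T - d) := by positivity
      linarith
    nlinarith

lemma rpow_mul_rpow_div_le {m y α s : ℝ} (hm : 0 < m) (hy : 0 < y) (hα : 0 < α) (hs : 0 ≤ s) :
    m ^ s * y ^ α / (α ^ α * s ^ s) ≤ (m + y) ^ (s + α) / (s + α) ^ (s + α) := by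
  rcases hs.eq_or_lt with rfl | hs
  · simp only [Real.rpow_zero, one_mul, mul_one, zero_add]
    gcongr
    linarith
  · have hsα : 0 < s + α := by positivity
    have h := Real.geom_mean_le_arith_mean2_weighted (w₁ := s / (s + α)) (w₂ := α / (s + α))
      (p₁ := m / s) (p₂ := y / α) (by positivity) (by positivity) (by positivity) (by positivity)
      (by field_simp)
    have e : s / (s + α) * (m / s) + α / (s + α) * (y / α) = (m + y) / (s + α) := by field_simp
    rw [e] at h
    have h' := Real.rpow_le_rpow (by positivity) h hsα.le
    rw [Real.mul_rpow (by positivity) (by positivity), ← Real.rpow_mul (by positivity),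
      ← Real.rpow_mul (by positivity), div_mul_cancel₀ _ hsα.ne', div_mul_cancel₀ _ hsα.ne',
      Real.div_rpow hm.le hs.le, Real.div_rpow hy.le hα.le,
      Real.div_rpow (by positivity) hsα.le] at h'
    refine le_trans (le_of_eq ?_) h'
    field_simp

/-- The infimum of `(m + y₁ + ⋯ + yⱼ) / (y₁ ⋯ yⱼ) ^ α` over positive `y₁, …, yⱼ`. -/
noncomputable def starCapacity (α m : ℝ) (j : ℕ) : ℝ :=
  m ^ (1 - j * α) / (α ^ (j * α) * (1 - j * α) ^ (1 - j * α))

lemma starCapacity_nonneg {α m : ℝ} {j : ℕ} (hα : 0 < α) (hm : 0 < m) (hj : j * α ≤ 1) :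
    0 ≤ starCapacity α m j := by
  have : 0 ≤ 1 - j * α := by linarith
  unfold starCapacity
  positivity

lemma starCapacity_succ_mul_le {α m y : ℝ} {j : ℕ} (hα : 0 < α) (hm : 0 < m) (hy : 0 < y)
    (hj : (j + 1 : ℕ) * α ≤ 1) :
    starCapacity α m (j + 1) * y ^ α ≤ starCapacity α (m + y) j := by
  have hs : 0 ≤ 1 - (j + 1 : ℕ) * α := by linarith
  have h := rpow_mul_rpow_div_le hm hy hα hs
  unfold starCapacity
  set s := 1 - (j + 1 : ℕ) * α with hsdef
  have e : 1 - j * α = s + α := by rw [hsdef]; push_cast; ring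
  have e' : ((j + 1 : ℕ) : ℝ) * α = j * α + α := by push_cast; ring
  rw [e, e', Real.rpow_add hα]
  have hp : 0 < α ^ (j * α) := by positivity
  calc _ = (m ^ s * y ^ α / (α ^ α * s ^ s)) / α ^ (j * α) := by
        rw [div_mul_eq_mul_div, div_div]; congr 1; ring
    _ ≤ ((m + y) ^ (s + α) / (s + α) ^ (s + α)) / α ^ (j * α) := by gcongr
    _ = _ := by rw [div_div]; congr 1; ring

lemma capacity_le_matchingSum {V : Type*} [Fintype V] [DecidableEq V] {β : Type*} (c : V → β)
    (hc : ∀ x y z : V, c x ≠ c y → c y ≠ c z → c x = c z) {α : ℝ} (hα : 0 < α) (hα1 : α ≤ 1)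
    (F : Finset (Sym2 V)) (hF : ∀ a b, s(a, b) ∈ F → c a ≠ c b)
    (hdeg : ∀ v, ({e ∈ F | v ∈ e}.card : ℝ) * α ≤ 1) (μ : V → ℝ) (hμ : ∀ v, 0 < μ v) :
    (α ^ α * (1 - α) ^ (1 - α)) ^ F.card * ∏ v, starCapacity α (μ v) {e ∈ F | v ∈ e}.card ≤
      matchingSum F μ Finset.univ := by
  induction F using Finset.induction_on generalizing μ with
  | empty => simp [starCapacity]
  | insert e F he ih =>
    induction e using Sym2.ind with | _ u v =>
    have hcuv : c u ≠ c v := hF u v (by simp)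
    have huv : u ≠ v := fun h => hcuv (congrArg c h)
    have hF₀ : ∀ a b, s(a, b) ∈ F → c a ≠ c b := fun a b h => hF a b (by simp [h])
    have hF' : ∀ e ∈ F, ¬ e.IsDiag := by
      intro e he
      induction e using Sym2.ind with | _ a b =>
      intro h
      exact hF₀ a b he (congrArg c (by simpa using h))
    have hdegle : ∀ w, {e ∈ F | w ∈ e}.card ≤ {e ∈ insert s(u, v) F | w ∈ e}.card := fun w =>
      Finset.card_le_card (Finset.filter_subset_filter _ (Finset.subset_insert _ _))
    have hdeg₀ : ∀ w, ({e ∈ F | w ∈ e}.card : ℝ) * α ≤ 1 := fun w =>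
      (mul_le_mul_of_nonneg_right (by exact_mod_cast hdegle w) hα.le).trans (hdeg w)
    have hdegmem : ∀ w, w ∈ s(u, v) →
        {e ∈ insert s(u, v) F | w ∈ e}.card = {e ∈ F | w ∈ e}.card + 1 := by
      intro w hw
      rw [Finset.filter_insert, if_pos hw, Finset.card_insert_of_notMem (by simp [he])]
    have hdegnot : ∀ w, w ∉ s(u, v) →
        {e ∈ insert s(u, v) F | w ∈ e}.card = {e ∈ F | w ∈ e}.card := by
      intro w hw
      rw [Finset.filter_insert, if_neg hw]
    have hcorr := (matchingSum_correlation c hc F hF₀ μ Finset.univ u (Finset.mem_univ _) v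
      (Finset.mem_univ _) huv).1 hcuv
    rw [matchingSum_insert he, if_pos (by simp), Finset.card_insert_of_notMem he, pow_succ',
      mul_assoc]
    refine mul_le_add_of_forall_mul_rpow_le (matchingSum_pos F hμ _) (matchingSum_pos F hμ _)
      (matchingSum_pos F hμ _).le (matchingSum_pos F hμ _).le hcorr hα hα1 fun y z hy hz => ?_
    set μ₁ := Function.update μ u (μ u + y) with hμ₁
    set μ₂ := Function.update μ₁ v (μ₁ v + z) with hμ₂
    have hμ₁v : μ₁ v = μ v := Function.update_of_ne huv.symm _ _
    have hμ₂pos : ∀ w, 0 < μ₂ w := by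
      intro w
      have h1 := hμ w
      have h2 := hμ u
      have h3 := hμ v
      rw [hμ₂, hμ₁v, hμ₁]
      simp only [Function.update_apply]
      split_ifs <;> positivity
    have hval : matchingSum F μ₂ Finset.univ = matchingSum F μ Finset.univ +
        matchingSum F μ (Finset.univ.erase u) * y + matchingSum F μ (Finset.univ.erase v) * z +
        matchingSum F μ ((Finset.univ.erase u).erase v) * (y * z) := by
      rw [hμ₂, matchingSum_update_add F hF' _ (Finset.mem_univ v), hμ₁,
        matchingSum_update_add F hF' _ (Finset.mem_univ u),
        matchingSum_update_add F hF' _ (show u ∈ Finset.univ.erase v by simp [huv]),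
        Finset.erase_right_comm]
      ring
    rw [← hval]
    refine le_trans ?_ (ih hF₀ hdeg₀ μ₂ hμ₂pos)
    rw [mul_assoc]
    have hK : 0 ≤ α ^ α * (1 - α) ^ (1 - α) := by
      have : 0 ≤ 1 - α := by linarith
      positivity
    refine mul_le_mul_of_nonneg_left ?_ (pow_nonneg hK _)
    have hg : y ^ α * z ^ α =
        ∏ w, ((if w = u then y ^ α else 1) * if w = v then z ^ α else 1) := by
      rw [Finset.prod_mul_distrib]; simp
    rw [hg, ← Finset.prod_mul_distrib]
    refine Finset.prod_le_prod (fun w _ => ?_) fun w _ => ?_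
    · refine mul_nonneg (starCapacity_nonneg hα (hμ w) (hdeg w)) (mul_nonneg ?_ ?_) <;>
        split_ifs <;> positivity
    · by_cases hwu : w = u
      · subst hwu
        have hd := hdeg w
        rw [hdegmem w (by simp)] at hd ⊢
        rw [if_pos rfl, if_neg huv, mul_one, hμ₂, Function.update_of_ne huv, hμ₁,
          Function.update_self]
        exact starCapacity_succ_mul_le hα (hμ w) hy hd
      · by_cases hwv : w = v
        · subst hwv
          have hd := hdeg w
          rw [hdegmem w (by simp)] at hd ⊢
          rw [if_pos rfl, if_neg hwu, one_mul, hμ₂, Function.update_self, hμ₁v]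
          exact starCapacity_succ_mul_le hα (hμ w) hz hd
        · rw [hdegnot w (by simp [hwu, hwv]), if_neg hwu, if_neg hwv, mul_one, mul_one, hμ₂,
            Function.update_of_ne hwv, hμ₁, Function.update_of_ne hwu]

end Capacity

section LogConcave

open Polynomial

/-- The coefficients are nonnegative and form a log-concave sequence without internal zeros. -/
def HasLogConcaveCoeffs (p : ℝ[X]) : Prop :=
  (∀ i, 0 ≤ p.coeff i) ∧
    ∀ i j, i ≤ j → p.coeff i * p.coeff (j + 1) ≤ p.coeff (i + 1) * p.coeff j

lemma HasLogConcaveCoeffs.C_mul {p : ℝ[X]} (hp : HasLogConcaveCoeffs p) {r : ℝ} (hr : 0 ≤ r) :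
    HasLogConcaveCoeffs (C r * p) := by
  refine ⟨fun i => by rw [coeff_C_mul]; exact mul_nonneg hr (hp.1 i), fun i j hij => ?_⟩
  simp only [coeff_C_mul]
  nlinarith [mul_le_mul_of_nonneg_left (hp.2 i j hij) (mul_nonneg hr hr)]

lemma HasLogConcaveCoeffs.X_sub_C_mul {p : ℝ[X]} (hp : HasLogConcaveCoeffs p) {r : ℝ}
    (hr : r ≤ 0) : HasLogConcaveCoeffs ((X - C r) * p) := by
  obtain ⟨s, hs, rfl⟩ : ∃ s : ℝ, 0 ≤ s ∧ r = -s := ⟨-r, by linarith, by ring⟩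
  have h0 : ((X - C (-s)) * p).coeff 0 = s * p.coeff 0 := by
    simp [coeff_zero_eq_eval_zero]
  have h1 : ∀ i, ((X - C (-s)) * p).coeff (i + 1) = p.coeff i + s * p.coeff (i + 1) := by
    intro i
    rw [sub_mul, coeff_sub, coeff_X_mul, coeff_C_mul]; ring
  obtain ⟨hnn, hlc⟩ := hp
  constructor
  · rintro (_ | i)
    · rw [h0]; exact mul_nonneg hs (hnn 0)
    · rw [h1]; exact add_nonneg (hnn i) (mul_nonneg hs (hnn _))
  · intro i j hij
    rcases hij.eq_or_lt with rfl | hij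
    · rw [mul_comm]
    obtain ⟨j, rfl⟩ : ∃ l, j = l + 1 := ⟨j - 1, by omega⟩
    have ha := mul_le_mul_of_nonneg_left (hlc i (j + 1) (by omega)) (mul_nonneg hs hs)
    rcases i with _ | i
    · rw [h0, h1, h1, h1]
      have hb := mul_nonneg (hnn 0) (hnn j)
      have hd := mul_nonneg hs (mul_nonneg (hnn 1) (hnn j))
      simp only [zero_add] at *
      linarith
    · rw [h1, h1, h1, h1]
      have hb := hlc i j (by omega)
      have hd := mul_le_mul_of_nonneg_left
        ((hlc i (j + 1) (by omega)).trans (hlc (i + 1) j (by omega))) hs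
      linarith

lemma hasLogConcaveCoeffs_of_splits {p : ℝ[X]} (hp : p.Splits) (hlead : 0 ≤ p.leadingCoeff)
    (hroots : ∀ x ∈ p.roots, x ≤ 0) : HasLogConcaveCoeffs p := by
  rw [hp.eq_prod_roots]
  refine HasLogConcaveCoeffs.C_mul ?_ hlead
  generalize p.roots = s at hroots
  induction s using Multiset.induction_on with
  | empty =>
    refine ⟨fun i => ?_, fun i j _ => ?_⟩
    · simp only [Multiset.map_zero, Multiset.prod_zero, coeff_one]
      split_ifs <;> norm_num
    · simp [coeff_one]
  | cons a s ih =>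
    rw [Multiset.map_cons, Multiset.prod_cons]
    exact (ih fun x hx => hroots x (Multiset.mem_cons_of_mem hx)).X_sub_C_mul
      (hroots a (Multiset.mem_cons_self a s))

/-- Choosing `x` so that `p.coeff k * x ^ k` is the largest term of `p.eval x` bounds
`p.coeff k` from below. -/
lemma HasLogConcaveCoeffs.le_mul_coeff {p : ℝ[X]} (hp : HasLogConcaveCoeffs p)
    (h0 : 0 < p.coeff 0) {n k : ℕ} (hk : 1 ≤ k) (hn : p.natDegree ≤ n) {T : ℝ} (hT : 0 < T)
    (h : ∀ x : ℝ, 0 < x → x ^ k * T ≤ p.eval x) : T ≤ (n + 1) * p.coeff k := by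
  obtain ⟨hnn, hlc⟩ := hp
  have hzero : ∀ i, p.coeff i = 0 → ∀ j, i ≤ j → p.coeff j = 0 := by
    intro i hi j hij
    induction j, hij using Nat.le_induction with
    | base => exact hi
    | succ j _ ih =>
      have := hlc 0 j (Nat.zero_le _)
      rw [ih, mul_zero] at this
      have := hnn (j + 1)
      nlinarith
  have hpos : 0 < p.coeff k := by
    refine (hnn k).lt_of_ne fun hk0 => ?_
    have hdeg : p.natDegree < k := by
      rw [natDegree_lt_iff_degree_lt (by rintro rfl; simp at h0), degree_lt_iff_coeff_zero]
      exact hzero k hk0.symm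
    obtain ⟨l, rfl⟩ : ∃ l, k = l + 1 := ⟨k - 1, by omega⟩
    set A := ∑ j ∈ Finset.range (l + 1), p.coeff j with hA
    have hA0 : 0 ≤ A := Finset.sum_nonneg fun i _ => hnn i
    have hx1 : 1 ≤ A / T + 1 := by
      have : 0 ≤ A / T := by positivity
      linarith
    have hx := h (A / T + 1) (by linarith)
    have hxT : (A / T + 1) * T = A + T := by field_simp
    set x := A / T + 1
    have h2 : p.eval x ≤ x ^ l * A := by
      rw [eval_eq_sum_range' hdeg, hA, Finset.mul_sum]
      refine Finset.sum_le_sum fun j hj => ?_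
      rw [mul_comm]
      exact mul_le_mul_of_nonneg_right
        (pow_le_pow_right₀ hx1 (by rw [Finset.mem_range] at hj; omega)) (hnn j)
    have hxl : 0 < x ^ l := by positivity
    rw [pow_succ, mul_assoc, hxT] at hx
    nlinarith
  obtain ⟨l, rfl⟩ : ∃ l, k = l + 1 := ⟨k - 1, by omega⟩
  have hpos' : 0 < p.coeff l :=
    (hnn l).lt_of_ne fun hl => hpos.ne' (hzero l hl.symm _ (by omega))
  set x := p.coeff l / p.coeff (l + 1) with hx
  have hx0 : 0 < x := by positivity
  have hxl : p.coeff l = x * p.coeff (l + 1) := by rw [hx]; field_simp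
  have hup : ∀ j, l + 1 ≤ j → p.coeff j * x ^ j ≤ p.coeff (l + 1) * x ^ (l + 1) := by
    intro j hj
    induction j, hj using Nat.le_induction with
    | base => exact le_rfl
    | succ j hj ih =>
      refine le_trans ?_ ih
      have h1 := hlc l j (by omega)
      rw [hxl] at h1
      have h2 : x * p.coeff (j + 1) ≤ p.coeff j := by
        refine le_of_mul_le_mul_left ?_ hpos
        linarith
      rw [pow_succ, mul_comm (x ^ j) x, ← mul_assoc, mul_comm (p.coeff (j + 1))]
      gcongr
  have hdown : ∀ i, i ≤ l + 1 →
      p.coeff (l + 1 - i) * x ^ (l + 1 - i) ≤ p.coeff (l + 1) * x ^ (l + 1) := by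
    intro i
    induction i with
    | zero => simp
    | succ i ih =>
      intro hi
      refine le_trans ?_ (ih (by omega))
      obtain ⟨j, hj⟩ : ∃ j, l + 1 - i = j + 1 := ⟨l - i, by omega⟩
      rw [show l + 1 - (i + 1) = j by omega, hj]
      have h1 := hlc j l (by omega)
      rw [hxl] at h1
      have h2 : p.coeff j ≤ x * p.coeff (j + 1) := by
        refine le_of_mul_le_mul_right ?_ hpos
        linarith
      rw [pow_succ, mul_comm (x ^ j) x, ← mul_assoc, mul_comm (p.coeff (j + 1))]
      gcongr
  have hmode : ∀ j, p.coeff j * x ^ j ≤ p.coeff (l + 1) * x ^ (l + 1) := by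
    intro j
    rcases le_total (l + 1) j with hj | hj
    · exact hup j hj
    · simpa [Nat.sub_sub_self hj] using hdown (l + 1 - j) (by omega)
  have hev := h x hx0
  rw [eval_eq_sum_range' (Nat.lt_succ_of_le hn)] at hev
  have hsum : ∑ j ∈ Finset.range (n + 1), p.coeff j * x ^ j ≤
      (n + 1) * (p.coeff (l + 1) * x ^ (l + 1)) := by
    refine (Finset.sum_le_sum fun j _ => hmode j).trans_eq ?_
    simp
  have hxk : 0 < x ^ (l + 1) := by positivity
  refine le_of_mul_le_mul_left ?_ hxk
  calc _ ≤ _ := hev.trans hsum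
    _ = _ := by ring

end LogConcave

section MatchingPolynomial

open Polynomial

variable {V : Type*}

open scoped Classical in
/-- The set of `k`-matchings formed by edges in `F`. -/
noncomputable def matchingsOfCard (F : Finset (Sym2 V)) (k : ℕ) : Finset (Finset (Sym2 V)) :=
  {s ∈ F.powerset | IsEdgeMatching s ∧ s.card = k}

/-- The matching generating polynomial, truncated at degree `n`. -/
noncomputable def matchingPoly (F : Finset (Sym2 V)) (n : ℕ) : ℝ[X] :=
  ∑ j ∈ Finset.range (n + 1), C ((matchingsOfCard F j).card : ℝ) * X ^ j

lemma coeff_matchingPoly (F : Finset (Sym2 V)) (n k : ℕ) :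
    (matchingPoly F n).coeff k = if k ≤ n then ((matchingsOfCard F k).card : ℝ) else 0 := by
  simp [matchingPoly, coeff_X_pow]

lemma coeff_matchingPoly_nonneg (F : Finset (Sym2 V)) (n k : ℕ) :
    0 ≤ (matchingPoly F n).coeff k := by
  rw [coeff_matchingPoly]; split_ifs <;> positivity

lemma coeff_zero_matchingPoly (F : Finset (Sym2 V)) (n : ℕ) : (matchingPoly F n).coeff 0 = 1 := by
  have : matchingsOfCard F 0 = {∅} := by
    ext s
    simp only [matchingsOfCard, Finset.mem_filter, Finset.mem_powerset, Finset.card_eq_zero,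
      Finset.mem_singleton]
    refine ⟨fun h => h.2.2, ?_⟩
    rintro rfl
    simp [IsEdgeMatching]
  simp [coeff_matchingPoly, this]

lemma natDegree_matchingPoly_le (F : Finset (Sym2 V)) (n : ℕ) :
    (matchingPoly F n).natDegree ≤ n := by
  rw [natDegree_le_iff_coeff_eq_zero]
  intro k hk
  rw [coeff_matchingPoly, if_neg (by omega)]

variable [Fintype V] [DecidableEq V]

lemma IsEdgeMatching.card_uncovered {s : Finset (Sym2 V)} (hs : IsEdgeMatching s)
    (hd : ∀ e ∈ s, ¬ e.IsDiag) :
    (Finset.univ.filter fun v : V => ∀ e ∈ s, v ∉ e).card + 2 * s.card = Fintype.card V := by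
  have h1 : (s.biUnion Sym2.toFinset).card = 2 * s.card := by
    rw [Finset.card_biUnion, Finset.sum_congr rfl fun e he =>
      Sym2.card_toFinset_of_not_isDiag e (hd e he), Finset.sum_const, smul_eq_mul, mul_comm]
    intro e he f hf hne
    change Disjoint _ _
    rw [Finset.disjoint_left]
    intro v hv hv'
    exact hs e he f hf hne v (Sym2.mem_toFinset.1 hv) (Sym2.mem_toFinset.1 hv')
  have h2 : (Finset.univ.filter fun v : V => ∀ e ∈ s, v ∉ e) = (s.biUnion Sym2.toFinset)ᶜ := by
    ext v; simp
  rw [h2, ← h1, Finset.card_compl_add_card]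

open scoped Classical in
lemma matchingSum_const {R : Type*} [CommRing R] (F : Finset (Sym2 V))
    (hF : ∀ e ∈ F, ¬ e.IsDiag) {n : ℕ} (hn : Fintype.card V = 2 * n) (t : R) :
    matchingSum F (fun _ => t) Finset.univ =
      ∑ j ∈ Finset.range (n + 1), ((matchingsOfCard F j).card : R) * t ^ (2 * (n - j)) := by
  have hcard : ∀ s ∈ F.powerset, IsEdgeMatching s →
      (Finset.univ.filter fun v : V => ∀ e ∈ s, v ∉ e).card + 2 * s.card = 2 * n := by
    intro s hs hm
    rw [← hn]
    exact hm.card_uncovered fun e he => hF e (Finset.mem_powerset.1 hs he)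
  have h1 : matchingSum F (fun _ => t) Finset.univ =
      ∑ s ∈ F.powerset with IsEdgeMatching s, t ^ (2 * (n - s.card)) := by
    unfold matchingSum
    rw [Finset.sum_filter]
    refine Finset.sum_congr rfl fun s hs => ?_
    by_cases hm : IsEdgeMatching s
    · rw [if_pos ⟨hm, by simp⟩, if_pos hm, Finset.prod_const]
      congr 1
      rw [Nat.mul_sub, ← hcard s hs hm, Nat.add_sub_cancel]
      congr!
    · rw [if_neg (fun h => hm h.1), if_neg hm]
  rw [h1, ← Finset.sum_fiberwise_of_maps_to (g := Finset.card) (t := Finset.range (n + 1))]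
  · refine Finset.sum_congr rfl fun j _ => ?_
    rw [← nsmul_eq_mul, ← Finset.sum_const]
    refine Finset.sum_congr (by ext s; simp [matchingsOfCard, and_assoc]) fun s hs => ?_
    rw [(Finset.mem_filter.1 hs).2.2]
  · intro s hs
    rw [Finset.mem_filter] at hs
    have := hcard s hs.1 hs.2
    rw [Finset.mem_range]
    omega

lemma matchingSum_const_eq_aeval {K : Type*} [Field K] [Algebra ℝ K] (F : Finset (Sym2 V))
    (hF : ∀ e ∈ F, ¬ e.IsDiag) {n : ℕ} (hn : Fintype.card V = 2 * n) {t : K} (ht : t ≠ 0) :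
    matchingSum F (fun _ => t) Finset.univ =
      t ^ (2 * n) * aeval ((t ^ 2)⁻¹) (matchingPoly F n) := by
  rw [matchingSum_const F hF hn, matchingPoly, map_sum, Finset.mul_sum]
  refine Finset.sum_congr rfl fun j hj => ?_
  have hj' : 2 * n = 2 * (n - j) + 2 * j := by rw [Finset.mem_range] at hj; omega
  rw [hj', pow_add]
  simp only [map_mul, map_pow, aeval_X, map_natCast, inv_pow, ← pow_mul]
  field_simp

lemma matchingPoly_splits (F : Finset (Sym2 V)) (hF : ∀ e ∈ F, ¬ e.IsDiag) {n : ℕ}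
    (hn : Fintype.card V = 2 * n) : (matchingPoly F n).Splits := by
  refine Splits.of_splits_map (algebraMap ℝ ℂ) (IsAlgClosed.splits _) fun z hz => ?_
  have hz0 : aeval z (matchingPoly F n) = 0 := by
    rw [aeval_def, ← eval_map]; exact (mem_roots'.1 hz).2
  have hz1 : z ≠ 0 := by
    rintro rfl
    simp [aeval_def, eval₂_at_zero, coeff_zero_matchingPoly] at hz0
  obtain ⟨s, hs⟩ := IsAlgClosed.exists_pow_nat_eq z⁻¹ (n := 2) (by norm_num)
  have key : ∀ t : ℂ, t ^ 2 = z⁻¹ → ¬ 0 < t.re := by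
    intro t ht htre
    have ht0 : t ≠ 0 := by rintro rfl; simp at htre
    refine matchingSum_ne_zero F hF (μ := fun _ => t) (fun _ => htre) Finset.univ ?_
    rw [matchingSum_const_eq_aeval F hF hn ht0, ht, inv_inv, hz0, mul_zero]
  have h1 := key s hs
  have h2 := key (-s) (by rw [neg_sq, hs])
  rw [Complex.neg_re] at h2
  have hre : s.re = 0 := by linarith
  have hs' : z = (((-(s.im ^ 2))⁻¹ : ℝ) : ℂ) := by
    rw [← inv_inv z, ← hs]
    have : s = s.im * Complex.I := by
      apply Complex.ext <;> simp [hre]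
    rw [this, mul_pow, Complex.I_sq]
    simp
  exact ⟨_, hs'.symm⟩

lemma matchingPoly_hasLogConcaveCoeffs (F : Finset (Sym2 V)) (hF : ∀ e ∈ F, ¬ e.IsDiag) {n : ℕ}
    (hn : Fintype.card V = 2 * n) : HasLogConcaveCoeffs (matchingPoly F n) := by
  refine hasLogConcaveCoeffs_of_splits (matchingPoly_splits F hF hn)
    (coeff_matchingPoly_nonneg F n _) fun x hx => ?_
  by_contra! hx0
  have h := (mem_roots'.1 hx).2
  rw [IsRoot.def, eval_eq_sum_range, Finset.sum_range_succ', coeff_zero_matchingPoly] at h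
  have : 0 ≤ ∑ j ∈ Finset.range (matchingPoly F n).natDegree,
      (matchingPoly F n).coeff (j + 1) * x ^ (j + 1) :=
    Finset.sum_nonneg fun j _ => mul_nonneg (coeff_matchingPoly_nonneg F n _) (by positivity)
  simp at h
  linarith

end MatchingPolynomial

lemma rpow_self_eq_exp {x : ℝ} (hx : 0 ≤ x) : x ^ x = Real.exp (x * Real.log x) := by
  rcases hx.eq_or_lt with rfl | hx
  · simp
  · rw [Real.rpow_def_of_pos hx, mul_comm]

lemma exp_Gammad_eq {d n : ℕ} (hd : 1 ≤ d) {p : ℝ} (hp : 0 < p) (hp1 : p ≤ 1) :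
    Real.exp (2 * n * Gammad d p) =
      ((p / d) ^ (p / d) * (1 - p / d) ^ (1 - p / d)) ^ (n * d) *
        (((p / d) ^ p * (1 - p) ^ (1 - p))⁻¹) ^ (2 * n) := by
  have hd0 : (0 : ℝ) < d := by exact_mod_cast hd
  have hα : 0 < p / d := by positivity
  have hα1 : p / d ≤ 1 := by
    rw [div_le_one hd0]
    exact hp1.trans (by exact_mod_cast hd)
  rw [rpow_self_eq_exp hα.le, rpow_self_eq_exp (sub_nonneg.2 hα1),
    rpow_self_eq_exp (sub_nonneg.2 hp1), Real.rpow_def_of_pos hα, ← Real.exp_add, ← Real.exp_add,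
    ← Real.exp_neg, ← Real.exp_nat_mul, ← Real.exp_nat_mul, ← Real.exp_add]
  congr 1
  unfold Gammad
  rw [Real.log_div hd0.ne' hp.ne', Real.log_div hp.ne' hd0.ne']
  push_cast
  field_simp
  ring

lemma matchCount_eq_card {V : Type*} [Fintype V] [DecidableEq V] (G : SimpleGraph V)
    [DecidableRel G.Adj] (k : ℕ) : matchCount G k = (matchingsOfCard G.edgeFinset k).card := by
  classical
  unfold matchCount
  rw [Nat.subtype_card]
  intro s
  rw [matchingsOfCard, Finset.mem_filter, Finset.mem_powerset, ← SimpleGraph.coe_edgeFinset,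
    Finset.coe_subset]
  unfold IsEdgeMatching
  tauto

/-- Effective form of Gurvits's theorem: `m_k(G) ≥ exp(2n·Γ_d(p))/(2n)` for a `d`-regular
bipartite simple graph on `2n` vertices, where `p = k/n`. -/
theorem gurvits_effective {V : Type*} [Fintype V] (d n : ℕ) (hd : 1 ≤ d) (hn : 1 ≤ n)
    (G : SimpleGraph V) [DecidableRel G.Adj]
    (hcard : Fintype.card V = 2 * n)
    (hreg : G.IsRegularOfDegree d) (hbip : G.Colorable 2)
    (k : ℕ) (hk1 : 1 ≤ k) (hkn : k ≤ n) (p : ℝ) (hp : p = (k : ℝ) / n) :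
    Real.exp (2 * n * Gammad d p) / (2 * n) ≤ (matchCount G k : ℝ) := by
  classical
  have hd0 : (0 : ℝ) < d := by exact_mod_cast hd
  have hd1 : (1 : ℝ) ≤ d := by exact_mod_cast hd
  have hn0 : (0 : ℝ) < n := by exact_mod_cast hn
  have hn1 : (1 : ℝ) ≤ n := by exact_mod_cast hn
  have hk0 : (0 : ℝ) < k := by exact_mod_cast hk1
  have hp0 : 0 < p := by rw [hp]; positivity
  have hp1 : p ≤ 1 := by
    rw [hp, div_le_one hn0]; exact_mod_cast hkn
  have hα : 0 < p / d := by positivity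
  have hα1 : p / d ≤ 1 := by
    rw [div_le_one hd0]; linarith
  have hdα : d * (p / d) = p := by field_simp
  have hF : ∀ e ∈ G.edgeFinset, ¬ e.IsDiag := fun e he =>
    G.not_isDiag_of_mem_edgeSet (SimpleGraph.mem_edgeFinset.1 he)
  have hdeg : ∀ v, {e ∈ G.edgeFinset | v ∈ e}.card = d := by
    intro v
    rw [← SimpleGraph.incidenceFinset_eq_filter, SimpleGraph.card_incidenceFinset_eq_degree,
      hreg v]
  have hcardE : G.edgeFinset.card = n * d := by
    have h := G.sum_degrees_eq_twice_card_edges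
    rw [Finset.sum_congr rfl fun v _ => hreg v, Finset.sum_const, Finset.card_univ, hcard,
      smul_eq_mul] at h
    linarith
  obtain ⟨c⟩ := hbip
  set T := Real.exp (2 * n * Gammad d p) with hT
  have hbound : ∀ x : ℝ, 0 < x → x ^ k * T ≤ (matchingPoly G.edgeFinset n).eval x := by
    intro x hx
    set t := (√x)⁻¹ with ht
    have ht0 : 0 < t := by positivity
    have htx : (t ^ 2)⁻¹ = x := by rw [ht, inv_pow, inv_inv, Real.sq_sqrt hx.le]
    clear_value t
    have h := capacity_le_matchingSum c (by intro x y z h1 h2; omega) hα hα1 G.edgeFinset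
      (fun a b h => c.valid (by simpa using h)) (by intro v; rw [hdeg, hdα]; exact hp1)
      (fun _ => t) (fun _ => ht0)
    rw [matchingSum_const_eq_aeval _ hF hcard ht0.ne', htx, hcardE] at h
    simp only [hdeg, Finset.prod_const, Finset.card_univ, hcard, starCapacity, hdα] at h
    have htp : (t ^ (1 - p)) ^ (2 * n) = t ^ (2 * n) * x ^ k := by
      rw [← Real.rpow_mul_natCast ht0.le]
      have : (1 - p) * ((2 * n : ℕ) : ℝ) = ((2 * (n - k) : ℕ) : ℝ) := by
        rw [hp]; push_cast [Nat.cast_sub hkn]; field_simp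
      rw [this, Real.rpow_natCast, show 2 * n = 2 * (n - k) + 2 * k by omega, pow_add, ← htx,
        inv_pow, ← pow_mul, mul_assoc, mul_inv_cancel₀ (by positivity), mul_one]
    rw [div_eq_mul_inv (t ^ (1 - p)), mul_pow (t ^ (1 - p)), htp] at h
    rw [hT, exp_Gammad_eq hd hp0 hp1]
    have htn : 0 < t ^ (2 * n) := by positivity
    refine le_of_mul_le_mul_left ?_ htn
    rw [← Polynomial.coe_aeval_eq_eval]
    refine le_trans (le_of_eq ?_) h
    ring
  have hmain := (matchingPoly_hasLogConcaveCoeffs G.edgeFinset hF hcard).le_mul_coeff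
    (by rw [coeff_zero_matchingPoly]; norm_num) hk1 (natDegree_matchingPoly_le _ n)
    (Real.exp_pos _) hbound
  rw [coeff_matchingPoly, if_pos hkn, ← matchCount_eq_card] at hmain
  rw [div_le_iff₀ (by positivity)]
  have : (0 : ℝ) ≤ matchCount G k := by positivity
  nlinarith
end

section
/- Let d ≥ 1 and n ≥ 1 be integers, let G be a d-regular bipartite simple graph on 2n vertices, and let 0 ≤ p ≤ 1 be a real number. Then Σ_{k=0}^{n} m_k(G) · ((p/d)·(1−p/d))^k · (1−p)^{2(n−k)} ≥ (1−p/d)^{nd}. -/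
namespace MonomerDimer

open Finset

variable {V : Type*}

/-- A finite set of pairwise disjoint non-loop edges. -/
def IsMatching (M : Finset (Sym2 V)) : Prop :=
  (∀ e ∈ M, ¬ e.IsDiag) ∧ ∀ e ∈ M, ∀ f ∈ M, e ≠ f → ∀ v, v ∈ e → v ∉ f

open Classical in
/-- The matchings of the complete graph on the vertex set `S`. -/
noncomputable def matchings (S : Finset V) : Finset (Finset (Sym2 V)) :=
  S.sym2.powerset.filter IsMatching

open Classical in
/-- The vertices of `S` not covered by `M`. -/
noncomputable def uncovered (S : Finset V) (M : Finset (Sym2 V)) : Finset V :=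
  S.filter fun v => ∀ e ∈ M, v ∉ e

/-- The monomer-dimer partition function on the vertex set `S` with edge weights `w` and
vertex activities `a`. -/
noncomputable def partitionFn (w : Sym2 V → ℝ) (a : V → ℝ) (S : Finset V) : ℝ :=
  ∑ M ∈ matchings S, (∏ e ∈ M, w e) * ∏ v ∈ uncovered S M, a v

lemma mem_matchings {S : Finset V} {M : Finset (Sym2 V)} :
    M ∈ matchings S ↔ (∀ e ∈ M, ∀ v ∈ e, v ∈ S) ∧ IsMatching M := by
  simp [matchings, Finset.subset_iff, Finset.mem_sym2_iff]

lemma mem_uncovered {S : Finset V} {M : Finset (Sym2 V)} {v : V} :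
    v ∈ uncovered S M ↔ v ∈ S ∧ ∀ e ∈ M, v ∉ e := by
  simp [uncovered]

lemma IsMatching.subset {M N : Finset (Sym2 V)} (hN : IsMatching N) (h : M ⊆ N) :
    IsMatching M :=
  ⟨fun e he => hN.1 e (h he), fun e he f hf => hN.2 e (h he) f (h hf)⟩

lemma partitionFn_congr {w w' : Sym2 V → ℝ} {a a' : V → ℝ} {S : Finset V}
    (hw : ∀ e : Sym2 V, (∀ v ∈ e, v ∈ S) → w e = w' e) (ha : ∀ v ∈ S, a v = a' v) :
    partitionFn w a S = partitionFn w' a' S := by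
  refine sum_congr rfl fun M hM => ?_
  congr 1
  · exact prod_congr rfl fun e he => hw e ((mem_matchings.1 hM).1 e he)
  · exact prod_congr rfl fun v hv => ha v (mem_uncovered.1 hv).1

lemma partitionFn_nonneg {w : Sym2 V → ℝ} {a : V → ℝ} (hw : ∀ e, 0 ≤ w e) (ha : ∀ v, 0 ≤ a v)
    (S : Finset V) : 0 ≤ partitionFn w a S :=
  sum_nonneg fun _ _ => mul_nonneg (prod_nonneg fun e _ => hw e) (prod_nonneg fun v _ => ha v)

lemma partitionFn_zero (a : V → ℝ) (S : Finset V) :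
    partitionFn (fun _ => 0) a S = ∏ v ∈ S, a v := by
  unfold partitionFn
  rw [sum_eq_single ∅]
  · rw [prod_empty, one_mul]
    exact prod_congr (by ext v; simp [mem_uncovered]) fun _ _ => rfl
  · intro M _ hM
    obtain ⟨e, he⟩ := nonempty_iff_ne_empty.2 hM
    rw [prod_eq_zero he rfl, zero_mul]
  · intro h
    exact absurd (mem_matchings.2 (by simp [IsMatching])) h

variable [DecidableEq V]

lemma insert_mem_matchings {S : Finset V} {u t : V} (hu : u ∉ S) (ht : t ∈ S)
    {M : Finset (Sym2 V)} (hM : M ∈ matchings (S.erase t)) :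
    insert s(u, t) M ∈ matchings (insert u S) := by
  rw [mem_matchings] at hM ⊢
  obtain ⟨h1, h2, h3⟩ := hM
  have hut : u ≠ t := fun h => hu (h ▸ ht)
  have huM : ∀ e ∈ M, u ∉ e := fun e he h => hu (mem_of_mem_erase (h1 e he u h))
  have htM : ∀ e ∈ M, t ∉ e := fun e he h => (notMem_erase t S) (h1 e he t h)
  refine ⟨?_, ?_, ?_⟩
  · intro e he v hv
    rcases mem_insert.1 he with rfl | he
    · rcases Sym2.mem_iff.1 hv with rfl | rfl <;> simp [ht]
    · exact mem_insert_of_mem (mem_of_mem_erase (h1 e he v hv))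
  · intro e he
    rcases mem_insert.1 he with rfl | he
    · simpa using hut
    · exact h2 e he
  · intro e he f hf hef v hve hvf
    rw [mem_insert] at he hf
    rcases he with rfl | he <;> rcases hf with rfl | hf
    · exact hef rfl
    · rcases Sym2.mem_iff.1 hve with rfl | rfl
      · exact huM f hf hvf
      · exact htM f hf hvf
    · rcases Sym2.mem_iff.1 hvf with rfl | rfl
      · exact huM e he hve
      · exact htM e he hve
    · exact h3 e he f hf hef v hve hvf

lemma matchings_insert {S : Finset V} {u : V} (hu : u ∉ S) :
    matchings (insert u S) =
      matchings S ∪ S.biUnion fun t => (matchings (S.erase t)).image (insert s(u, t)) := by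
  ext M
  simp only [mem_union, mem_biUnion, mem_image]
  constructor
  · intro hM
    obtain ⟨h1, hM⟩ := mem_matchings.1 hM
    by_cases hc : ∃ e ∈ M, u ∈ e
    · right
      obtain ⟨e, he, hue⟩ := hc
      obtain ⟨t, rfl⟩ := hue
      have htu : t ≠ u := fun h => hM.1 _ he (by simp [h])
      refine ⟨t, ?_, M.erase s(u, t), ?_, insert_erase he⟩
      · exact (mem_insert.1 (h1 _ he t (by simp))).resolve_left htu
      · refine mem_matchings.2 ⟨fun f hf v hv => ?_, hM.subset (erase_subset _ _)⟩
        obtain ⟨hfe, hf⟩ := mem_erase.1 hf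
        have := hM.2 f hf _ he hfe v hv
        rw [Sym2.mem_iff, not_or] at this
        exact mem_erase.2 ⟨this.2, (mem_insert.1 (h1 f hf v hv)).resolve_left this.1⟩
    · left
      push Not at hc
      refine mem_matchings.2 ⟨fun e he v hv => ?_, hM⟩
      exact (mem_insert.1 (h1 e he v hv)).resolve_left fun h => hc e he (h ▸ hv)
  · rintro (hM | ⟨t, ht, M, hM, rfl⟩)
    · obtain ⟨h1, hM⟩ := mem_matchings.1 hM
      exact mem_matchings.2 ⟨fun e he v hv => mem_insert_of_mem (h1 e he v hv), hM⟩
    · exact insert_mem_matchings hu ht hM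

lemma partitionFn_insert (w : Sym2 V → ℝ) (a : V → ℝ) {S : Finset V} {u : V} (hu : u ∉ S) :
    partitionFn w a (insert u S) =
      a u * partitionFn w a S + ∑ t ∈ S, w s(u, t) * partitionFn w a (S.erase t) := by
  have hnot : ∀ {S' : Finset V} {M : Finset (Sym2 V)} {v t : V}, v ∉ S' → M ∈ matchings S' →
      s(v, t) ∉ M := fun hv hM h => hv ((mem_matchings.1 hM).1 _ h _ (by simp))
  have huM : ∀ {t : V} {M : Finset (Sym2 V)}, M ∈ matchings (S.erase t) →
      ∀ t', s(u, t') ∉ M := fun hM t' => hnot (fun h => hu (mem_of_mem_erase h)) hM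
  unfold partitionFn
  rw [matchings_insert hu, sum_union, sum_biUnion, mul_sum]
  · congr 1
    · refine sum_congr rfl fun M hM => ?_
      have : uncovered (insert u S) M = insert u (uncovered S M) := by
        ext v
        simp only [mem_uncovered, mem_insert]
        constructor
        · tauto
        · rintro (rfl | h)
          · exact ⟨Or.inl rfl, fun e he h => hu ((mem_matchings.1 hM).1 e he _ h)⟩
          · tauto
      rw [this, prod_insert (fun h => hu (mem_uncovered.1 h).1)]
      ring
    · refine sum_congr rfl fun t ht => ?_
      rw [sum_image, mul_sum]
      · refine sum_congr rfl fun M hM => ?_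
        have : uncovered (insert u S) (insert s(u, t) M) = uncovered (S.erase t) M := by
          ext v
          simp only [mem_uncovered, mem_insert, mem_erase, forall_eq_or_imp, Sym2.mem_iff]
          constructor
          · tauto
          · rintro ⟨⟨h1, h2⟩, h3⟩
            refine ⟨Or.inr h2, ?_, h3⟩
            rintro (rfl | rfl)
            · exact hu h2
            · exact h1 rfl
        rw [this, prod_insert (huM hM t)]
        ring
      · intro M hM N hN h
        rw [← erase_insert (huM hM t), ← erase_insert (huM hN t)]
        exact congrArg (fun X => X.erase s(u, t)) h
  · intro t _ t' _ htt'
    rw [Function.onFun, disjoint_left]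
    intro M hM hM'
    obtain ⟨N, _, rfl⟩ := mem_image.1 hM
    obtain ⟨N', hN', h⟩ := mem_image.1 hM'
    have : s(u, t) ∈ insert s(u, t') N' := h ▸ mem_insert_self _ _
    rcases mem_insert.1 this with h | h
    · exact htt' (Sym2.congr_right.1 h)
    · exact huM hN' t h
  · rw [disjoint_left]
    intro M hM hM'
    obtain ⟨t, _, hM'⟩ := mem_biUnion.1 hM'
    obtain ⟨N, _, rfl⟩ := mem_image.1 hM'
    exact hnot hu hM (mem_insert_self _ _)

lemma partitionFn_update_activity (w : Sym2 V → ℝ) (a : V → ℝ) {S : Finset V} {u : V}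
    (hu : u ∉ S) (y : ℝ) :
    partitionFn w (Function.update a u (a u + y)) (insert u S) =
      partitionFn w a (insert u S) + y * partitionFn w a S := by
  have key : ∀ S' ⊆ S, partitionFn w (Function.update a u (a u + y)) S' = partitionFn w a S' :=
    fun S' hS' => partitionFn_congr (fun _ _ => rfl) fun v hv =>
      Function.update_of_ne (fun h : v = u => hu (hS' (h ▸ hv))) _ _
  rw [partitionFn_insert _ _ hu, partitionFn_insert _ _ hu, Function.update_self,
    key S subset_rfl, sum_congr rfl fun t _ => by rw [key _ (erase_subset t S)]]
  ring

lemma partitionFn_update_weight (w : Sym2 V → ℝ) (a : V → ℝ) {S : Finset V} {u v : V}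
    (hu : u ∉ S) (hv : v ∉ S) (huv : u ≠ v) (q : ℝ) :
    partitionFn (Function.update w s(u, v) (w s(u, v) + q)) a (insert u (insert v S)) =
      partitionFn w a (insert u (insert v S)) + q * partitionFn w a S := by
  have huS : u ∉ insert v S := by simp [huv, hu]
  have key : ∀ S' ⊆ insert v S,
      partitionFn (Function.update w s(u, v) (w s(u, v) + q)) a S' = partitionFn w a S' :=
    fun S' hS' => partitionFn_congr (fun e he => Function.update_of_ne
      (fun h : e = s(u, v) => huS (hS' (he u (h ▸ Sym2.mem_mk_left u v)))) _ _) fun _ _ => rfl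
  rw [partitionFn_insert _ _ huS, partitionFn_insert _ _ huS, key _ subset_rfl,
    sum_congr rfl fun t _ => by rw [key _ (erase_subset t _)],
    sum_insert hv, sum_insert hv, Function.update_self, erase_insert hv]
  have hne : ∀ t ∈ S, s(u, t) ≠ s(u, v) := fun t ht h => hv (by rwa [← Sym2.congr_right.1 h])
  rw [sum_congr rfl fun t ht => by rw [Function.update_of_ne (hne t ht)]]
  ring

/-- Heilmann–Lieb correlation inequality in a bipartite graph: deleting two vertices is
positively correlated for opposite colours and negatively correlated for equal colours. -/
lemma partitionFn_correlation {w : Sym2 V → ℝ} {a : V → ℝ} (hw : ∀ e, 0 ≤ w e)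
    {c : V → Prop} (hc : ∀ u v, w s(u, v) ≠ 0 → (c u ↔ ¬ c v)) :
    ∀ (n : ℕ) (S : Finset V), S.card = n → ∀ u v, u ∉ S → v ∉ S → u ≠ v →
      ((c u ↔ ¬ c v) → partitionFn w a (insert u S) * partitionFn w a (insert v S) ≤
        partitionFn w a (insert u (insert v S)) * partitionFn w a S) ∧
      ((c u ↔ c v) → partitionFn w a (insert u (insert v S)) * partitionFn w a S ≤
        partitionFn w a (insert u S) * partitionFn w a (insert v S)) := by
  intro n
  induction n with
  | zero =>
    intro S hS u v hu hv huv
    obtain rfl := card_eq_zero.1 hS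
    have huS : u ∉ insert v (∅ : Finset V) := by simpa using huv
    simp only [partitionFn_insert w a huS, partitionFn_insert w a hu, partitionFn_insert w a hv,
      sum_empty, sum_insert hv, erase_insert hv]
    refine ⟨fun _ => ?_, fun h => ?_⟩
    · nlinarith [mul_nonneg (hw s(u, v)) (mul_self_nonneg (partitionFn w a ∅))]
    · have : w s(u, v) = 0 := by
        by_contra h0
        have := hc u v h0
        tauto
      rw [this]
      exact le_of_eq (by ring)
  | succ n ih =>
    intro S hS u v hu hv huv
    have huS : u ∉ insert v S := by simp [huv, hu]
    have expand : partitionFn w a (insert u (insert v S)) * partitionFn w a S -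
        partitionFn w a (insert u S) * partitionFn w a (insert v S) =
        w s(u, v) * partitionFn w a S ^ 2 +
          ∑ t ∈ S, w s(u, t) * (partitionFn w a (insert v (S.erase t)) * partitionFn w a S -
            partitionFn w a (insert v S) * partitionFn w a (S.erase t)) := by
      rw [partitionFn_insert w a huS, partitionFn_insert w a hu, sum_insert hv, erase_insert hv]
      have : ∑ t ∈ S, w s(u, t) * partitionFn w a ((insert v S).erase t) =
          ∑ t ∈ S, w s(u, t) * partitionFn w a (insert v (S.erase t)) :=
        sum_congr rfl fun t ht => by rw [erase_insert_of_ne fun h => hv (by rw [h]; exact ht)]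
      rw [this]
      simp only [mul_sub, sum_sub_distrib, add_mul, sum_mul]
      have e1 : ∀ t, w s(u, t) * (partitionFn w a (insert v (S.erase t)) * partitionFn w a S) =
        w s(u, t) * partitionFn w a (insert v (S.erase t)) * partitionFn w a S := fun t => by ring
      have e2 : ∀ t, w s(u, t) * (partitionFn w a (insert v S) * partitionFn w a (S.erase t)) =
        w s(u, t) * partitionFn w a (S.erase t) * partitionFn w a (insert v S) := fun t => by ring
      simp only [e1, e2]
      ring
    have hih : ∀ t ∈ S, _ := fun t ht =>
      ih (S.erase t) (by rw [card_erase_of_mem ht, hS]; rfl) v t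
        (fun h => hv (mem_of_mem_erase h)) (notMem_erase t S) (fun h => hv (h ▸ ht))
    refine ⟨fun h => ?_, fun h => ?_⟩
    · rw [← sub_nonneg, expand]
      refine add_nonneg (mul_nonneg (hw _) (sq_nonneg _)) (sum_nonneg fun t ht => ?_)
      by_cases h0 : w s(u, t) = 0
      · simp [h0]
      · have h2 := (hih t ht).2 (by have := hc u t h0; tauto)
        rw [insert_erase ht] at h2
        exact mul_nonneg (hw _) (sub_nonneg.2 h2)
    · rw [← sub_nonpos, expand]
      have : w s(u, v) = 0 := by
        by_contra h0
        have := hc u v h0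
        tauto
      rw [this, zero_mul, zero_add]
      refine sum_nonpos fun t ht => ?_
      by_cases h0 : w s(u, t) = 0
      · simp [h0]
      · have h2 := (hih t ht).1 (by have := hc u t h0; tauto)
        rw [insert_erase ht] at h2
        exact mul_nonpos_of_nonneg_of_nonpos (hw _) (sub_nonpos.2 h2)

/-- The two-variable pairing inequality: a lower bound of monomial type for a positively
correlated bilinear polynomial bounds the sum of its extreme coefficients. -/
lemma pairing_bound_of_pos {A B C D x κ : ℝ} (hA : 0 < A) (hB : 0 < B)
    (hD : 0 < D) (hcor : B * C ≤ A * D) (hx0 : 0 < x) (hx1 : x < 1)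
    (h : ∀ y z : ℝ, 0 < y → 0 < z →
      κ * ((y / x) ^ x * (z / x) ^ x) ≤ A + B * y + C * z + D * (y * z)) :
    κ * (1 - x) ≤ A + x * (1 - x) * D := by
  have hr : 0 < 1 - x := sub_pos.2 hx1
  set r := 1 - x with hrdef
  have hxr : x = 1 - r := by rw [hrdef]; ring
  set s := A / (D * r ^ 2) with hs
  have hs0 : 0 < s := by positivity
  have h1 := h (x * (A / (B * r))) (x * (B / (D * r))) (by positivity) (by positivity)
  rw [mul_div_cancel_left₀ _ hx0.ne', mul_div_cancel_left₀ _ hx0.ne',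
    ← Real.mul_rpow (by positivity) (by positivity),
    show A / (B * r) * (B / (D * r)) = s by rw [hs]; field_simp] at h1
  have h2 : A + B * (x * (A / (B * r))) + C * (x * (B / (D * r))) +
      D * (x * (A / (B * r)) * (x * (B / (D * r)))) ≤ A / r ^ 2 := by
    have h3 : C * (x * (B / (D * r))) ≤ x * A / r := by
      rw [show C * (x * (B / (D * r))) = B * C * x / (D * r) by ring,
        div_le_div_iff₀ (by positivity) hr]
      nlinarith [mul_le_mul_of_nonneg_right hcor (mul_pos hx0 hr).le]
    have h4 : A + B * (x * (A / (B * r))) + x * A / r +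
        D * (x * (A / (B * r)) * (x * (B / (D * r)))) = A / r ^ 2 := by
      rw [hxr]
      field_simp
      ring
    linarith
  have h5 : (1 / s) ^ x ≤ r + x * (1 / s) := by
    have := Real.geom_mean_le_arith_mean2_weighted hx0.le hr.le (one_div_pos.2 hs0).le
      zero_le_one (by rw [hrdef]; ring)
    rw [Real.one_rpow] at this
    linarith
  have h6 : s ^ x * (1 / s) ^ x = 1 := by
    rw [← Real.mul_rpow hs0.le (by positivity), mul_one_div_cancel hs0.ne', Real.one_rpow]
  calc κ * r = κ * s ^ x * ((1 / s) ^ x * r) := by linear_combination (-κ * r) * h6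
    _ ≤ A / r ^ 2 * ((1 / s) ^ x * r) :=
        mul_le_mul_of_nonneg_right (h1.trans h2) (by positivity)
    _ ≤ A / r ^ 2 * ((r + x * (1 / s)) * r) := by gcongr
    _ = A + x * r * D := by
        rw [hs]
        field_simp

lemma pairing_bound {A B C D x κ : ℝ} (hA : 0 ≤ A) (hB : 0 ≤ B) (hC : 0 ≤ C) (hD : 0 ≤ D)
    (hcor : B * C ≤ A * D) (hx0 : 0 ≤ x) (hx1 : x ≤ 1)
    (h : ∀ y z : ℝ, 0 < y → 0 < z →
      κ * ((y / x) ^ x * (z / x) ^ x) ≤ A + B * y + C * z + D * (y * z)) :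
    κ * (1 - x) ≤ A + x * (1 - x) * D := by
  rcases hx1.eq_or_lt with rfl | hx1
  · simpa using hA
  refine le_of_forall_pos_le_add fun δ hδ => ?_
  rcases hx0.eq_or_lt with rfl | hx0
  · set y := δ / (B + C + D + δ) with hy
    have hy0 : 0 < y := by positivity
    have hy1 : y ≤ 1 := (div_le_one (by positivity)).2 (by linarith)
    have hyδ : (B + C + D) * y ≤ δ := by
      rw [hy, mul_div_assoc', div_le_iff₀ (by positivity)]
      nlinarith
    have := h y y hy0 hy0
    simp only [Real.rpow_zero, mul_one] at this
    nlinarith [mul_le_mul_of_nonneg_left hy1 (mul_nonneg hD hy0.le)]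
  · set ε := δ / 2 with hε
    have hε0 : 0 < ε := by positivity
    have hη : 0 < ε ^ 2 / (C + 1) := by positivity
    have key : κ * (1 - x) ≤ (A + ε) + x * (1 - x) * (D + ε) := by
      refine pairing_bound_of_pos (B := B + ε ^ 2 / (C + 1)) (C := C) (by positivity)
        (by positivity) (by positivity) ?_ hx0 hx1 fun y z hy hz => (h y z hy hz).trans ?_
      · have : ε ^ 2 / (C + 1) * C ≤ ε ^ 2 := by
          rw [div_mul_eq_mul_div, div_le_iff₀ (by positivity)]
          nlinarith [sq_nonneg ε]
        nlinarith [mul_nonneg hA hε0.le, mul_nonneg hD hε0.le]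
      · have h1 := mul_pos hη hy
        have h2 := mul_pos hε0 (mul_pos hy hz)
        linarith
    nlinarith [mul_nonneg hx0.le hε0.le, mul_nonneg (mul_nonneg hx0.le hx0.le) hε0.le]

/-- Weighted AM-GM with the missing weight placed on `1`. -/
lemma prod_rpow_le_one_sub_add {ι : Type*} (s : Finset ι) (w z : ι → ℝ) (hw : ∀ i ∈ s, 0 ≤ w i)
    (hz : ∀ i ∈ s, 0 ≤ z i) (hsum : ∑ i ∈ s, w i ≤ 1) :
    ∏ i ∈ s, z i ^ w i ≤ 1 - ∑ i ∈ s, w i + ∑ i ∈ s, w i * z i := by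
  have := Real.geom_mean_le_arith_mean_weighted (insertNone s)
    (fun o => o.elim (1 - ∑ i ∈ s, w i) w) (fun o => o.elim 1 z) ?_ ?_ ?_
  · simpa [prod_insertNone, sum_insertNone] using this
  · rintro (_ | i) hi
    · simpa using hsum
    · exact hw i (by simpa using hi)
  · simp [sum_insertNone]
  · rintro (_ | i) hi
    · simp
    · exact hz i (by simpa using hi)

variable [Fintype V]

/-- Edge weights when exactly the edges in `T` have been paired. -/
noncomputable def pairedWeight (x : Sym2 V → ℝ) (T : Finset (Sym2 V)) (e : Sym2 V) : ℝ :=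
  if e ∈ T then x e * (1 - x e) else 0

/-- Vertex activities when each edge `e` of `U` is cut into half-edges with variables `Y v e`. -/
noncomputable def cutActivity (x : Sym2 V → ℝ) (E U : Finset (Sym2 V))
    (Y : V → Sym2 V → ℝ) (v : V) : ℝ :=
  1 - (∑ e ∈ E, if v ∈ e then x e else 0) + ∑ e ∈ U, if v ∈ e then Y v e else 0

lemma cut_bound {E : Finset (Sym2 V)} {x : Sym2 V → ℝ} {c : V → Prop}
    (hE : ∀ u v, s(u, v) ∈ E → (c u ↔ ¬ c v)) (hx0 : ∀ e, 0 ≤ x e) (hx1 : ∀ e, x e ≤ 1)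
    (hsum : ∀ v, (∑ e ∈ E, if v ∈ e then x e else 0) ≤ 1)
    (T : Finset (Sym2 V)) (hT : T ⊆ E) (Y : V → Sym2 V → ℝ) (hY : ∀ v e, 0 < Y v e) :
    (∏ e ∈ T, (1 - x e)) *
        ∏ v, ∏ e ∈ E \ T, (if v ∈ e then (Y v e / x e) ^ x e else 1) ≤
      partitionFn (pairedWeight x T) (cutActivity x E (E \ T) Y) univ := by
  induction T using Finset.induction_on generalizing Y with
  | empty =>
    have h0 : pairedWeight x ∅ = fun _ => 0 := by ext e; simp [pairedWeight]
    rw [h0, partitionFn_zero, prod_empty, one_mul, sdiff_empty]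
    refine prod_le_prod (fun v _ => prod_nonneg fun e _ => ?_) fun v _ => ?_
    · split_ifs
      · exact Real.rpow_nonneg (div_nonneg (hY v e).le (hx0 e)) _
      · exact zero_le_one
    · have := prod_rpow_le_one_sub_add E (fun e => if v ∈ e then x e else 0)
        (fun e => Y v e / x e) (fun e _ => by split_ifs <;> simp [hx0])
        (fun e _ => div_nonneg (hY v e).le (hx0 e)) (hsum v)
      refine le_trans (le_of_eq (prod_congr rfl fun e _ => ?_)) (this.trans ?_)
      · split_ifs <;> simp
      · refine add_le_add le_rfl (sum_le_sum fun e _ => ?_)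
        split_ifs
        · rcases eq_or_ne (x e) 0 with h | h
          · simpa [h] using (hY v e).le
          · rw [mul_div_cancel₀ _ h]
        · simp
  | insert e T he ih =>
    have heE : e ∈ E := hT (mem_insert_self _ _)
    have ih := ih fun f hf => hT (mem_insert_of_mem hf)
    obtain ⟨U, hU⟩ : ∃ U, U = E \ insert e T := ⟨_, rfl⟩
    have heU : e ∉ U := by simp [hU]
    have hUT : E \ T = insert e U := by
      rw [hU, sdiff_insert, insert_erase (mem_sdiff.2 ⟨heE, he⟩)]
    rw [← hU]
    rw [hUT] at ih
    induction e using Sym2.ind with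
    | _ u v =>
    have hcuv := hE u v heE
    have huv : u ≠ v := by
      rintro rfl
      tauto
    obtain ⟨S, hS⟩ : ∃ S : Finset V, S = (univ.erase u).erase v := ⟨_, rfl⟩
    have huS : u ∉ S := by simp [hS]
    have hvS : v ∉ S := by simp [hS]
    have huniv : (univ : Finset V) = insert u (insert v S) := by
      rw [hS, insert_erase (by simpa using huv.symm), insert_erase (mem_univ u)]
    set a := cutActivity x E U Y with ha
    set w := pairedWeight x T with hw
    have hw0 : ∀ f, 0 ≤ w f := fun f => by
      simp only [hw, pairedWeight]
      split_ifs
      · exact mul_nonneg (hx0 f) (sub_nonneg.2 (hx1 f))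
      · exact le_rfl
    have ha0 : ∀ v', 0 ≤ a v' := fun v' => by
      refine add_nonneg (sub_nonneg.2 (hsum v')) (sum_nonneg fun f _ => ?_)
      split_ifs
      · exact (hY _ _).le
      · exact le_rfl
    have hweight : pairedWeight x (insert s(u, v) T) =
        Function.update w s(u, v) (w s(u, v) + x s(u, v) * (1 - x s(u, v))) := by
      ext f
      rcases eq_or_ne f s(u, v) with rfl | hf
      · simp [hw, pairedWeight, he]
      · simp [hw, pairedWeight, hf]
    rw [hweight, huniv, partitionFn_update_weight w a huS hvS huv, ← huniv, prod_insert he]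
    have hcor := (partitionFn_correlation (a := a) hw0 (c := c) (fun u' v' h => by
      refine hE u' v' (hT (mem_insert_of_mem ?_))
      by_contra h'
      exact h (by simp [hw, pairedWeight, h'])) _ S rfl u v huS hvS huv).1 hcuv
    rw [← huniv, mul_comm] at hcor
    set P := ∏ v', ∏ f ∈ U, (if v' ∈ f then (Y v' f / x f) ^ x f else 1) with hP
    have := pairing_bound (κ := (∏ f ∈ T, (1 - x f)) * P) (partitionFn_nonneg hw0 ha0 univ)
      (partitionFn_nonneg hw0 ha0 _) (partitionFn_nonneg hw0 ha0 _)
      (partitionFn_nonneg hw0 ha0 S) hcor (hx0 s(u, v)) (hx1 s(u, v)) fun y z hy hz => by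
        let Y' : V → Sym2 V → ℝ := fun v' f =>
          if f = s(u, v) then (if v' = u then y else z) else Y v' f
        have hne : ∀ f ∈ U, f ≠ s(u, v) := fun f hf h => heU (h ▸ hf)
        have hY' : ∀ v' f, 0 < Y' v' f := fun v' f => by
          simp only [Y']
          split_ifs
          exacts [hy, hz, hY v' f]
        have hact : cutActivity x E (insert s(u, v) U) Y' =
            Function.update (Function.update a v (a v + z)) u
              (Function.update a v (a v + z) u + y) := by
          ext v'
          have hrest : ∑ f ∈ U, (if v' ∈ f then Y' v' f else 0) =
              ∑ f ∈ U, if v' ∈ f then Y v' f else 0 :=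
            sum_congr rfl fun f hf => by simp [Y', hne f hf]
          rw [cutActivity, sum_insert heU, hrest]
          rcases eq_or_ne v' u with rfl | hu
          · simp [Y', ha, cutActivity, huv]
            ring
          · rcases eq_or_ne v' v with rfl | hv
            · simp [Y', ha, cutActivity, hu]
              ring
            · simp [ha, cutActivity, hu, hv]
        have hprod : ∏ v', ∏ f ∈ insert s(u, v) U,
            (if v' ∈ f then (Y' v' f / x f) ^ x f else 1) =
            ((y / x s(u, v)) ^ x s(u, v) * (z / x s(u, v)) ^ x s(u, v)) * P := by
          rw [hP]
          simp only [prod_insert heU, prod_mul_distrib]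
          congr 1
          · rw [← prod_filter, show univ.filter (fun v' => v' ∈ s(u, v)) = {u, v} by ext; simp,
              prod_pair huv]
            simp [Y', huv.symm]
          · exact prod_congr rfl fun v' _ => prod_congr rfl fun f hf => by simp [Y', hne f hf]
        have hvS' : v ∉ insert u S := by simp [huv.symm, hvS]
        have huS' : u ∉ insert v S := by simp [huv, huS]
        have h1 := ih Y' hY'
        rw [hprod, hact, huniv, partitionFn_update_activity _ _ huS', Finset.insert_comm,
          partitionFn_update_activity _ _ hvS', partitionFn_update_activity _ _ hvS,
          Finset.insert_comm, ← huniv] at h1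
        linarith
    linarith

/-- The Bethe lower bound for the monomer-dimer partition function of a bipartite graph at a
fractional matching `x`. -/
theorem prod_one_sub_le_partitionFn {E : Finset (Sym2 V)} {x : Sym2 V → ℝ} {c : V → Prop}
    (hE : ∀ u v, s(u, v) ∈ E → (c u ↔ ¬ c v)) (hx0 : ∀ e, 0 ≤ x e) (hx1 : ∀ e, x e ≤ 1)
    (hsum : ∀ v, (∑ e ∈ E, if v ∈ e then x e else 0) ≤ 1) :
    ∏ e ∈ E, (1 - x e) ≤
      partitionFn (fun e => if e ∈ E then x e * (1 - x e) else 0)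
        (fun v => 1 - ∑ e ∈ E, if v ∈ e then x e else 0) univ := by
  have h := cut_bound hE hx0 hx1 hsum E subset_rfl (fun _ _ => 1) fun _ _ => one_pos
  have ha : cutActivity x E ∅ (fun _ _ => 1) =
      fun v => 1 - ∑ e ∈ E, if v ∈ e then x e else 0 := by
    ext v
    simp [cutActivity]
  have hw : pairedWeight x E = fun e => if e ∈ E then x e * (1 - x e) else 0 := rfl
  simpa [ha, hw] using h

lemma IsMatching.card_uncovered {M : Finset (Sym2 V)} (hM : IsMatching M) :
    (uncovered univ M).card + 2 * M.card = Fintype.card V := by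
  have h1 : uncovered univ M = (M.biUnion Sym2.toFinset)ᶜ := by
    ext v
    simp [mem_uncovered]
  have h2 : (M.biUnion Sym2.toFinset).card = 2 * M.card := by
    rw [card_biUnion, sum_congr rfl fun e he => Sym2.card_toFinset_of_not_isDiag e (hM.1 e he),
      sum_const, smul_eq_mul, mul_comm]
    intro e he f hf hef
    rw [Function.onFun, disjoint_left]
    intro v hv hv'
    exact hM.2 e he f hf hef v (Sym2.mem_toFinset.1 hv) (Sym2.mem_toFinset.1 hv')
  rw [h1, ← h2, card_compl_add_card]

/-- With constant weights on a graph of even order, the partition function is the weighted sum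
of the matching numbers. -/
lemma partitionFn_eq_sum_matchCount (G : SimpleGraph V) [DecidableRel G.Adj] {n : ℕ}
    (hcard : Fintype.card V = 2 * n) (q a : ℝ) :
    partitionFn (fun e => if e ∈ G.edgeFinset then q else 0) (fun _ => a) univ =
      ∑ k ∈ range (n + 1), (matchCount G k : ℝ) * q ^ k * a ^ (2 * (n - k)) := by
  have hle : ∀ M : Finset (Sym2 V), IsMatching M → M.card ≤ n := fun M hM => by
    have := hM.card_uncovered
    omega
  have hmaps : ∀ M ∈ (matchings (univ : Finset V)).filter (· ⊆ G.edgeFinset),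
      M.card ∈ range (n + 1) := fun M hM => by
    rw [mem_filter, mem_matchings] at hM
    exact mem_range.2 (Nat.lt_succ_of_le (hle M hM.1.2))
  have hrestrict : partitionFn (fun e => if e ∈ G.edgeFinset then q else 0) (fun _ => a) univ =
      ∑ M ∈ (matchings (univ : Finset V)).filter (· ⊆ G.edgeFinset),
        q ^ M.card * a ^ (2 * (n - M.card)) := by
    rw [sum_filter]
    refine sum_congr rfl fun M hM => ?_
    have hM' := (mem_matchings.1 hM).2.card_uncovered
    rw [prod_const, show (uncovered univ M).card = 2 * (n - M.card) by omega]
    split_ifs with hMG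
    · rw [prod_congr rfl fun e he => if_pos (hMG he), prod_const]
    · obtain ⟨e, he, heG⟩ := not_subset.1 hMG
      rw [prod_eq_zero he (if_neg heG), zero_mul]
  rw [hrestrict, ← sum_fiberwise_of_maps_to hmaps]
  refine sum_congr rfl fun k _ => ?_
  have hcount : matchCount G k =
      (((matchings (univ : Finset V)).filter (· ⊆ G.edgeFinset)).filter
        (fun M => M.card = k)).card := by
    refine Nat.subtype_card _ fun M => ?_
    simp only [mem_filter, mem_matchings, mem_univ, implies_true, true_and, IsMatching]
    rw [← SimpleGraph.coe_edgeFinset, coe_subset]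
    have hdiag : M ⊆ G.edgeFinset → ∀ e ∈ M, ¬ e.IsDiag := fun h e he =>
      G.not_isDiag_of_mem_edgeFinset (h he)
    tauto
  rw [sum_congr rfl fun M hM => by rw [(mem_filter.1 hM).2], sum_const, hcount, nsmul_eq_mul,
    mul_assoc]

end MonomerDimer

/-- For a `d`-regular bipartite simple graph on `2n` vertices and any `0 ≤ p ≤ 1`:
`Σ_{k=0}^n m_k(G) ((p/d)(1-p/d))^k (1-p)^(2(n-k)) ≥ (1-p/d)^(nd)`. -/
theorem weighted_matching_sum_lower_bound {V : Type*} [Fintype V] (d n : ℕ) (hd : 1 ≤ d)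
    (hn : 1 ≤ n) (G : SimpleGraph V) [DecidableRel G.Adj]
    (hcard : Fintype.card V = 2 * n)
    (hreg : G.IsRegularOfDegree d) (hbip : G.Colorable 2)
    (p : ℝ) (hp0 : 0 ≤ p) (hp1 : p ≤ 1) :
    (1 - p / d) ^ (n * d) ≤
      ∑ k ∈ Finset.range (n + 1),
        (matchCount G k : ℝ) * ((p / d) * (1 - p / d)) ^ k * (1 - p) ^ (2 * (n - k)) := by
  classical
  have hd0 : (0 : ℝ) < d := by exact_mod_cast hd
  have hd1 : (1 : ℝ) ≤ d := by exact_mod_cast hd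
  obtain ⟨C⟩ := hbip
  have hE : ∀ u v, s(u, v) ∈ G.edgeFinset → (C u = 0 ↔ ¬ C v = 0) := fun u v h => by
    have : C u ≠ C v := C.valid (SimpleGraph.mem_edgeFinset.1 h)
    omega
  have hdeg : ∀ v, (∑ e ∈ G.edgeFinset, if v ∈ e then p / d else 0) = p := fun v => by
    rw [← Finset.sum_filter, Finset.sum_const, ← G.incidenceFinset_eq_filter,
      G.card_incidenceFinset_eq_degree, hreg v, nsmul_eq_mul, mul_div_cancel₀ _ hd0.ne']
  have hedges : G.edgeFinset.card = n * d := by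
    have := G.sum_degrees_eq_twice_card_edges
    rw [Finset.sum_congr rfl fun v _ => hreg v, Finset.sum_const, Finset.card_univ, hcard,
      smul_eq_mul, mul_assoc] at this
    omega
  have h := MonomerDimer.prod_one_sub_le_partitionFn (x := fun _ => p / d) hE
    (fun _ => by positivity) (fun _ => (div_le_one hd0).2 (hp1.trans hd1))
    (fun v => (hdeg v).trans_le hp1)
  simp only [hdeg] at h
  rwa [Finset.prod_const, hedges, MonomerDimer.partitionFn_eq_sum_matchCount G hcard] at h
end

section
/- Let a ≥ b ≥ 1 be integers and let G = (A,B,E) be a finite bipartite simple graph in which every vertex of A has degree a and every vertex of B has degree b (so |A| ≤ |B|). Let 1 ≤ k ≤ |A|, set p = 2k/v(G) where v(G) = |A|+|B|, set q = (a+b)p/(2b) = k/|A|, and let p_μ = binom(|A|,k)·q^k·(1−q)^{|A|−k}. Then m_k(G) ≥ p_μ · exp(v(G)·Γ_{a,b}(p)). -/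
/-- The binary entropy function `H(q) = -q ln q - (1-q) ln (1-q)`.
(In Lean, `Real.log 0 = 0`, so `H(0) = H(1) = 0` automatically.) -/
noncomputable def binEnt (q : ℝ) : ℝ :=
  -(q * Real.log q + (1 - q) * Real.log (1 - q))

/-- The entropy function `Γ_{a,b}(p)` of the infinite `(a,b)`-biregular tree. -/
noncomputable def Gammaab (a b : ℕ) (p : ℝ) : ℝ :=
  ((a : ℝ) / ((a : ℝ) + b)) * binEnt (((a : ℝ) + b) * p / (2 * a))
    + ((b : ℝ) / ((a : ℝ) + b)) * binEnt (((a : ℝ) + b) * p / (2 * b))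
    + (p / 2) * Real.log ((a : ℝ) * b)
    - ((a : ℝ) * b / ((a : ℝ) + b)) * binEnt (((a : ℝ) + b) * p / (2 * (a : ℝ) * b))

open Polynomial in
theorem splits_of_aeval_ne_zero {p : ℝ[X]} (h : ∀ z : ℂ, z.im ≠ 0 → aeval z p ≠ 0) :
    p.Splits := by
  refine Splits.of_splits_map (algebraMap ℝ ℂ) (IsAlgClosed.splits _) fun z hz => ?_
  have hz' : aeval z p = 0 := by
    have := (mem_roots'.1 hz).2
    rwa [IsRoot.def, eval_map_algebraMap] at this
  have him : z.im = 0 := by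
    by_contra hne
    exact h z hne hz'
  exact ⟨z.re, Complex.ext (by simp) (by simp [him])⟩

open Polynomial in
theorem multiset_prod_X_sub_C_eq (s : Multiset ℝ) (hs : (0 : ℝ) ∉ s) :
    (s.map fun r => X - C r).prod =
      C (s.map fun r => -r).prod * (s.map fun r => 1 + C (-r⁻¹) * X).prod := by
  induction s using Multiset.induction_on with
  | empty => simp
  | cons r s ih =>
    rw [Multiset.mem_cons, not_or] at hs
    have hr : r ≠ 0 := fun h => hs.1 h.symm
    have hX : (X - C r : ℝ[X]) = C (-r) * (1 + C (-r⁻¹) * X) := by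
      rw [mul_add, ← mul_assoc, ← C_mul, neg_mul_neg, mul_inv_cancel₀ hr]
      simp [sub_eq_neg_add]
    simp only [Multiset.map_cons, Multiset.prod_cons, ih hs.2, hX, C_mul]
    ring

open Polynomial in
theorem Polynomial.Splits.exists_eq_prod_one_add {p : ℝ[X]} (hp : p.Splits) {d : ℕ}
    (hd : p.natDegree ≤ d) (h0 : p.coeff 0 ≠ 0) :
    ∃ α : Fin d → ℝ, p = C (p.coeff 0) * ∏ i, (1 + C (α i) * X) := by
  have hroots : (0 : ℝ) ∉ p.roots := fun h =>
    h0 (by rw [coeff_zero_eq_eval_zero]; exact (mem_roots'.1 h).2)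
  have hform : p = C (p.leadingCoeff * (p.roots.map fun r => -r).prod) *
      (p.roots.map fun r => 1 + C (-r⁻¹) * X).prod := by
    rw [C_mul, mul_assoc, ← multiset_prod_X_sub_C_eq _ hroots]
    exact hp.eq_prod_roots
  have hc : p.coeff 0 = p.leadingCoeff * (p.roots.map fun r => -r).prod := by
    conv_lhs => rw [hform]
    simp [coeff_zero_eq_eval_zero, eval_multiset_prod]
  obtain ⟨l, hl⟩ : ∃ l : List ℝ, (l : Multiset ℝ) =
      p.roots.map (fun r => -r⁻¹) + Multiset.replicate (d - p.natDegree) 0 := Quot.exists_rep _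
  have hlen : l.length = d := by
    have := congrArg Multiset.card hl
    rw [Multiset.coe_card] at this
    rw [this, Multiset.card_add, Multiset.card_map, Multiset.card_replicate,
      ← hp.natDegree_eq_card_roots]
    omega
  subst hlen
  refine ⟨l.get, ?_⟩
  have hval : (Finset.univ.val.map l.get) =
      p.roots.map (fun r => -r⁻¹) + Multiset.replicate (l.length - p.natDegree) 0 := by
    rw [← hl, Fin.univ_val_map, List.ofFn_get]
  have : ∏ i, (1 + C (l.get i) * X) =
      ((Finset.univ.val.map l.get).map fun a => 1 + C a * X).prod := by
    rw [Multiset.map_map]; rfl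
  rw [this, hval, Multiset.map_add, Multiset.prod_add, Multiset.map_map, Multiset.map_replicate,
    hc]
  simpa using hform

open Polynomial in
theorem coeff_prod_one_add {ι : Type*} (s : Finset ι) (α : ι → ℝ) :
    (∏ i ∈ s, (1 + C (α i) * X)).coeff 0 = 1 ∧
    (∏ i ∈ s, (1 + C (α i) * X)).coeff 1 = ∑ i ∈ s, α i ∧
    2 * (∏ i ∈ s, (1 + C (α i) * X)).coeff 2 = (∑ i ∈ s, α i) ^ 2 - ∑ i ∈ s, α i ^ 2 := by
  classical
  induction s using Finset.induction_on with
  | empty => simp [coeff_one]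
  | insert a s ha ih =>
    obtain ⟨h0, h1, h2⟩ := ih
    simp only [Finset.prod_insert ha, Finset.sum_insert ha, add_mul, one_mul, coeff_add, mul_assoc,
      coeff_C_mul, coeff_X_mul_zero, coeff_X_mul, h0, h1]
    refine ⟨by ring, by ring, ?_⟩
    rw [mul_add, h2]
    ring

open Polynomial in
/-- **Newton's inequality** for the first three coefficients of a real-rooted polynomial. -/
theorem Polynomial.Splits.newton_zero {p : ℝ[X]} (hp : p.Splits) {d : ℕ}
    (hd : p.natDegree ≤ d) (h0 : p.coeff 0 ≠ 0) :
    2 * d * (p.coeff 0 * p.coeff 2) ≤ (d - 1) * p.coeff 1 ^ 2 := by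
  obtain ⟨α, hα⟩ := hp.exists_eq_prod_one_add hd h0
  obtain ⟨-, h1, h2⟩ := coeff_prod_one_add Finset.univ α
  have e1 : p.coeff 1 = p.coeff 0 * ∑ i, α i := by
    conv_lhs => rw [hα, coeff_C_mul, h1]
  have e2 : 2 * p.coeff 2 = p.coeff 0 * ((∑ i, α i) ^ 2 - ∑ i, α i ^ 2) := by
    rw [← h2]
    conv_lhs => rw [hα, coeff_C_mul]
    ring
  have hcs : (∑ i, α i) ^ 2 ≤ d * ∑ i, α i ^ 2 := by
    simpa using sq_sum_le_card_mul_sum_sq (s := Finset.univ) (f := α)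
  have : 2 * d * (p.coeff 0 * p.coeff 2) = d * p.coeff 0 * (2 * p.coeff 2) := by ring
  rw [this, e2, e1]
  nlinarith [mul_le_mul_of_nonneg_left hcs (sq_nonneg (p.coeff 0))]

open Polynomial in
theorem Polynomial.Splits.derivative_real {p : ℝ[X]} (hp : p.Splits) :
    (derivative p).Splits := by
  rcases Nat.eq_zero_or_pos p.natDegree with h | h
  · rw [eq_C_of_natDegree_eq_zero h]; simp
  · rw [splits_iff_card_roots]
    have h1 := card_roots_le_derivative p
    rw [← hp.natDegree_eq_card_roots] at h1
    have h2 := card_roots' (derivative p)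
    have h3 := natDegree_derivative_lt h.ne'
    omega

open Polynomial in
/-- **Newton's inequality** for the coefficients of a real-rooted polynomial. -/
theorem Polynomial.Splits.newton {p : ℝ[X]} (hp : p.Splits) {n : ℕ}
    (hd : p.natDegree ≤ n) {j : ℕ} (hj : j + 2 ≤ n) (h0 : p.coeff j ≠ 0) :
    ((n : ℝ) - j) * (j + 2) * (p.coeff j * p.coeff (j + 2)) ≤
      (n - j - 1) * (j + 1) * p.coeff (j + 1) ^ 2 := by
  have hs : (derivative^[j] p).Splits := by
    clear h0 hj
    induction j with
    | zero => exact hp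
    | succ j ih => rw [Function.iterate_succ_apply']; exact ih.derivative_real
  have hdeg : (derivative^[j] p).natDegree ≤ n - j :=
    (natDegree_iterate_derivative p j).trans (Nat.sub_le_sub_right hd j)
  have c0 : (derivative^[j] p).coeff 0 = (j.factorial : ℝ) * p.coeff j := by
    rw [coeff_iterate_derivative]; simp [Nat.descFactorial_self]
  have c1 : (derivative^[j] p).coeff 1 = ((j + 1) * j.factorial : ℝ) * p.coeff (j + 1) := by
    rw [coeff_iterate_derivative, add_comm 1 j, nsmul_eq_mul]
    congr 1
    have := Nat.factorial_mul_descFactorial (n := j + 1) (k := j) (by omega)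
    rw [Nat.add_sub_cancel_left, Nat.factorial_one, one_mul] at this
    rw [this, Nat.factorial_succ]; push_cast; ring
  have c2 : 2 * (derivative^[j] p).coeff 2 =
      ((j + 2) * (j + 1) * j.factorial : ℝ) * p.coeff (j + 2) := by
    rw [coeff_iterate_derivative, add_comm 2 j, nsmul_eq_mul, ← mul_assoc]
    congr 1
    have := Nat.factorial_mul_descFactorial (n := j + 2) (k := j) (by omega)
    rw [Nat.add_sub_cancel_left, Nat.factorial_two] at this
    have h2 : (2 : ℝ) * ((j + 2).descFactorial j : ℝ) = ((j + 2).factorial : ℝ) := by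
      exact_mod_cast this
    rw [h2, Nat.factorial_succ, Nat.factorial_succ]; push_cast; ring
  have hf : (0 : ℝ) < j.factorial := by exact_mod_cast j.factorial_pos
  have key := hs.newton_zero hdeg (by rw [c0]; exact mul_ne_zero hf.ne' h0)
  rw [Nat.cast_sub (by omega)] at key
  have e : 2 * ((n : ℝ) - j) * ((derivative^[j] p).coeff 0 * (derivative^[j] p).coeff 2) =
      (n - j) * (derivative^[j] p).coeff 0 * (2 * (derivative^[j] p).coeff 2) := by ring
  rw [e, c0, c1, c2] at key
  have hpos : 0 < (j.factorial : ℝ) ^ 2 * (j + 1) := by positivity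
  refine le_of_mul_le_mul_left ?_ hpos
  calc _ = _ := by ring
    _ ≤ _ := key
    _ = _ := by ring

open Polynomial in
theorem coeff_prod_one_add_nonneg {ι : Type*} (s : Finset ι) (α : ι → ℝ) (hα : ∀ i ∈ s, 0 ≤ α i)
    (j : ℕ) : 0 ≤ (∏ i ∈ s, (1 + C (α i) * X)).coeff j := by
  classical
  induction s using Finset.induction_on generalizing j with
  | empty => rw [Finset.prod_empty, coeff_one]; split_ifs <;> norm_num
  | insert a s ha ih =>
    have ih' := ih fun i hi => hα i (Finset.mem_insert_of_mem hi)
    have h := hα a (Finset.mem_insert_self a s)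
    rw [Finset.prod_insert ha, add_mul, one_mul, mul_assoc, coeff_add, coeff_C_mul]
    cases j with
    | zero => simpa using ih' 0
    | succ j =>
      rw [coeff_X_mul]
      exact add_nonneg (ih' _) (mul_nonneg h (ih' _))

open Polynomial in
theorem coeff_prod_one_add_pos {ι : Type*} (s : Finset ι) (α : ι → ℝ) (hα : ∀ i ∈ s, 0 < α i)
    {j : ℕ} (hj : j ≤ s.card) : 0 < (∏ i ∈ s, (1 + C (α i) * X)).coeff j := by
  classical
  induction s using Finset.induction_on generalizing j with
  | empty => obtain rfl : j = 0 := by simpa using hj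
             simp
  | insert a s ha ih =>
    have hs : ∀ i ∈ s, 0 < α i := fun i hi => hα i (Finset.mem_insert_of_mem hi)
    have h := hα a (Finset.mem_insert_self a s)
    rw [Finset.card_insert_of_notMem ha] at hj
    rw [Finset.prod_insert ha, add_mul, one_mul, mul_assoc, coeff_add, coeff_C_mul]
    cases j with
    | zero => simpa using ih hs (Nat.zero_le _)
    | succ j =>
      rw [coeff_X_mul]
      exact add_pos_of_nonneg_of_pos
        (coeff_prod_one_add_nonneg s α (fun i hi => (hs i hi).le) _)
        (mul_pos h (ih hs (by omega)))

/-- A positive log-concave sequence lies below the geometric sequence through two consecutive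
terms. -/
theorem logConcave_le_geometric {d : ℕ → ℝ} {n J : ℕ} (hpos : ∀ i ≤ n, 0 < d i)
    (hlc : ∀ i, i + 2 ≤ n → d i * d (i + 2) ≤ d (i + 1) ^ 2) (hJ : J + 1 ≤ n)
    {i : ℕ} (hi : i ≤ n) :
    d i * (d (J + 1) / d J) ^ (J + 1) ≤ d (J + 1) * (d (J + 1) / d J) ^ i := by
  set ρ := d (J + 1) / d J with hρ
  have hJ0 : 0 < d J := hpos J (by omega)
  have hρ0 : 0 < ρ := div_pos (hpos _ hJ) hJ0
  have hρJ : d (J + 1) = ρ * d J := by rw [hρ]; field_simp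
  have up : ∀ m, J + m + 1 ≤ n → d (J + m + 1) ≤ ρ * d (J + m) := by
    intro m
    induction m with
    | zero => intro _; exact hρJ.le
    | succ m ih =>
      intro hm
      have h1 := ih (by omega)
      have h2 := hlc (J + m) (by omega)
      have p0 := hpos (J + m) (by omega)
      have p1 := hpos (J + m + 1) (by omega)
      refine le_of_mul_le_mul_left ?_ p0
      calc d (J + m) * d (J + m + 2) ≤ d (J + m + 1) * d (J + m + 1) := by rw [← sq]; exact h2
        _ ≤ d (J + m + 1) * (ρ * d (J + m)) := by gcongr
        _ = d (J + m) * (ρ * d (J + m + 1)) := by ring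
  have up' : ∀ m, J + m + 1 ≤ n → d (J + m + 1) ≤ d (J + 1) * ρ ^ m := by
    intro m
    induction m with
    | zero => intro _; simp
    | succ m ih =>
      intro hm
      calc d (J + (m + 1) + 1) ≤ ρ * d (J + (m + 1)) := up (m + 1) hm
        _ ≤ ρ * (d (J + 1) * ρ ^ m) := by gcongr; exact ih (by omega)
        _ = _ := by ring
  have down : ∀ m i, i + m = J → ρ * d i ≤ d (i + 1) := by
    intro m
    induction m with
    | zero => rintro i rfl; exact hρJ.ge
    | succ m ih =>
      intro i him
      have h1 := ih (i + 1) (by omega)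
      have h2 := hlc i (by omega)
      have p0 := hpos i (by omega)
      have p1 := hpos (i + 1) (by omega)
      refine le_of_mul_le_mul_left ?_ p1
      calc d (i + 1) * (ρ * d i) = d i * (ρ * d (i + 1)) := by ring
        _ ≤ d i * d (i + 2) := by gcongr
        _ ≤ d (i + 1) * d (i + 1) := by rw [← sq]; exact h2
  have down' : ∀ m i, i + m = J + 1 → d i * ρ ^ m ≤ d (J + 1) := by
    intro m
    induction m with
    | zero => rintro i him; rw [← him]; simp
    | succ m ih =>
      intro i him
      calc d i * ρ ^ (m + 1) = (ρ * d i) * ρ ^ m := by ring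
        _ ≤ d (i + 1) * ρ ^ m := by gcongr; exact down m i (by omega)
        _ ≤ _ := ih (i + 1) (by omega)
  rcases le_total i (J + 1) with h | h
  · obtain ⟨m, hm⟩ := Nat.exists_eq_add_of_le h
    rw [hm, pow_add, mul_comm (ρ ^ i), ← mul_assoc, ← hm]
    exact mul_le_mul_of_nonneg_right (down' m i hm.symm) (by positivity)
  · obtain ⟨m, rfl⟩ := Nat.exists_eq_add_of_le h
    rw [pow_add ρ (J + 1) m, mul_comm (ρ ^ (J + 1)), ← mul_assoc, add_right_comm]
    exact mul_le_mul_of_nonneg_right (up' m (by omega)) (by positivity)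

open Polynomial in
theorem Polynomial.Splits.coeff_lower_bound {p : ℝ[X]} (hp : p.Splits) {n j : ℕ}
    (hd : p.natDegree ≤ n) (hpos : ∀ i ≤ n, 0 < p.coeff i) (hj : j < n) {D : ℝ}
    (hD : ∀ t : ℝ, 0 < t → D * t ^ j ≤ p.eval t) :
    (n.choose j : ℝ) * ((j : ℝ) / n) ^ j * (1 - (j : ℝ) / n) ^ (n - j) * D ≤ p.coeff j := by
  rcases j with _ | J
  · simp only [Nat.choose_zero_right, pow_zero, Nat.cast_zero, zero_div, sub_zero, one_pow,
      Nat.cast_one, one_mul, coeff_zero_eq_eval_zero]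
    refine ge_of_tendsto (f := fun t : ℝ => p.eval t) (x := nhdsWithin 0 (Set.Ioi 0)) ?_ ?_
    · exact p.continuous.continuousWithinAt
    · filter_upwards [self_mem_nhdsWithin] with t ht
      simpa using hD t ht
  set e : ℕ → ℝ := fun i => (n.choose i : ℝ) with he
  have epos : ∀ i ≤ n, 0 < e i := fun i hi => by
    simp only [he]; exact_mod_cast Nat.choose_pos hi
  set d : ℕ → ℝ := fun i => p.coeff i / e i with hdd
  have pe : ∀ i ≤ n, p.coeff i = e i * d i := fun i hi => by
    simp only [hdd]; rw [mul_div_cancel₀ _ (epos i hi).ne']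
  have dpos : ∀ i ≤ n, 0 < d i := fun i hi => div_pos (hpos i hi) (epos i hi)
  have erec : ∀ i < n, e (i + 1) * (i + 1) = e i * (n - i) := fun i hi => by
    have := Nat.choose_succ_right_eq n i
    simp only [he]
    rw [← Nat.cast_sub hi.le]
    exact_mod_cast this
  have hlc : ∀ i, i + 2 ≤ n → d i * d (i + 2) ≤ d (i + 1) ^ 2 := by
    intro i hi
    have key := hp.newton hd hi (hpos i (by omega)).ne'
    rw [pe i (by omega), pe (i + 1) (by omega), pe (i + 2) hi] at key
    have r0 := erec i (by omega)
    have r1 := erec (i + 1) (by omega)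
    push_cast at r1
    have hni : (0 : ℝ) < n - i - 1 := by
      have : ((i + 2 : ℕ) : ℝ) ≤ n := by exact_mod_cast hi
      push_cast at this; linarith
    have e1 := epos (i + 1) (by omega)
    have hc : 0 < e (i + 1) ^ 2 * ((i + 1) * (n - i - 1 : ℝ)) := by positivity
    refine le_of_mul_le_mul_left ?_ hc
    calc _ = (e (i + 1) * (i + 1)) * (e (i + 1) * (n - (i + 1))) * (d i * d (i + 2)) := by ring
      _ = (e i * (n - i)) * (e (i + 2) * (i + 1 + 1)) * (d i * d (i + 2)) := by rw [r0, ← r1]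
      _ = (n - i) * (i + 2) * (e i * d i * (e (i + 2) * d (i + 2))) := by ring
      _ ≤ _ := key
      _ = _ := by ring
  set ρ := d (J + 1) / d J with hρ
  have hρ0 : 0 < ρ := div_pos (dpos _ hj.le) (dpos _ (by omega))
  have hgeo : ∀ i ≤ n, d i * ρ ^ (J + 1) ≤ d (J + 1) * ρ ^ i := fun i hi =>
    logConcave_le_geometric dpos hlc hj.le hi
  have hn : (0 : ℝ) < n := by exact_mod_cast (by omega : 0 < n)
  have hjn : ((J + 1 : ℕ) : ℝ) < n := by exact_mod_cast hj
  have hj0 : (0 : ℝ) < ((J + 1 : ℕ) : ℝ) := by positivity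
  set τ : ℝ := ((J + 1 : ℕ) : ℝ) / (n - ((J + 1 : ℕ) : ℝ)) with hτ
  have hk0 : (0 : ℝ) < n - ((J + 1 : ℕ) : ℝ) := by linarith
  have hτ0 : 0 < τ := by positivity
  have heval : p.eval (τ / ρ) * ρ ^ (J + 1) ≤ d (J + 1) * (τ + 1) ^ n := by
    rw [eval_eq_sum_range' (Nat.lt_succ_of_le hd), add_pow, Finset.sum_mul, Finset.mul_sum]
    refine Finset.sum_le_sum fun i hi => ?_
    have hi' : i ≤ n := Nat.lt_succ_iff.1 (Finset.mem_range.1 hi)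
    rw [pe i hi', one_pow, mul_one]
    calc e i * d i * (τ / ρ) ^ i * ρ ^ (J + 1)
        = e i * (τ / ρ) ^ i * (d i * ρ ^ (J + 1)) := by ring
      _ ≤ e i * (τ / ρ) ^ i * (d (J + 1) * ρ ^ i) :=
        mul_le_mul_of_nonneg_left (hgeo i hi') (by have := epos i hi'; positivity)
      _ = _ := by rw [div_pow]; field_simp; simp only [he]; ring
  have hD' := hD (τ / ρ) (by positivity)
  have h1 : D * τ ^ (J + 1) ≤ d (J + 1) * (τ + 1) ^ n := by
    calc D * τ ^ (J + 1) = D * (τ / ρ) ^ (J + 1) * ρ ^ (J + 1) := by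
          rw [mul_assoc, ← mul_pow, div_mul_cancel₀ _ hρ0.ne']
      _ ≤ p.eval (τ / ρ) * ρ ^ (J + 1) := by gcongr
      _ ≤ _ := heval
  have hτ1 : τ + 1 = n / (n - ((J + 1 : ℕ) : ℝ)) := by rw [hτ]; field_simp; ring
  have h2 : ((J + 1 : ℕ) / (n : ℝ)) ^ (J + 1) * (1 - (J + 1 : ℕ) / (n : ℝ)) ^ (n - (J + 1))
      * (τ + 1) ^ n = τ ^ (J + 1) := by
    have a1 : (1 - (J + 1 : ℕ) / (n : ℝ)) * (τ + 1) = 1 := by rw [hτ1]; field_simp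
    have a2 : ((J + 1 : ℕ) / (n : ℝ)) * (τ + 1) = τ := by rw [hτ1, hτ]; field_simp
    have : (τ + 1) ^ n = (τ + 1) ^ (J + 1) * (τ + 1) ^ (n - (J + 1)) := by
      rw [← pow_add]; congr 1; omega
    rw [this]
    calc _ = ((J + 1 : ℕ) / (n : ℝ) * (τ + 1)) ^ (J + 1) *
          ((1 - (J + 1 : ℕ) / (n : ℝ)) * (τ + 1)) ^ (n - (J + 1)) := by
            rw [mul_pow, mul_pow]; ring
      _ = _ := by rw [a1, a2]; simp
  have h3 : ((J + 1 : ℕ) / (n : ℝ)) ^ (J + 1) * (1 - (J + 1 : ℕ) / (n : ℝ)) ^ (n - (J + 1)) * D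
      ≤ d (J + 1) := by
    refine le_of_mul_le_mul_right ?_ (by positivity : 0 < (τ + 1) ^ n)
    calc _ = D * (((J + 1 : ℕ) / (n : ℝ)) ^ (J + 1) * (1 - (J + 1 : ℕ) / (n : ℝ)) ^ (n - (J + 1))
      * (τ + 1) ^ n) := by ring
      _ ≤ _ := by rw [h2]; exact h1
  rw [pe _ hj.le]
  calc _ = e (J + 1) * (((J + 1 : ℕ) / (n : ℝ)) ^ (J + 1) *
        (1 - (J + 1 : ℕ) / (n : ℝ)) ^ (n - (J + 1)) * D) := by simp only [he]; ring
    _ ≤ _ := mul_le_mul_of_nonneg_left h3 (epos _ hj.le).le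

theorem prod_one_add_mul_le {b : ℕ} (hb : 1 ≤ b) (α : Fin b → ℝ) (hα : ∀ i, 0 ≤ α i) {y : ℝ}
    (hy : 0 ≤ y) : ∏ i, (1 + α i * y) ≤ (1 + (∑ i, α i) / b * y) ^ b := by
  have hb0 : (b : ℝ) ≠ 0 := by exact_mod_cast (by omega : b ≠ 0)
  have hz : ∀ i, 0 ≤ 1 + α i * y := fun i => by have := hα i; positivity
  have h := Real.geom_mean_le_arith_mean_weighted Finset.univ (fun _ : Fin b => (b : ℝ)⁻¹)
    (fun i => 1 + α i * y) (fun _ _ => by positivity) (by simp [hb0]) (fun i _ => hz i)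
  rw [Real.finsetProd_rpow _ _ (fun i _ => hz i)] at h
  have h2 : ∑ i, (b : ℝ)⁻¹ * (1 + α i * y) = 1 + (∑ i, α i) / b * y := by
    rw [← Finset.mul_sum, Finset.sum_add_distrib, ← Finset.sum_mul]
    simp; field_simp
  rw [h2] at h
  have hp : 0 ≤ ∏ i, (1 + α i * y) := Finset.prod_nonneg fun i _ => hz i
  have h3 := pow_le_pow_left₀ (by positivity) h b
  rwa [Real.rpow_inv_natCast_pow hp (by omega)] at h3

/-- The factor lost when a variable of degree `b` is eliminated from a capacity bound with
exponent `s`. -/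
noncomputable def capFactor (b s : ℝ) : ℝ := (1 - s / b) ^ (b - s) * (1 - s) ^ (-(1 - s))

theorem capFactor_mul_le_of_pos {b : ℕ} (hb : 1 ≤ b) {s β C c : ℝ} (hs0 : 0 < s) (hs1 : s ≤ 1)
    (hβ : 0 < β) (hc : 0 < c) (h : ∀ y : ℝ, 0 < y → C * y ^ s ≤ c * (1 + β * y) ^ b) :
    capFactor b s * C ≤ c * (1 + b * β) := by
  have hb1 : (1 : ℝ) ≤ b := by exact_mod_cast hb
  rcases lt_or_ge s (b : ℝ) with hsb | hsb
  · have hbs : 0 < b - s := by linarith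
    have hy : 0 < s / (β * (b - s)) := by positivity
    have h1 := h _ hy
    have e1 : 1 + β * (s / (β * (b - s))) = ((b - s) / b)⁻¹ := by field_simp; ring
    have e2 : (1 - s / b : ℝ) = (b - s) / b := by field_simp
    have hr : 0 < ((b : ℝ) - s) / b := by positivity
    set r : ℝ := ((b : ℝ) - s) / b with hrdef
    have e3 : s / (β * (b - s)) = (r * (b * β / s))⁻¹ := by rw [hrdef]; field_simp
    rw [e1, e3, Real.inv_rpow (by positivity), ← div_eq_mul_inv, inv_pow,
      Real.mul_rpow hr.le (by positivity), ← Real.rpow_natCast r b] at h1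
    have hX : 0 < (b * β / s) ^ s := by positivity
    have hR : 0 < r ^ s := by positivity
    have hB : 0 < r ^ (b : ℝ) := by positivity
    have h2 : C * r ^ ((b : ℝ) - s) ≤ c * (b * β / s) ^ s := by
      rw [div_le_iff₀ (by positivity)] at h1
      rw [Real.rpow_sub hr, mul_div_assoc', div_le_iff₀ hR]
      calc C * r ^ (b : ℝ) ≤ (c * (r ^ (b : ℝ))⁻¹ * (r ^ s * (b * β / s) ^ s)) * r ^ (b : ℝ) := by
            gcongr
        _ = _ := by field_simp
    have h3 : (1 - s) ^ (-(1 - s)) * (b * β / s) ^ s ≤ 1 + b * β := by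
      have := Real.geom_mean_le_arith_mean2_weighted (w₁ := 1 - s) (w₂ := s) (p₁ := (1 - s)⁻¹)
        (p₂ := b * β / s) (by linarith) hs0.le (inv_nonneg.2 (by linarith)) (by positivity)
        (by ring)
      rw [Real.rpow_neg (by linarith), ← Real.inv_rpow (by linarith)]
      refine this.trans (add_le_add (mul_inv_le_one) (le_of_eq ?_))
      field_simp
    have hS : 0 ≤ (1 - s) ^ (-(1 - s)) := Real.rpow_nonneg (by linarith) _
    unfold capFactor
    rw [e2]
    calc r ^ ((b : ℝ) - s) * (1 - s) ^ (-(1 - s)) * C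
        = (1 - s) ^ (-(1 - s)) * (C * r ^ ((b : ℝ) - s)) := by ring
      _ ≤ (1 - s) ^ (-(1 - s)) * (c * (b * β / s) ^ s) := by gcongr
      _ = c * ((1 - s) ^ (-(1 - s)) * (b * β / s) ^ s) := by ring
      _ ≤ _ := by gcongr
  · have hb' : (b : ℝ) = 1 := le_antisymm (hsb.trans hs1) hb1
    have hs' : s = 1 := le_antisymm hs1 (hb' ▸ hsb)
    have hbn : b = 1 := by exact_mod_cast hb'
    subst hbn
    have := h 1 one_pos
    simpa [capFactor, hs'] using this

theorem capFactor_mul_le {b : ℕ} (hb : 1 ≤ b) {s β C c : ℝ} (hs0 : 0 < s) (hs1 : s ≤ 1)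
    (hβ : 0 ≤ β) (hc : 0 < c) (h : ∀ y : ℝ, 0 < y → C * y ^ s ≤ c * (1 + β * y) ^ b) :
    capFactor b s * C ≤ c * (1 + b * β) := by
  refine le_of_forall_pos_le_add fun ε hε => ?_
  have hb1 : (0 : ℝ) < b := by exact_mod_cast (by omega : 0 < b)
  have hδ : 0 < ε / (b * c) := by positivity
  have := capFactor_mul_le_of_pos hb (β := β + ε / (b * c)) hs0 hs1 (by positivity) hc
    (C := C) fun y hy => (h y hy).trans (by gcongr; linarith)
  refine this.trans (le_of_eq ?_)
  field_simp
  ring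

open Polynomial in
theorem Polynomial.Splits.exists_eq_prod_one_add_of_nonneg {p : ℝ[X]} (hp : p.Splits) {d : ℕ}
    (hd : p.natDegree ≤ d) (hpos : ∀ y : ℝ, 0 ≤ y → 0 < p.eval y) :
    ∃ α : Fin d → ℝ, (∀ i, 0 ≤ α i) ∧ p = C (p.coeff 0) * ∏ i, (1 + C (α i) * X) := by
  have hc : 0 < p.coeff 0 := by rw [coeff_zero_eq_eval_zero]; exact hpos 0 le_rfl
  obtain ⟨α, hα⟩ := hp.exists_eq_prod_one_add hd hc.ne'
  refine ⟨α, fun i => ?_, hα⟩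
  by_contra! hi
  have h1 := hpos (-(α i)⁻¹) (neg_nonneg.2 (inv_nonpos.2 hi.le))
  rw [hα, eval_mul, eval_prod, Finset.prod_eq_zero (Finset.mem_univ i), mul_zero] at h1
  · exact lt_irrefl _ h1
  · simp [hi.ne]

open Polynomial in
theorem Polynomial.Splits.capFactor_mul_le_coeff {p : ℝ[X]} (hp : p.Splits) {b : ℕ} (hb : 1 ≤ b)
    (hd : p.natDegree ≤ b) (hpos : ∀ y : ℝ, 0 ≤ y → 0 < p.eval y) {s C : ℝ} (hs0 : 0 < s)
    (hs1 : s ≤ 1) (hC : ∀ y : ℝ, 0 < y → C * y ^ s ≤ p.eval y) :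
    capFactor b s * C ≤ p.coeff 0 + p.coeff 1 := by
  have hc : 0 < p.coeff 0 := by rw [coeff_zero_eq_eval_zero]; exact hpos 0 le_rfl
  obtain ⟨α, hα0, hα⟩ := hp.exists_eq_prod_one_add_of_nonneg hd hpos
  have heval : ∀ y, p.eval y = p.coeff 0 * ∏ i, (1 + α i * y) := fun y => by
    conv_lhs => rw [hα]
    simp [eval_prod]
  have e1 : p.coeff 1 = p.coeff 0 * ∑ i, α i := by
    conv_lhs => rw [hα, coeff_C_mul, (coeff_prod_one_add Finset.univ α).2.1]
  have hb1 : (b : ℝ) ≠ 0 := by exact_mod_cast (by omega : b ≠ 0)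
  have key := capFactor_mul_le hb hs0 hs1 (β := (∑ i, α i) / b) (C := C)
    (div_nonneg (Finset.sum_nonneg fun i _ => hα0 i) (Nat.cast_nonneg b)) hc fun y hy => by
      refine (hC y hy).trans ?_
      rw [heval]
      exact mul_le_mul_of_nonneg_left (prod_one_add_mul_le hb α hα0 hy.le) hc.le
  rw [mul_div_cancel₀ _ hb1] at key
  rw [e1]
  linarith

section BipartiteCount

variable {V : Type*} [DecidableEq V] (G : SimpleGraph V) [DecidableRel G.Adj]

/-- `coverCount G l T` counts the matchings between `T` and a subset of the list `l` which
saturate `T`. -/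
def coverCount : List V → Finset V → ℕ
  | [], T => if T = ∅ then 1 else 0
  | v :: l, T => coverCount l T + ∑ u ∈ T with G.Adj v u, coverCount l (T.erase u)

/-- The matching polynomial of the bipartite graph between `A` and the list `l`, where every
vertex `u ∈ A` left unmatched contributes the weight `z u`. -/
def bipMatchPoly {K : Type*} [CommRing K] (A : Finset V) (l : List V) (z : V → K) : K :=
  ∑ T ∈ A.powerset, (coverCount G l T : K) * ∏ u ∈ A \ T, z u

theorem map_bipMatchPoly {K L : Type*} [CommRing K] [CommRing L] (φ : K →+* L) (A : Finset V)
    (l : List V) (z : V → K) :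
    φ (bipMatchPoly G A l z) = bipMatchPoly G A l fun u => φ (z u) := by
  simp [bipMatchPoly, map_sum, map_prod]

theorem bipMatchPoly_nil {K : Type*} [CommRing K] (A : Finset V) (z : V → K) :
    bipMatchPoly G A [] z = ∏ u ∈ A, z u := by
  rw [bipMatchPoly, Finset.sum_eq_single ∅]
  · simp [coverCount]
  · intro T _ hT
    simp [coverCount, hT]
  · simp

theorem coverCount_empty (l : List V) : coverCount G l ∅ = 1 := by
  induction l with
  | nil => simp [coverCount]
  | cons v l ih => simp [coverCount, ih]

theorem bipMatchPoly_pos {A : Finset V} (l : List V) {z : V → ℝ} (hz : ∀ u ∈ A, 0 < z u) :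
    0 < bipMatchPoly G A l z := by
  have hprod : ∀ T, 0 < ∏ u ∈ A \ T, z u := fun T =>
    Finset.prod_pos fun u hu => hz u (Finset.mem_sdiff.1 hu).1
  refine Finset.sum_pos' (fun T _ => mul_nonneg (Nat.cast_nonneg _) (hprod T).le)
    ⟨∅, Finset.empty_mem_powerset A, ?_⟩
  rw [coverCount_empty, Nat.cast_one, one_mul]
  exact hprod ∅

/-- The restriction of `bipMatchPoly` to the line through `z` in the direction of the indicator
function of the neighbourhood of `v`. -/
noncomputable def bipMatchLine {K : Type*} [CommRing K] (A : Finset V) (l : List V) (v : V)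
    (z : V → K) : Polynomial K :=
  bipMatchPoly G A l fun u => Polynomial.C (z u) + if G.Adj v u then Polynomial.X else 0

open Polynomial in
theorem eval_bipMatchLine {K : Type*} [CommRing K] (A : Finset V) (l : List V) (v : V)
    (z : V → K) (y : K) :
    (bipMatchLine G A l v z).eval y =
      bipMatchPoly G A l fun u => z u + if G.Adj v u then y else 0 := by
  have := map_bipMatchPoly G (evalRingHom y) A l
    fun u => C (z u) + if G.Adj v u then X else 0
  rw [coe_evalRingHom] at this
  rw [bipMatchLine, this]
  congr 1
  funext u
  split_ifs <;> simp

open Polynomial in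
theorem natDegree_bipMatchLine_le {K : Type*} [CommRing K] (A : Finset V) (l : List V) (v : V)
    (z : V → K) : (bipMatchLine G A l v z).natDegree ≤ (A.filter (G.Adj v)).card := by
  refine natDegree_sum_le_of_forall_le _ _ fun T _ => ?_
  refine natDegree_mul_le.trans ?_
  rw [natDegree_natCast, zero_add]
  refine (natDegree_prod_le _ _).trans ?_
  rw [Finset.card_filter]
  refine (Finset.sum_le_sum (g := fun u => if G.Adj v u then 1 else 0) fun u _ => ?_).trans
    (Finset.sum_le_sum_of_subset Finset.sdiff_subset)
  split_ifs
  · exact (natDegree_add_le _ _).trans (by simp [natDegree_X_le])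
  · simp

open Polynomial in
theorem bipMatchPoly_cons {K : Type*} [CommRing K] (A : Finset V) (l : List V) (v : V)
    (z : V → K) :
    bipMatchPoly G A (v :: l) z =
      (bipMatchLine G A l v z).coeff 0 + (bipMatchLine G A l v z).coeff 1 := by
  have h0 : (bipMatchLine G A l v z).coeff 0 = bipMatchPoly G A l z := by
    rw [coeff_zero_eq_eval_zero, eval_bipMatchLine]
    simp
  have h1 : (bipMatchLine G A l v z).coeff 1 = ∑ T ∈ A.powerset, ∑ u ∈ A \ T with G.Adj v u,
      (coverCount G l T : K) * ∏ w ∈ (A \ T).erase u, z w := by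
    have : (bipMatchLine G A l v z).coeff 1 = (derivative (bipMatchLine G A l v z)).eval 0 := by
      rw [← coeff_zero_eq_eval_zero, coeff_derivative]; simp
    rw [this, bipMatchLine, bipMatchPoly, derivative_sum, eval_finsetSum]
    refine Finset.sum_congr rfl fun T _ => ?_
    rw [derivative_natCast_mul, derivative_prod_finset, eval_natCast_mul, eval_finsetSum,
      Finset.mul_sum, Finset.sum_filter]
    refine Finset.sum_congr rfl fun u _ => ?_
    have hev : ∀ w, eval 0 (C (z w) + if G.Adj v w then X else 0) = z w := fun w => by
      split_ifs <;> simp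
    rw [eval_mul, eval_prod]
    simp only [hev]
    split_ifs <;> simp
  rw [h0, h1, bipMatchPoly, bipMatchPoly]
  simp only [coverCount, Nat.cast_add, Nat.cast_sum, add_mul, Finset.sum_add_distrib,
    Finset.sum_mul]
  congr 1
  rw [Finset.sum_sigma', Finset.sum_sigma']
  refine Finset.sum_bij' (fun x _ => ⟨x.1.erase x.2, x.2⟩) (fun x _ => ⟨insert x.2 x.1, x.2⟩)
    ?_ ?_ ?_ ?_ ?_
  · rintro ⟨T, u⟩ h
    simp only [Finset.mem_sigma, Finset.mem_powerset, Finset.mem_filter, Finset.mem_sdiff] at h ⊢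
    exact ⟨(Finset.erase_subset _ _).trans h.1, ⟨h.1 h.2.1, Finset.notMem_erase u T⟩, h.2.2⟩
  · rintro ⟨T, u⟩ h
    simp only [Finset.mem_sigma, Finset.mem_powerset, Finset.mem_filter, Finset.mem_sdiff] at h ⊢
    exact ⟨Finset.insert_subset h.2.1.1 h.1, Finset.mem_insert_self _ _, h.2.2⟩
  · rintro ⟨T, u⟩ h
    simp only [Finset.mem_sigma, Finset.mem_filter] at h
    simp [Finset.insert_erase h.2.1]
  · rintro ⟨T, u⟩ h
    simp only [Finset.mem_sigma, Finset.mem_filter, Finset.mem_sdiff] at h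
    simp [Finset.erase_insert h.2.1.2]
  · rintro ⟨T, u⟩ h
    simp only [Finset.mem_sigma, Finset.mem_filter] at h
    have : (A \ T.erase u).erase u = A \ T := by
      ext w
      simp only [Finset.mem_erase, Finset.mem_sdiff]
      have := h.2.1
      grind
    simp only [this]

theorem Multiset.sum_map_im_pos {s : Multiset ℂ} (hs : s ≠ 0) {f : ℂ → ℂ}
    (hf : ∀ r ∈ s, 0 < (f r).im) : 0 < ((s.map f).sum).im := by
  induction s using Multiset.induction_on with
  | empty => exact absurd rfl hs
  | cons a s ih =>
    rw [Multiset.map_cons, Multiset.sum_cons, Complex.add_im]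
    have ha := hf a (Multiset.mem_cons_self a s)
    by_cases h : s = 0
    · simpa [h] using ha
    · exact add_pos ha (ih h fun r hr => hf r (Multiset.mem_cons_of_mem hr))

open Polynomial in
/-- Stability of `bipMatchPoly` in the half-planes `{z | 0 < Im (ω z)}`, `0 ≤ Im ω`. -/
theorem bipMatchPoly_ne_zero {ω : ℂ} (hω : 0 ≤ ω.im) (A : Finset V) (l : List V) {z : V → ℂ}
    (hz : ∀ u ∈ A, 0 < (ω * z u).im) : bipMatchPoly G A l z ≠ 0 := by
  induction l generalizing z with
  | nil =>
    rw [bipMatchPoly_nil, Finset.prod_ne_zero_iff]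
    intro u hu h
    simpa [h] using hz u hu
  | cons v l ih =>
    rw [bipMatchPoly_cons]
    set p := bipMatchLine G A l v z with hp
    have hroot : ∀ r : ℂ, 0 ≤ (ω * r).im → p.eval r ≠ 0 := by
      intro r hr
      rw [hp, eval_bipMatchLine]
      refine ih fun u hu => ?_
      rw [mul_add, Complex.add_im]
      have := hz u hu
      split_ifs
      · linarith
      · simpa using this
    have h0 : p.eval 0 ≠ 0 := hroot 0 (by simp)
    have hd := (IsAlgClosed.splits p).eval_derivative_eq_eval_mul_sum h0
    have e1 : (derivative p).eval 0 = p.coeff 1 := by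
      rw [← coeff_zero_eq_eval_zero, coeff_derivative]; simp
    rw [← e1, hd, coeff_zero_eq_eval_zero]
    intro hsum
    have hsum1 : (p.roots.map fun r => 1 / (0 - r)).sum = -1 :=
      mul_left_cancel₀ h0 (by linear_combination hsum)
    have hne : p.roots ≠ 0 := by
      intro h
      rw [h] at hsum1
      simp at hsum1
    have him := Multiset.sum_map_im_pos hne
      (f := fun r => (-(starRingEnd ℂ) ω) * (1 / (0 - r))) fun r hr => by
        have hr' : (ω * r).im < 0 := by
          by_contra! h
          exact hroot r h (mem_roots'.1 hr).2
        have hr0 : r ≠ 0 := by rintro rfl; simp at hr'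
        have hn : 0 < Complex.normSq r := Complex.normSq_pos.2 hr0
        have : (-(starRingEnd ℂ) ω) * (1 / (0 - r)) =
            (starRingEnd ℂ) (ω * r) * ((Complex.normSq r)⁻¹ : ℝ) := by
          rw [zero_sub, one_div, inv_neg, neg_mul_neg, Complex.inv_def, map_mul]
          ring
        rw [this, Complex.im_mul_ofReal, Complex.conj_im]
        exact mul_pos (by linarith) (inv_pos.2 hn)
    rw [Multiset.sum_map_mul_left, hsum1] at him
    simp at him
    linarith

open Polynomial in
theorem splits_bipMatchLine (A : Finset V) (l : List V) (v : V) {z : V → ℝ}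
    (hz : ∀ u ∈ A, 0 < z u) : (bipMatchLine G A l v z).Splits := by
  refine splits_of_aeval_ne_zero fun y hy => ?_
  have hmap : aeval y (bipMatchLine G A l v z) =
      bipMatchPoly G A l fun u => (z u : ℂ) + if G.Adj v u then y else 0 := by
    rw [bipMatchLine, ← AlgHom.coe_toRingHom, map_bipMatchPoly]
    congr 1
    funext u
    split_ifs <;> simp
  rw [hmap]
  obtain ⟨σ, hσ⟩ : ∃ σ : ℝ, 0 < σ * y.im := ⟨y.im, mul_self_pos.2 hy⟩
  set ε : ℝ := σ * y.im / (2 * (|y.re| + 1)) with hε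
  have hε0 : 0 < ε := by positivity
  have hεy : 0 < σ * y.im + ε * y.re := by
    have h1 : ε * (2 * (|y.re| + 1)) = σ * y.im := by rw [hε]; field_simp
    have h2 := neg_abs_le y.re
    have h3 := abs_nonneg y.re
    nlinarith
  refine bipMatchPoly_ne_zero G (ω := ⟨σ, ε⟩) hε0.le A l fun u hu => ?_
  have hzu := hz u hu
  split_ifs
  · have : ((⟨σ, ε⟩ : ℂ) * ((z u : ℂ) + y)).im = ε * z u + (σ * y.im + ε * y.re) := by
      simp [Complex.mul_im]; ring
    rw [this]
    positivity
  · have : ((⟨σ, ε⟩ : ℂ) * ((z u : ℂ) + 0)).im = ε * z u := by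
      simp [Complex.mul_im]
    rw [this]
    positivity

open Polynomial in
theorem splits_bipMatchPoly_X (A : Finset V) (l : List V) :
    (bipMatchPoly G A l fun _ => (X : ℝ[X])).Splits := by
  refine splits_of_aeval_ne_zero fun y hy => ?_
  have hmap : aeval y (bipMatchPoly G A l fun _ => (X : ℝ[X])) =
      bipMatchPoly G A l fun _ => y := by
    rw [← AlgHom.coe_toRingHom, map_bipMatchPoly]
    simp
  rw [hmap]
  refine bipMatchPoly_ne_zero G (ω := (y.im : ℂ)) (by simp) A l fun u _ => ?_
  rw [Complex.im_ofReal_mul]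
  exact mul_self_pos.2 hy

open Polynomial in
theorem coeff_bipMatchPoly_X {A : Finset V} (l : List V) {k : ℕ} (hk : k ≤ A.card) :
    (bipMatchPoly G A l fun _ => (X : ℝ[X])).coeff (A.card - k) =
      ((∑ T ∈ A.powersetCard k, coverCount G l T : ℕ) : ℝ) := by
  rw [bipMatchPoly, finsetSum_coeff, Nat.cast_sum, Finset.powersetCard_eq_filter,
    Finset.sum_filter]
  refine Finset.sum_congr rfl fun T hT => ?_
  have hT' := Finset.mem_powerset.1 hT
  have := Finset.card_le_card hT'
  rw [Finset.prod_const, Finset.card_sdiff_of_subset hT', ← C_eq_natCast, coeff_C_mul,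
    coeff_X_pow]
  by_cases h : T.card = k
  · simp [h]
  · rw [if_neg (by omega), if_neg h, mul_zero]

end BipartiteCount

section Counting

variable {V : Type*} {G : SimpleGraph V}

/-- `s` is a matching of `G` between `T` and a subset of the list `l` which saturates `T`. -/
structure IsSaturatingMatching (G : SimpleGraph V) (l : List V) (T : Finset V)
    (s : Finset (Sym2 V)) : Prop where
  mem_edgeSet : ∀ e ∈ s, e ∈ G.edgeSet
  card_eq : s.card = T.card
  disjoint : ∀ e ∈ s, ∀ f ∈ s, e ≠ f → ∀ v : V, v ∈ e → v ∉ f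
  exists_eq : ∀ e ∈ s, ∃ u ∈ T, ∃ w ∈ l, e = s(u, w)
  saturates : ∀ u ∈ T, ∃ e ∈ s, u ∈ e

namespace IsSaturatingMatching

variable {l : List V} {T : Finset V} {s : Finset (Sym2 V)}

theorem cons (h : IsSaturatingMatching G l T s) (v : V) :
    IsSaturatingMatching G (v :: l) T s where
  mem_edgeSet := h.mem_edgeSet
  card_eq := h.card_eq
  disjoint := h.disjoint
  exists_eq e he := by
    obtain ⟨u, hu, w, hw, rfl⟩ := h.exists_eq e he
    exact ⟨u, hu, w, List.mem_cons_of_mem _ hw, rfl⟩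
  saturates := h.saturates

theorem notMem_of_notMem (h : IsSaturatingMatching G l T s) {v : V} (hl : v ∉ l) (hT : v ∉ T)
    {e : Sym2 V} (he : e ∈ s) : v ∉ e := by
  obtain ⟨u, hu, w, hw, rfl⟩ := h.exists_eq e he
  rw [Sym2.mem_iff]
  rintro (rfl | rfl)
  exacts [hT hu, hl hw]

theorem insert_edge [DecidableEq V] {u v : V} (h : IsSaturatingMatching G l (T.erase u) s)
    (hu : u ∈ T) (hT : ∀ w ∈ v :: l, w ∉ T) (hv : v ∉ l) (huv : G.Adj v u) :
    IsSaturatingMatching G (v :: l) T (insert s(u, v) s) := by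
  have hv' : ∀ e ∈ s, v ∉ e := fun e he =>
    h.notMem_of_notMem hv (fun h' => hT v List.mem_cons_self (Finset.mem_of_mem_erase h')) he
  have hu' : ∀ e ∈ s, u ∉ e := fun e he =>
    h.notMem_of_notMem (fun h' => hT u (List.mem_cons_of_mem _ h') hu) (Finset.notMem_erase u T) he
  have hns : s(u, v) ∉ s := fun hs => hv' _ hs (Sym2.mem_mk_right u v)
  refine ⟨?_, ?_, ?_, ?_, ?_⟩
  · intro e he
    obtain rfl | he := Finset.mem_insert.1 he
    · exact huv.symm
    · exact h.mem_edgeSet e he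
  · rw [Finset.card_insert_of_notMem hns, h.card_eq, Finset.card_erase_add_one hu]
  · intro e he f hf hef w hwe hwf
    obtain rfl | he' := Finset.mem_insert.1 he <;> obtain rfl | hf' := Finset.mem_insert.1 hf
    · exact hef rfl
    · obtain rfl | rfl := Sym2.mem_iff.1 hwe
      exacts [hu' f hf' hwf, hv' f hf' hwf]
    · obtain rfl | rfl := Sym2.mem_iff.1 hwf
      exacts [hu' e he' hwe, hv' e he' hwe]
    · exact h.disjoint e he' f hf' hef w hwe hwf
  · intro e he
    obtain rfl | he := Finset.mem_insert.1 he
    · exact ⟨u, hu, v, List.mem_cons_self, rfl⟩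
    · obtain ⟨x, hx, w, hw, rfl⟩ := h.exists_eq e he
      exact ⟨x, Finset.mem_of_mem_erase hx, w, List.mem_cons_of_mem _ hw, rfl⟩
  · intro w hw
    by_cases hwu : w = u
    · exact ⟨s(u, v), Finset.mem_insert_self _ _, hwu ▸ Sym2.mem_mk_left u v⟩
    · obtain ⟨e, he, hwe⟩ := h.saturates w (Finset.mem_erase.2 ⟨hwu, hw⟩)
      exact ⟨e, Finset.mem_insert_of_mem he, hwe⟩

theorem eq_filter [DecidableEq V] (h : IsSaturatingMatching G l T s) {A : Finset V} (hT : T ⊆ A)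
    (hA : ∀ w ∈ l, w ∉ A) [DecidablePred fun u => ∃ e ∈ s, u ∈ e] :
    T = A.filter fun u => ∃ e ∈ s, u ∈ e := by
  ext u
  rw [Finset.mem_filter]
  refine ⟨fun hu => ⟨hT hu, h.saturates u hu⟩, ?_⟩
  rintro ⟨huA, e, he, hue⟩
  by_contra hu
  exact h.notMem_of_notMem (fun hl => hA u hl huA) hu he hue

end IsSaturatingMatching

open Classical in
theorem coverCount_le_card [Fintype V] [DecidableEq V] [DecidableRel G.Adj] {l : List V}
    (hl : l.Nodup) {T : Finset V} (hT : ∀ w ∈ l, w ∉ T) :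
    coverCount G l T ≤ (Finset.univ.filter (IsSaturatingMatching G l T)).card := by
  induction l generalizing T with
  | nil =>
    rw [coverCount]
    split_ifs with h
    · subst h
      exact Finset.card_pos.2 ⟨∅, by simp; constructor <;> simp⟩
    · exact Nat.zero_le _
  | cons v l ih =>
    obtain ⟨hv, hl⟩ := List.nodup_cons.1 hl
    have hT' : ∀ w ∈ l, w ∉ T := fun w hw => hT w (List.mem_cons_of_mem _ hw)
    have hvT : v ∉ T := hT v List.mem_cons_self
    set M := fun T' => Finset.univ.filter (IsSaturatingMatching G l T') with hM
    set N := fun u => (M (T.erase u)).image (insert s(u, v)) with hN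
    have hnot : ∀ T' ⊆ T, ∀ s ∈ M T', ∀ u, s(u, v) ∉ s := by
      intro T' hT'' s hs u hmem
      exact (Finset.mem_filter.1 hs).2.notMem_of_notMem hv (fun h => hvT (hT'' h)) hmem
        (Sym2.mem_mk_right u v)
    have hcardN : ∀ u, (N u).card = (M (T.erase u)).card := by
      intro u
      refine Finset.card_image_of_injOn fun s hs s' hs' h => ?_
      have h1 := hnot _ (Finset.erase_subset u T) s hs u
      have h2 := hnot _ (Finset.erase_subset u T) s' hs' u
      rw [← Finset.erase_insert h1, ← Finset.erase_insert h2]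
      exact congrArg (fun x => Finset.erase x s(u, v)) h
    have hdisj : Disjoint (M T) ((T.filter (G.Adj v)).biUnion N) := by
      rw [Finset.disjoint_biUnion_right]
      intro u _
      rw [Finset.disjoint_left]
      intro s hs hs'
      obtain ⟨s', -, rfl⟩ := Finset.mem_image.1 hs'
      exact hnot T subset_rfl _ hs u (Finset.mem_insert_self _ _)
    have hpd : ((T.filter (G.Adj v) : Finset V) : Set V).PairwiseDisjoint N := by
      intro u _ u' _ huu'
      rw [Function.onFun, Finset.disjoint_left]
      intro s hs hs'
      obtain ⟨s₁, -, rfl⟩ := Finset.mem_image.1 hs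
      obtain ⟨s₂, hs₂, he⟩ := Finset.mem_image.1 hs'
      have hmem : s(u, v) ∈ insert s(u', v) s₂ := he ▸ Finset.mem_insert_self _ _
      obtain h | h := Finset.mem_insert.1 hmem
      · exact huu' (Sym2.congr_left.1 h)
      · exact hnot _ (Finset.erase_subset u' T) s₂ hs₂ u h
    calc coverCount G (v :: l) T
        = coverCount G l T + ∑ u ∈ T with G.Adj v u, coverCount G l (T.erase u) := rfl
      _ ≤ (M T).card + ∑ u ∈ T with G.Adj v u, (N u).card := by
        refine add_le_add (ih hl hT') (Finset.sum_le_sum fun u _ => ?_)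
        rw [hcardN]
        exact ih hl fun w hw h => hT' w hw (Finset.mem_of_mem_erase h)
      _ = (M T ∪ (T.filter (G.Adj v)).biUnion N).card := by
        rw [Finset.card_union_of_disjoint hdisj, Finset.card_biUnion hpd]
      _ ≤ _ := by
        refine Finset.card_le_card fun s hs => Finset.mem_filter.2 ⟨Finset.mem_univ s, ?_⟩
        obtain hs | hs := Finset.mem_union.1 hs
        · exact (Finset.mem_filter.1 hs).2.cons v
        · obtain ⟨u, hu, hs⟩ := Finset.mem_biUnion.1 hs
          obtain ⟨s', hs', rfl⟩ := Finset.mem_image.1 hs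
          obtain ⟨huT, huv⟩ := Finset.mem_filter.1 hu
          exact (Finset.mem_filter.1 hs').2.insert_edge huT hT hv huv

open Classical in
theorem sum_coverCount_le_matchCount [Fintype V] [DecidableEq V] [DecidableRel G.Adj] {l : List V}
    (hl : l.Nodup) {A : Finset V} (hA : ∀ w ∈ l, w ∉ A) (k : ℕ) :
    ∑ T ∈ A.powersetCard k, coverCount G l T ≤ matchCount G k := by
  set M := fun T => Finset.univ.filter (IsSaturatingMatching G l T) with hM
  have hpd : ((A.powersetCard k : Finset (Finset V)) : Set (Finset V)).PairwiseDisjoint M := by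
    intro T hT T' hT' hne
    rw [Function.onFun, Finset.disjoint_left]
    intro s hs hs'
    refine hne ?_
    rw [(Finset.mem_filter.1 hs).2.eq_filter (Finset.mem_powersetCard.1 hT).1 hA,
      (Finset.mem_filter.1 hs').2.eq_filter (Finset.mem_powersetCard.1 hT').1 hA]
  calc ∑ T ∈ A.powersetCard k, coverCount G l T
      ≤ ∑ T ∈ A.powersetCard k, (M T).card := Finset.sum_le_sum fun T hT =>
        coverCount_le_card hl fun w hw h => hA w hw ((Finset.mem_powersetCard.1 hT).1 h)
    _ = ((A.powersetCard k).biUnion M).card := (Finset.card_biUnion hpd).symm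
    _ ≤ (Finset.univ.filter fun s : Finset (Sym2 V) => ↑s ⊆ G.edgeSet ∧ s.card = k ∧
          ∀ e ∈ s, ∀ f ∈ s, e ≠ f → ∀ v : V, v ∈ e → v ∉ f).card := by
        refine Finset.card_le_card fun s hs => ?_
        obtain ⟨T, hT, hs⟩ := Finset.mem_biUnion.1 hs
        have h := (Finset.mem_filter.1 hs).2
        exact Finset.mem_filter.2 ⟨Finset.mem_univ s, h.mem_edgeSet,
          h.card_eq.trans (Finset.mem_powersetCard.1 hT).2, h.disjoint⟩
    _ = matchCount G k := (Nat.subtype_card _ (by simp)).symm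

end Counting

theorem rpow_mul_prod_rpow_le {ι : Type*} {N : Finset ι} {a : ℕ} (ha : 1 ≤ a) (hN : N.card = a)
    {x : ι → ℝ} (hx : ∀ i ∈ N, 0 < x i) {q t : ℝ} (hq0 : 0 < q) (hq1 : q ≤ 1) (ht : 0 < t) :
    (t / (1 - q)) ^ (1 - q) * (a / q) ^ q * ∏ i ∈ N, x i ^ (q / a) ≤ t + ∑ i ∈ N, x i := by
  have ha' : (0 : ℝ) < a := by exact_mod_cast ha
  set S := ∑ i ∈ N, x i with hS
  have hS0 : 0 ≤ S := Finset.sum_nonneg fun i hi => (hx i hi).le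
  have h1 := Real.geom_mean_le_arith_mean_weighted N (fun _ => 1 / (a : ℝ)) x
    (fun _ _ => by positivity) (by simp [hN, ha'.ne']) fun i hi => (hx i hi).le
  rw [← Finset.mul_sum, ← hS] at h1
  have h0 : 0 ≤ ∏ i ∈ N, x i ^ (1 / (a : ℝ)) :=
    Finset.prod_nonneg fun i hi => Real.rpow_nonneg (hx i hi).le _
  have h2 : (a / q) ^ q * ∏ i ∈ N, x i ^ (q / a) ≤ (S / q) ^ q := by
    have : ∏ i ∈ N, x i ^ (q / a) = (∏ i ∈ N, x i ^ (1 / (a : ℝ))) ^ q := by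
      rw [← Real.finsetProd_rpow _ _ fun i hi => Real.rpow_nonneg (hx i hi).le _]
      refine Finset.prod_congr rfl fun i hi => ?_
      rw [← Real.rpow_mul (hx i hi).le]
      ring_nf
    rw [this, ← Real.mul_rpow (by positivity) h0]
    refine Real.rpow_le_rpow (by positivity) ?_ hq0.le
    rw [div_mul_eq_mul_div]
    refine div_le_div_of_nonneg_right ?_ hq0.le
    calc (a : ℝ) * ∏ i ∈ N, x i ^ (1 / (a : ℝ)) ≤ a * (1 / a * S) := by gcongr
      _ = S := by field_simp
  have hq1' : 0 ≤ 1 - q := sub_nonneg.2 hq1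
  have h3 := Real.geom_mean_le_arith_mean2_weighted hq1' hq0.le
    (div_nonneg ht.le hq1') (div_nonneg hS0 hq0.le) (by ring)
  rw [mul_div_cancel₀ S hq0.ne'] at h3
  have h4 : (1 - q) * (t / (1 - q)) ≤ t := by
    rcases hq1'.eq_or_lt with h | h
    · rw [← h, zero_mul]; exact ht.le
    · rw [mul_div_cancel₀ t h.ne']
  rw [mul_assoc]
  calc _ ≤ (t / (1 - q)) ^ (1 - q) * (S / q) ^ q := by gcongr
    _ ≤ _ := h3.trans (by linarith)

section Capacity

variable {V : Type*} [DecidableEq V] {G : SimpleGraph V} [DecidableRel G.Adj] {A B : Finset V}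
  {a b : ℕ}

theorem capFactor_pow_mul_le_bipMatchPoly (ha : 1 ≤ a) (hb : 1 ≤ b)
    (hA : ∀ u ∈ A, (B.filter fun v => G.Adj v u).card = a)
    (hB : ∀ v ∈ B, (A.filter (G.Adj v)).card = b) {q s t : ℝ} (hq0 : 0 < q) (hq1 : q ≤ 1)
    (ht : 0 < t) (hs : s = q / a * b) (hs1 : s ≤ 1) {l : List V} (hl : l.Nodup)
    (hlB : ∀ v ∈ l, v ∈ B) {x : V → ℝ} (hx : ∀ v, 0 < x v) :
    capFactor b s ^ l.length * (((t / (1 - q)) ^ (1 - q) * (a / q) ^ q) ^ A.card *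
        ∏ v ∈ B with v ∉ l, x v ^ s) ≤
      bipMatchPoly G A l fun u => t + ∑ v ∈ B with v ∉ l ∧ G.Adj v u, x v := by
  have ha' : (0 : ℝ) < a := by exact_mod_cast ha
  have hb' : (0 : ℝ) < b := by exact_mod_cast hb
  induction l generalizing x with
  | nil =>
    simp only [List.length_nil, pow_zero, one_mul, List.not_mem_nil, not_false_eq_true,
      Finset.filter_true, true_and, bipMatchPoly_nil]
    have hprod : ∏ v ∈ B, x v ^ s = ∏ u ∈ A, ∏ v ∈ B with G.Adj v u, x v ^ (q / a) := by
      rw [Finset.prod_comm' (t' := B) (s' := fun v => A.filter (G.Adj v)) (by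
        intro u v; simp only [Finset.mem_filter]; tauto)]
      refine Finset.prod_congr rfl fun v hv => ?_
      rw [Finset.prod_const, hB v hv, ← Real.rpow_mul_natCast (hx v).le, hs]
    rw [hprod, ← Finset.prod_const, ← Finset.prod_mul_distrib]
    have hq1' : 0 ≤ 1 - q := sub_nonneg.2 hq1
    exact Finset.prod_le_prod
      (fun u _ => mul_nonneg (by positivity)
        (Finset.prod_nonneg fun v _ => Real.rpow_nonneg (hx v).le _))
      fun u hu => rpow_mul_prod_rpow_le ha (hA u hu) (fun v _ => hx v) hq0 hq1 ht
  | cons v l ih =>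
    obtain ⟨hv, hl⟩ := List.nodup_cons.1 hl
    have hvB := hlB v List.mem_cons_self
    have hlB' : ∀ w ∈ l, w ∈ B := fun w hw => hlB w (List.mem_cons_of_mem _ hw)
    have hfilter : (B.filter fun w => w ∉ l) = insert v (B.filter fun w => w ∉ v :: l) := by
      ext w
      by_cases hw : w = v
      · subst hw; simp [hvB, hv]
      · simp [hw]
    have hnot : v ∉ B.filter fun w => w ∉ v :: l := by simp
    set z : V → ℝ := fun u => t + ∑ w ∈ B with w ∉ v :: l ∧ G.Adj w u, x w with hz
    have hz0 : ∀ u, 0 < z u := fun u =>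
      add_pos_of_pos_of_nonneg ht (Finset.sum_nonneg fun w _ => (hx w).le)
    have hs0 : 0 < s := by rw [hs]; positivity
    rw [bipMatchPoly_cons, List.length_cons, pow_succ']
    rw [mul_assoc]
    refine (splits_bipMatchLine G A l v fun u _ => hz0 u).capFactor_mul_le_coeff hb
      ((natDegree_bipMatchLine_le G A l v z).trans_eq (hB v hvB)) ?_ hs0 hs1 ?_
    · intro y hy
      rw [eval_bipMatchLine]
      refine bipMatchPoly_pos G l fun u _ => add_pos_of_pos_of_nonneg (hz0 u) ?_
      split_ifs
      exacts [hy, le_rfl]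
    · intro y hy
      have hx' : ∀ w, 0 < Function.update x v y w := fun w => by
        rw [Function.update_apply]
        split_ifs
        exacts [hy, hx w]
      have hne : ∀ w ∈ B.filter fun w => w ∉ v :: l, Function.update x v y w = x w := by
        intro w hw
        exact Function.update_of_ne (by rintro rfl; exact hnot hw) _ _
      have key := ih hl hlB' hx'
      have hp : ∏ w ∈ B with w ∉ l, Function.update x v y w ^ s =
          y ^ s * ∏ w ∈ B with w ∉ v :: l, x w ^ s := by
        rw [hfilter, Finset.prod_insert hnot, Function.update_self]
        congr 1
        exact Finset.prod_congr rfl fun w hw => by rw [hne w hw]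
      have hsum : ∀ u, t + ∑ w ∈ B with w ∉ l ∧ G.Adj w u, Function.update x v y w =
          z u + if G.Adj v u then y else 0 := by
        intro u
        rw [← Finset.filter_filter, Finset.sum_filter, hfilter, Finset.sum_insert hnot,
          Function.update_self]
        simp only [hz]
        have hcongr : (∑ w ∈ B with w ∉ v :: l,
            if G.Adj w u then Function.update x v y w else 0) =
              ∑ w ∈ B with w ∉ v :: l, if G.Adj w u then x w else 0 :=
          Finset.sum_congr rfl fun w hw => by rw [hne w hw]
        rw [← Finset.filter_filter, Finset.sum_filter _ x, hcongr]
        ring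
      rw [hp] at key
      simp only [hsum] at key
      rw [eval_bipMatchLine]
      linarith

theorem capFactor_pow_mul_le_eval (ha : 1 ≤ a) (hb : 1 ≤ b)
    (hA : ∀ u ∈ A, (B.filter fun v => G.Adj v u).card = a)
    (hB : ∀ v ∈ B, (A.filter (G.Adj v)).card = b) {q s t : ℝ} (hq0 : 0 < q) (hq1 : q ≤ 1)
    (ht : 0 < t) (hs : s = q / a * b) (hs1 : s ≤ 1) :
    capFactor b s ^ B.card * ((t / (1 - q)) ^ (1 - q) * (a / q) ^ q) ^ A.card ≤
      (bipMatchPoly G A B.toList fun _ => (Polynomial.X : Polynomial ℝ)).eval t := by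
  have h := capFactor_pow_mul_le_bipMatchPoly ha hb hA hB hq0 hq1 ht hs hs1 B.nodup_toList
    (fun v hv => Finset.mem_toList.1 hv) (x := fun _ => 1) fun _ => one_pos
  have hev := map_bipMatchPoly G (Polynomial.evalRingHom t) A B.toList
    fun _ => (Polynomial.X : Polynomial ℝ)
  rw [Polynomial.coe_evalRingHom] at hev
  rw [hev]
  have hempty : ∀ u, (B.filter fun v => v ∉ B.toList ∧ G.Adj v u) = ∅ := fun u =>
    Finset.filter_eq_empty_iff.2 fun v hv h => h.1 (Finset.mem_toList.2 hv)
  simp only [hempty, Real.one_rpow, Finset.prod_const_one, mul_one, Finset.length_toList,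
    Finset.sum_empty, add_zero] at h
  simpa using h

end Capacity

open Polynomial in
theorem Polynomial.Splits.coeff_pos {p : ℝ[X]} (hp : p.Splits) {n : ℕ} (hd : p.natDegree ≤ n)
    (hpos : ∀ y : ℝ, 0 ≤ y → 0 < p.eval y) (hn : p.coeff n ≠ 0) {i : ℕ} (hi : i ≤ n) :
    0 < p.coeff i := by
  have hc : 0 < p.coeff 0 := by rw [coeff_zero_eq_eval_zero]; exact hpos 0 le_rfl
  obtain ⟨α, hα0, hα⟩ := hp.exists_eq_prod_one_add_of_nonneg hd hpos
  have htop : (∏ i, (1 + C (α i) * X)).coeff n = ∏ i, α i := by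
    have := coeff_prod_of_natDegree_le (s := Finset.univ) (fun i : Fin n => 1 + C (α i) * X) 1
      fun i _ => (natDegree_add_le _ _).trans
        (max_le (by simp) ((natDegree_C_mul_le _ _).trans natDegree_X_le))
    simpa [coeff_one] using this
  have hα1 : ∀ i ∈ Finset.univ, 0 < α i := fun i hi => by
    refine (hα0 i).lt_of_ne' fun h => hn ?_
    rw [hα, coeff_C_mul, htop, Finset.prod_eq_zero hi h, mul_zero]
  rw [hα, coeff_C_mul]
  exact mul_pos hc (coeff_prod_one_add_pos Finset.univ α hα1 (by simpa using hi))

theorem Real.rpow_eq_exp_log_mul {x y : ℝ} (hx : 0 ≤ x) (h : x = 0 → y = 0) :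
    x ^ y = Real.exp (Real.log x * y) := by
  rcases hx.eq_or_lt with rfl | hx
  · simp [h rfl]
  · exact Real.rpow_def_of_pos hx y

theorem capFactor_eq_exp {b s : ℝ} (hb : 1 ≤ b) (hs1 : s ≤ 1) :
    capFactor b s =
      Real.exp ((b - s) * Real.log (1 - s / b) - (1 - s) * Real.log (1 - s)) := by
  have hb0 : 0 < b := by linarith
  rw [capFactor, Real.rpow_eq_exp_log_mul, Real.rpow_eq_exp_log_mul, ← Real.exp_add]
  · ring_nf
  · linarith
  · intro h; linarith
  · rw [sub_nonneg, div_le_one hb0]; linarith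
  · intro h
    rw [sub_eq_zero, eq_comm, div_eq_one_iff_eq hb0.ne'] at h
    linarith

theorem card_mul_Gammaab {a b n m k : ℕ} (ha : 1 ≤ a) (hb : 1 ≤ b) (hn : 1 ≤ n) (hm : 1 ≤ m)
    (hk : 1 ≤ k) (h : a * n = b * m) {q s : ℝ} (hq : q = k / n) (hs : s = k / m) :
    ((n : ℝ) + m) * Gammaab a b (2 * k / (n + m)) =
      m * ((b - s) * Real.log (1 - s / b) - (1 - s) * Real.log (1 - s)) +
        n * (q * Real.log (a / q) - (1 - q) * Real.log (1 - q)) := by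
  have ha0 : (0 : ℝ) < a := by exact_mod_cast ha
  have hb0 : (0 : ℝ) < b := by exact_mod_cast hb
  have hn0 : (0 : ℝ) < n := by exact_mod_cast hn
  have hm0 : (0 : ℝ) < m := by exact_mod_cast hm
  have hk0 : (0 : ℝ) < k := by exact_mod_cast hk
  have h' : (a : ℝ) * n = b * m := by exact_mod_cast h
  have hq0 : 0 < q := by rw [hq]; positivity
  have hs0 : 0 < s := by rw [hs]; positivity
  have hnm : (m : ℝ) * s = k := by rw [hs]; field_simp
  have hnq : (n : ℝ) * q = k := by rw [hq]; field_simp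
  have c1 : ((n : ℝ) + m) * (a / (a + b)) = m := by field_simp; linear_combination h'
  have c2 : ((n : ℝ) + m) * (b / (a + b)) = n := by field_simp; linear_combination -h'
  have c3 : ((n : ℝ) + m) * (2 * k / (n + m) / 2) = k := by field_simp
  have c4 : ((n : ℝ) + m) * (a * b / (a + b)) = b * m := by linear_combination b * c1
  have e1 : ((a : ℝ) + b) * (2 * k / (n + m)) / (2 * a) = s := by
    rw [hs]; field_simp; linear_combination -h'
  have e2 : ((a : ℝ) + b) * (2 * k / (n + m)) / (2 * b) = q := by
    rw [hq]; field_simp; linear_combination h'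
  have e3 : ((a : ℝ) + b) * (2 * k / (n + m)) / (2 * a * b) = s / b := by
    rw [← e1]; field_simp
  have l1 : Real.log ((a : ℝ) * b) = Real.log a + Real.log b := Real.log_mul ha0.ne' hb0.ne'
  have l2 : Real.log (s / b) = Real.log s - Real.log b := Real.log_div hs0.ne' hb0.ne'
  have l3 : Real.log (a / q) = Real.log a - Real.log q := Real.log_div ha0.ne' hq0.ne'
  have e4 : (b : ℝ) * m * (s / b) = k := by field_simp; linear_combination hnm
  have expand : ((n : ℝ) + m) * Gammaab a b (2 * k / (n + m)) =
      m * binEnt s + n * binEnt q + k * Real.log (a * b) - b * m * binEnt (s / b) := by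
    rw [Gammaab, e1, e2, e3]
    linear_combination c1 * binEnt s + c2 * binEnt q + c3 * Real.log (a * b) -
      c4 * binEnt (s / b)
  rw [expand, binEnt, binEnt, binEnt, l1, l2, l3]
  linear_combination (-Real.log s) * hnm - (Real.log a) * hnq +
    (Real.log s - Real.log b - Real.log (1 - s / b)) * e4 + Real.log (1 - s / b) * hnm

open Polynomial in
theorem choose_mul_capFactor_le_sum_coverCount {V : Type*} [DecidableEq V] {G : SimpleGraph V}
    [DecidableRel G.Adj] {A B : Finset V} {a b k : ℕ} (hb : 1 ≤ b) (hab : b ≤ a)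
    (hA : ∀ u ∈ A, (B.filter fun v => G.Adj v u).card = a)
    (hB : ∀ v ∈ B, (A.filter (G.Adj v)).card = b) (hk : 1 ≤ k) (hkA : k ≤ A.card) {q s : ℝ}
    (hq : q = k / A.card) (hs : s = k / B.card) :
    (A.card.choose k : ℝ) * q ^ k * (1 - q) ^ (A.card - k) * (capFactor b s ^ B.card *
        ((1 - q) ^ (-(1 - q)) * (a / q) ^ q) ^ A.card) ≤
      ((∑ T ∈ A.powersetCard k, coverCount G B.toList T : ℕ) : ℝ) := by
  have hcount : B.card * b = A.card * a := Finset.card_mul_eq_card_mul G.Adj hB hA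
  set n := A.card with hn
  set m := B.card with hm
  have ha : 1 ≤ a := hb.trans hab
  have hn1 : 1 ≤ n := hk.trans hkA
  have hnm : n ≤ m := by
    by_contra! h
    have : m * b < n * a := Nat.mul_lt_mul_of_lt_of_le h hab (by omega)
    omega
  have hm1 : 1 ≤ m := hn1.trans hnm
  have ha0 : (0 : ℝ) < a := by exact_mod_cast ha
  have hb0 : (0 : ℝ) < b := by exact_mod_cast hb
  have hn0 : (0 : ℝ) < n := by exact_mod_cast hn1
  have hm0 : (0 : ℝ) < m := by exact_mod_cast hm1
  have hk0 : (0 : ℝ) < k := by exact_mod_cast hk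
  have hkn : (k : ℝ) ≤ n := by exact_mod_cast hkA
  have hnm' : (n : ℝ) ≤ m := by exact_mod_cast hnm
  have hcount' : (m : ℝ) * b = n * a := by exact_mod_cast hcount
  have hb1 : (1 : ℝ) ≤ b := by exact_mod_cast hb
  set R := bipMatchPoly G A B.toList fun _ => (X : ℝ[X]) with hR
  have hzero : capFactor b (n / m) ^ m * (a : ℝ) ^ n ≤ R.eval 0 := by
    have ht : Filter.Tendsto (fun t => R.eval t) (nhdsWithin 0 (Set.Ioi 0)) (nhds (R.eval 0)) :=
      (R.continuous.tendsto 0).mono_left nhdsWithin_le_nhds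
    refine ge_of_tendsto ht (Filter.eventually_of_mem self_mem_nhdsWithin fun t ht => ?_)
    have := capFactor_pow_mul_le_eval ha hb hA hB one_pos le_rfl (Set.mem_Ioi.1 ht)
      (s := n / m) (by field_simp; linear_combination -hcount') ((div_le_one hm0).2 hnm')
    simpa using this
  have hcap : ∀ s : ℝ, s ≤ 1 → 0 < capFactor b s := fun s hs => by
    rw [capFactor_eq_exp hb1 hs]; exact Real.exp_pos _
  have hpos : ∀ y : ℝ, 0 ≤ y → 0 < R.eval y := by
    intro y hy
    rcases hy.eq_or_lt with rfl | hy
    · have := hcap (n / m) ((div_le_one hm0).2 hnm')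
      exact lt_of_lt_of_le (by positivity) hzero
    · have := map_bipMatchPoly G (evalRingHom y) A B.toList fun _ => (X : ℝ[X])
      rw [coe_evalRingHom] at this
      rw [hR, this]
      exact bipMatchPoly_pos G _ fun _ _ => by simpa using hy
  rw [← coeff_bipMatchPoly_X G B.toList hkA, ← hR, ← hn]
  rcases hkA.eq_or_lt with rfl | hlt
  · have hq1 : q = 1 := by rw [hq, div_self hn0.ne']
    subst hq1
    rw [Nat.sub_self, coeff_zero_eq_eval_zero, hs]
    simpa using hzero
  · have hlt' : (k : ℝ) < n := by exact_mod_cast hlt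
    have hq0 : 0 < q := by rw [hq]; positivity
    have hq1 : q < 1 := by rw [hq, div_lt_one hn0]; exact hlt'
    have hnq : (n : ℝ) * (1 - q) = (n - k : ℕ) := by
      rw [Nat.cast_sub hkA, hq]; field_simp
    have htop : R.coeff n = 1 := by
      have := coeff_bipMatchPoly_X G B.toList (A := A) (Nat.zero_le _)
      rw [Nat.sub_zero] at this
      rw [hR, hn, this]
      simp [coverCount_empty]
    have hdeg : R.natDegree ≤ n := by
      refine natDegree_sum_le_of_forall_le _ _ fun T _ => ?_
      rw [Finset.prod_const, ← C_eq_natCast]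
      exact (natDegree_C_mul_X_pow_le _ _).trans (Finset.card_le_card Finset.sdiff_subset)
    have hsplit : R.Splits := splits_bipMatchPoly_X G A B.toList
    have key := hsplit.coeff_lower_bound hdeg
      (fun i hi => hsplit.coeff_pos hdeg hpos (htop ▸ one_ne_zero) hi)
      (j := n - k) (by omega)
      (D := capFactor b s ^ m * ((1 - q) ^ (-(1 - q)) * (a / q) ^ q) ^ n) fun t ht => by
        have := capFactor_pow_mul_le_eval ha hb hA hB hq0 hq1.le ht (s := s)
          (by rw [hs, hq]; field_simp; linear_combination -hcount')
          (by rw [hs, div_le_one hm0]; linarith)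
        refine le_trans (le_of_eq ?_) this
        rw [← hm, ← hn, div_eq_mul_inv t, Real.mul_rpow ht.le (by simpa using hq1.le),
          Real.inv_rpow (by linarith), ← Real.rpow_neg (by linarith)]
        have hp : (t ^ (1 - q)) ^ n = t ^ (n - k) := by
          rw [← Real.rpow_mul_natCast ht.le, mul_comm, hnq, Real.rpow_natCast]
        rw [mul_assoc (t ^ (1 - q)), mul_pow (t ^ (1 - q)), hp]
        ring
    have hj : ((n - k : ℕ) : ℝ) / n = 1 - q := by rw [← hnq]; field_simp
    rw [hj, Nat.choose_symm hkA, Nat.sub_sub_self hkA, sub_sub_cancel] at key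
    refine le_trans (le_of_eq ?_) key
    ring

/-- Lower matching bound for `(a,b)`-biregular bipartite graphs:
`m_k(G) ≥ p_μ · exp(v(G)·Γ_{a,b}(p))`. -/
theorem biregular_lower_matching {V : Type*} [Fintype V] [DecidableEq V] (a b : ℕ)
    (hb : 1 ≤ b) (hab : b ≤ a) (G : SimpleGraph V) [DecidableRel G.Adj]
    (A B : Finset V) (hdisj : Disjoint A B) (hcover : A ∪ B = Finset.univ)
    (hedges : ∀ u v, G.Adj u v → (u ∈ A ∧ v ∈ B) ∨ (u ∈ B ∧ v ∈ A))
    (hdegA : ∀ v ∈ A, G.degree v = a) (hdegB : ∀ v ∈ B, G.degree v = b)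
    (k : ℕ) (hk1 : 1 ≤ k) (hkA : k ≤ A.card)
    (p q pμ : ℝ) (hp : p = 2 * (k : ℝ) / (Fintype.card V))
    (hq : q = ((a : ℝ) + b) * p / (2 * b))
    (hpμ : pμ = (A.card.choose k : ℝ) * q ^ k * (1 - q) ^ (A.card - k)) :
    pμ * Real.exp ((Fintype.card V : ℝ) * Gammaab a b p) ≤ (matchCount G k : ℝ) := by
  have hnotB : ∀ v ∈ A, v ∉ B := fun v hA hB => Finset.disjoint_left.1 hdisj hA hB
  have hA : ∀ u ∈ A, (B.filter fun v => G.Adj v u).card = a := by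
    intro u hu
    rw [← hdegA u hu, ← G.card_neighborFinset_eq_degree]
    congr 1
    ext v
    have := hedges v u
    have := hnotB u hu
    simp only [Finset.mem_filter, SimpleGraph.mem_neighborFinset, G.adj_comm u v]
    tauto
  have hB : ∀ v ∈ B, (A.filter (G.Adj v)).card = b := by
    intro v hv
    rw [← hdegB v hv, ← G.card_neighborFinset_eq_degree]
    congr 1
    ext u
    have := hedges v u
    have := fun h => hnotB v h hv
    simp only [Finset.mem_filter, SimpleGraph.mem_neighborFinset]
    tauto
  have hcount : B.card * b = A.card * a := Finset.card_mul_eq_card_mul G.Adj hB hA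
  have ha : 1 ≤ a := hb.trans hab
  have hn1 : 1 ≤ A.card := hk1.trans hkA
  have hm1 : 1 ≤ B.card := Nat.pos_of_mul_pos_right (hcount ▸ Nat.mul_pos hn1 ha)
  have hnm : A.card ≤ B.card := by
    by_contra! h
    have : B.card * b < A.card * a := Nat.mul_lt_mul_of_lt_of_le h hab (by omega)
    omega
  have hcard : (Fintype.card V : ℝ) = A.card + B.card := by
    rw [← Finset.card_univ, ← hcover, Finset.card_union_of_disjoint hdisj, Nat.cast_add]
  have ha0 : (0 : ℝ) < a := by exact_mod_cast ha
  have hb0 : (0 : ℝ) < b := by exact_mod_cast hb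
  have hn0 : (0 : ℝ) < A.card := by exact_mod_cast hn1
  have hm0 : (0 : ℝ) < B.card := by exact_mod_cast hm1
  have hkn : (k : ℝ) ≤ A.card := by exact_mod_cast hkA
  have hk0 : (0 : ℝ) < k := by exact_mod_cast hk1
  have hnm' : (A.card : ℝ) ≤ B.card := by exact_mod_cast hnm
  have hcount' : (B.card : ℝ) * b = A.card * a := by exact_mod_cast hcount
  have hq' : q = k / A.card := by
    rw [hq, hp, hcard]; field_simp; linear_combination -hcount'
  have hq0 : 0 < q := by rw [hq']; positivity
  have hq1 : q ≤ 1 := by rw [hq', div_le_one hn0]; exact hkn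
  set s : ℝ := k / B.card with hs
  have hs1 : s ≤ 1 := by rw [hs, div_le_one hm0]; linarith
  have hexp : Real.exp ((Fintype.card V : ℝ) * Gammaab a b p) = capFactor b s ^ B.card *
      ((1 - q) ^ (-(1 - q)) * (a / q) ^ q) ^ A.card := by
    rw [hp, hcard, card_mul_Gammaab ha hb hn1 hm1 hk1 (by linarith) hq' hs,
      capFactor_eq_exp (by exact_mod_cast hb) hs1,
      Real.rpow_eq_exp_log_mul (sub_nonneg.2 hq1) (by intro h; linarith),
      Real.rpow_def_of_pos (div_pos ha0 hq0), Real.exp_add, Real.exp_nat_mul, ← Real.exp_add,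
      Real.exp_nat_mul]
    ring_nf
  rw [hexp, hpμ]
  refine (choose_mul_capFactor_le_sum_coverCount hb hab hA hB hk1 hkA hq' hs).trans ?_
  exact_mod_cast sum_coverCount_le_matchCount B.nodup_toList
    (fun v hv hA => hnotB v hA (Finset.mem_toList.1 hv)) k
end

section
/- Let d ≥ 2 and n ≥ 1 be integers and let G be a d-regular bipartite simple graph on 2n vertices. Then for every real t > 0, M(G,t) ≥ S_d(t)^n, where η_t = (√(1+4(d−1)t) − 1)/(2(d−1)t) and S_d(t) = (1/η_t²)·((d−1)/(d−η_t))^{d−2}. -/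
/-- The matching generating polynomial `M(G,t) = Σ_k m_k(G) t^k`.
(Since `m_k(G) = 0` for `k > v(G)`, the range of summation captures all terms.) -/
noncomputable def matchGen {V : Type*} [Fintype V] (G : SimpleGraph V) (t : ℝ) : ℝ :=
  ∑ k ∈ Finset.range (Fintype.card V + 1), (matchCount G k : ℝ) * t ^ k

/-- The upper half-plane together with the nonnegative real axis. -/
def upperCone : AddSubmonoid ℂ where
  carrier := {z | 0 ≤ z.im ∧ (z.im = 0 → 0 ≤ z.re)}
  zero_mem' := by simp
  add_mem' := by
    rintro a b ⟨ha, ha'⟩ ⟨hb, hb'⟩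
    refine ⟨by simpa using add_nonneg ha hb, fun h => ?_⟩
    rw [Complex.add_im] at h
    rw [Complex.add_re]
    exact add_nonneg (ha' (by linarith)) (hb' (by linarith))

theorem mem_upperCone {z : ℂ} : z ∈ upperCone ↔ 0 ≤ z.im ∧ (z.im = 0 → 0 ≤ z.re) := Iff.rfl

theorem ofReal_mem_upperCone {x : ℝ} (hx : 0 ≤ x) : (x : ℂ) ∈ upperCone := by
  simp [mem_upperCone, hx]

theorem one_add_ne_zero_of_mem_upperCone {z : ℂ} (hz : z ∈ upperCone) : 1 + z ≠ 0 := by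
  intro h
  obtain rfl : z = -1 := by linear_combination h
  simp [mem_upperCone] at hz
  linarith

theorem mul_mem_upperCone {t : ℝ} (ht : 0 < t) {z : ℂ} (hz : z ∈ upperCone) :
    (t : ℂ) * z ∈ upperCone := by
  rw [mem_upperCone] at hz ⊢
  simp only [Complex.re_ofReal_mul, Complex.im_ofReal_mul, mul_eq_zero, ht.ne', false_or]
  exact ⟨mul_nonneg ht.le hz.1, fun h => mul_nonneg ht.le (hz.2 h)⟩

theorem conj_neg_inv_mem_upperCone {r : ℂ} (hr : r ∉ upperCone) :
    starRingEnd ℂ (-r⁻¹) ∈ upperCone := by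
  have h0 : r ≠ 0 := by
    rintro rfl
    exact hr upperCone.zero_mem
  have hN : 0 < Complex.normSq r := Complex.normSq_pos.2 h0
  rw [mem_upperCone] at hr ⊢
  simp only [map_neg, Complex.neg_im, Complex.conj_im, Complex.inv_im, neg_neg, Complex.neg_re,
    Complex.conj_re, Complex.inv_re, div_eq_zero_iff, hN.ne', or_false, neg_eq_zero]
  have him : r.im ≤ 0 := by
    by_contra! h
    exact hr ⟨h.le, fun h' => absurd h' h.ne'⟩
  refine ⟨div_nonneg (by linarith) hN.le, fun h => ?_⟩
  have hre : r.re ≤ 0 := by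
    by_contra! h'
    exact hr ⟨h.ge, fun _ => h'.le⟩
  rw [← neg_div]
  exact div_nonneg (by linarith) hN.le

open Polynomial in
theorem coeff_zero_add_coeff_one_ne_zero {Q : ℂ[X]} (hQ : ∀ z ∈ upperCone, Q.eval z ≠ 0) :
    Q.coeff 0 + Q.coeff 1 ≠ 0 := by
  have h0 : Q.eval 0 ≠ 0 := hQ 0 upperCone.zero_mem
  have h1 := (IsAlgClosed.splits Q).eval_derivative_eq_eval_mul_sum h0
  have h2 : Q.coeff 1 = (derivative Q).eval 0 := by
    rw [← coeff_zero_eq_eval_zero, coeff_derivative]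
    simp
  rw [h2, h1, coeff_zero_eq_eval_zero, ← mul_one_add]
  refine mul_ne_zero h0 ?_
  have hmem : starRingEnd ℂ (Q.roots.map fun z => 1 / (0 - z)).sum ∈ upperCone := by
    rw [map_multiset_sum, Multiset.map_map]
    refine upperCone.multiset_sum_mem _ fun a ha => ?_
    obtain ⟨r, hr, rfl⟩ := Multiset.mem_map.1 ha
    have hr' : r ∉ upperCone := fun h => hQ r h (isRoot_of_mem_roots hr)
    have := conj_neg_inv_mem_upperCone hr'
    rwa [← inv_neg, ← zero_sub r, ← one_div] at this
  have := one_add_ne_zero_of_mem_upperCone hmem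
  intro h
  exact this (by simpa using congrArg (starRingEnd ℂ) h)

open Polynomial in
theorem exists_factorization_of_ne_zero_on_upperCone {Q : ℝ[X]}
    (hQ : ∀ z ∈ upperCone, (Q.map (algebraMap ℝ ℂ)).eval z ≠ 0) :
    ∃ a : Multiset ℝ, a.card = Q.natDegree ∧ (∀ b ∈ a, 0 < b) ∧ Q.coeff 1 = Q.coeff 0 * a.sum ∧
      ∀ x, Q.eval x = Q.coeff 0 * (a.map fun b => 1 + b * x).prod := by
  have hreal : ∀ r : ℂ, (Q.map (algebraMap ℝ ℂ)).IsRoot r → r.im = 0 ∧ r.re < 0 := by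
    intro r hr
    have hr1 : r ∉ upperCone := fun h => hQ r h hr
    have hr2 : starRingEnd ℂ r ∉ upperCone := by
      intro h
      refine hQ _ h ?_
      rw [IsRoot.def, eval_map_algebraMap] at hr
      rw [eval_map_algebraMap, ← Complex.conjAe_coe]
      erw [aeval_algHom_apply]
      rw [hr, map_zero]
    simp only [mem_upperCone, Complex.conj_im, Complex.conj_re] at hr1 hr2
    grind
  have hs : Q.Splits := by
    refine Splits.of_splits_map (algebraMap ℝ ℂ) (IsAlgClosed.splits _) fun r hr => ?_
    have := hreal r (isRoot_of_mem_roots hr)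
    exact ⟨r.re, Complex.ext (by simp) (by simp [this.1])⟩
  have hneg : ∀ r ∈ Q.roots, r < 0 := by
    intro r hr
    have := hreal (r : ℂ) ((isRoot_of_mem_roots hr).map (f := algebraMap ℝ ℂ))
    simpa using this
  have h0 : Q.eval 0 ≠ 0 := by
    intro h
    refine hQ 0 upperCone.zero_mem ?_
    simpa using (IsRoot.map (f := algebraMap ℝ ℂ) h)
  refine ⟨Q.roots.map fun r => 1 / (0 - r), ?_, ?_, ?_, ?_⟩
  · rw [Multiset.card_map, hs.natDegree_eq_card_roots]
  · intro b hb
    obtain ⟨r, hr, rfl⟩ := Multiset.mem_map.1 hb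
    have := hneg r hr
    exact one_div_pos.2 (by linarith)
  · rw [coeff_zero_eq_eval_zero, ← hs.eval_derivative_eq_eval_mul_sum h0,
      ← coeff_zero_eq_eval_zero, coeff_derivative]
    simp
  · intro x
    rw [coeff_zero_eq_eval_zero, hs.eval_eq_prod_roots x, hs.eval_eq_prod_roots 0, mul_assoc,
      Multiset.map_map, ← Multiset.prod_map_mul]
    congr 2
    refine Multiset.map_congr rfl fun r hr => ?_
    have := (hneg r hr).ne
    simp only [Function.comp]
    field_simp
    ring

theorem prod_one_add_le_pow {d : ℕ} {a : Multiset ℝ} (hcard : a.card ≤ d) (ha : ∀ b ∈ a, 0 ≤ b)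
    {y : ℝ} (hy : 0 < y) (hsum : a.sum = d * y) :
    (a.map fun b => 1 + b).prod ≤ (1 + y) ^ d := by
  have key : (a.map fun b => 1 + b).prod ≤
      (1 + y) ^ a.card * Real.exp ((a.sum - a.card * y) / (1 + y)) := by
    clear hcard hsum
    induction a using Multiset.induction_on with
    | empty => simp
    | cons b a ih =>
      have hb : 1 + b ≤ (1 + y) * Real.exp ((b - y) / (1 + y)) := by
        calc 1 + b = (1 + y) * ((b - y) / (1 + y) + 1) := by field_simp; ring
          _ ≤ _ := by gcongr; exact Real.add_one_le_exp _
      have hb0 := ha b (Multiset.mem_cons_self b a)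
      have ih' := ih fun b hb => ha b (Multiset.mem_cons_of_mem hb)
      have hprod : 0 ≤ (a.map fun b => 1 + b).prod := by
        refine Multiset.prod_nonneg fun c hc => ?_
        obtain ⟨e, he, rfl⟩ := Multiset.mem_map.1 hc
        linarith [ha e (Multiset.mem_cons_of_mem he)]
      rw [Multiset.map_cons, Multiset.prod_cons, Multiset.card_cons, Multiset.sum_cons]
      calc _ ≤ ((1 + y) * Real.exp ((b - y) / (1 + y))) *
            ((1 + y) ^ a.card * Real.exp ((a.sum - a.card * y) / (1 + y))) := by gcongr
        _ = (1 + y) ^ (a.card + 1) * (Real.exp ((b - y) / (1 + y)) *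
            Real.exp ((a.sum - a.card * y) / (1 + y))) := by ring
        _ = _ := by
          rw [← Real.exp_add]
          congr 2
          push_cast
          ring
  refine key.trans ?_
  obtain ⟨k, rfl⟩ := Nat.exists_eq_add_of_le hcard
  rw [pow_add]
  gcongr
  have h1 : Real.exp (y / (1 + y)) ≤ 1 + y := by
    rw [← Real.le_log_iff_exp_le (by linarith)]
    have := Real.one_sub_inv_le_log_of_pos (show 0 < 1 + y by linarith)
    convert this using 1
    field_simp
    ring
  calc _ = Real.exp (y / (1 + y)) ^ k := by
        rw [← Real.exp_nat_mul, hsum]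
        congr 1
        push_cast
        ring
    _ ≤ _ := by gcongr

theorem rpow_le_one_add {θ y : ℝ} (h0 : 0 < θ) (h1 : θ < 1) (hy : 0 ≤ y) :
    (1 - θ) ^ (-(1 - θ)) * (y / θ) ^ θ ≤ 1 + y := by
  have h := Real.geom_mean_le_arith_mean2_weighted (w₁ := 1 - θ) (w₂ := θ) (p₁ := (1 - θ)⁻¹)
    (p₂ := y / θ) (by linarith) h0.le (inv_nonneg.2 (by linarith)) (by positivity) (by ring)
  rw [Real.rpow_neg (by linarith), ← Real.inv_rpow (by linarith)]
  refine h.trans_eq ?_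
  have : 1 - θ ≠ 0 := by linarith
  field_simp

/-- The constant lost when one variable is truncated. -/
noncomputable def truncConst (d : ℕ) (θ : ℝ) : ℝ :=
  (1 - θ) ^ (-(1 - θ)) * ((d - θ) / d) ^ (d - θ)

open Polynomial in
theorem truncConst_mul_le {d : ℕ} (hd : 1 ≤ d) {θ L : ℝ} (h0 : 0 < θ) (h1 : θ < 1) (hL : 0 < L)
    {Q : ℝ[X]} (hdeg : Q.natDegree ≤ d)
    (hQ : ∀ z ∈ upperCone, (Q.map (algebraMap ℝ ℂ)).eval z ≠ 0)
    (hlow : ∀ x, 0 < x → L * x ^ θ ≤ Q.eval x) :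
    truncConst d θ * L ≤ Q.coeff 0 + Q.coeff 1 := by
  obtain ⟨a, hcard, hpos, hsum, heval⟩ := exists_factorization_of_ne_zero_on_upperCone hQ
  have hd' : (1 : ℝ) ≤ d := by exact_mod_cast hd
  have hq : 0 < Q.coeff 0 := by
    have h := hlow 1 one_pos
    rw [heval 1] at h
    have hp : 0 < (a.map fun b => 1 + b * 1).prod := by
      refine Multiset.prod_pos fun b hb => ?_
      obtain ⟨c, hc, rfl⟩ := Multiset.mem_map.1 hb
      linarith [hpos c hc]
    have : 0 < L * 1 ^ θ := by simpa
    exact pos_of_mul_pos_left (this.trans_le h) hp.le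
  set q := Q.coeff 0
  have hs0 : 0 ≤ a.sum := Multiset.sum_nonneg fun b hb => (hpos b hb).le
  rcases hs0.eq_or_lt with hs | hs
  · exfalso
    have ha : a = 0 := by
      by_contra hne
      obtain ⟨b, hb⟩ := Multiset.exists_mem_of_ne_zero hne
      exact ((hpos b hb).trans_le
        (Multiset.single_le_sum (fun c hc => (hpos c hc).le) b hb)).ne hs
    have h := hlow ((2 * q / L) ^ θ⁻¹) (by positivity)
    rw [heval, ha, Real.rpow_inv_rpow (by positivity) h0.ne'] at h
    have : L * (2 * q / L) = 2 * q := by field_simp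
    simp at h
    linarith
  · set s := a.sum
    have hdθ : 0 < (d : ℝ) - θ := by linarith
    have h := hlow (d * (θ / (d - θ)) / s) (by positivity)
    have hprod : (a.map fun b => 1 + b * (d * (θ / (d - θ)) / s)).prod ≤
        (1 + θ / (d - θ)) ^ d := by
      have := prod_one_add_le_pow (d := d) (a := a.map fun b => b * (d * (θ / (d - θ)) / s))
        (y := θ / (d - θ)) (by simpa [hcard] using hdeg) (by
          intro b hb
          obtain ⟨c, hc, rfl⟩ := Multiset.mem_map.1 hb
          have := hpos c hc
          positivity) (by positivity) (by
          rw [Multiset.sum_map_mul_right, Multiset.map_id']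
          change s * _ = _
          field_simp)
      simpa [Multiset.map_map] using this
    have h2 : L * (d * (θ / (d - θ)) / s) ^ θ ≤ q * (1 + θ / (d - θ)) ^ d := by
      refine h.trans ?_
      rw [heval]
      gcongr
    have h3 : truncConst d θ * L ≤ q * ((1 - θ) ^ (-(1 - θ)) * (s / θ) ^ θ) := by
      have e1 : 1 + θ / (d - θ) = ((d - θ) / d)⁻¹ := by field_simp; ring
      have e2 : d * (θ / (d - θ)) / s = ((s / θ) * ((d - θ) / d))⁻¹ := by field_simp
      rw [e1, e2] at h2
      have hb : 0 < (d - θ) / d := by positivity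
      have hc : 0 < s / θ := by positivity
      unfold truncConst
      rw [Real.rpow_sub hb, Real.rpow_natCast]
      generalize ((d : ℝ) - θ) / d = b at *
      rw [Real.inv_rpow (by positivity), Real.mul_rpow hc.le hb.le, inv_pow] at h2
      have hA : 0 < (1 - θ) ^ (-(1 - θ)) := Real.rpow_pos_of_pos (by linarith) _
      have hB : 0 < b ^ θ := by positivity
      have hC : 0 < (s / θ) ^ θ := by positivity
      generalize (1 - θ) ^ (-(1 - θ)) = A at *
      generalize b ^ θ = B at *
      generalize (s / θ) ^ θ = C at *
      have hD : 0 < b ^ d := by positivity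
      generalize b ^ d = D at *
      rw [← div_eq_mul_inv, ← div_eq_mul_inv, div_le_div_iff₀ (by positivity) hD] at h2
      have : A * (D / B) * L = A * (L * D) / B := by ring
      rw [this, div_le_iff₀ hB]
      calc A * (L * D) ≤ A * (q * (C * B)) := by gcongr
        _ = _ := by ring
    rw [hsum]
    calc _ ≤ _ := h3
      _ ≤ q * (1 + s) := by gcongr; exact rpow_le_one_add h0 h1 hs.le
      _ = _ := by ring

section Truncation

variable {ι β R : Type*} [Fintype β] [DecidableEq β] [CommSemiring R]

/-- The contribution of one variable to a monomial: the variables in `S` are truncated to degree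
at most one and then set to `1`. -/
def truncFactor (S : Finset β) (x : β → R) (v : β) (k : ℕ) : R :=
  if v ∈ S then (if k ≤ 1 then 1 else 0) else x v ^ k

/-- The polynomial `∑ i ∈ I, w i * x ^ c i` with the variables in `S` truncated. -/
def truncSum (I : Finset ι) (w : ι → R) (c : ι → β → ℕ) (S : Finset β) (x : β → R) : R :=
  ∑ i ∈ I, w i * ∏ v, truncFactor S x v (c i v)

/-- `truncSum` as a univariate polynomial in the variable `v`. -/
noncomputable def truncSlice (I : Finset ι) (w : ι → R) (c : ι → β → ℕ) (S : Finset β) (x : β → R)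
    (v : β) : Polynomial R :=
  ∑ i ∈ I, Polynomial.monomial (c i v) (w i * ∏ u ∈ Finset.univ.erase v, truncFactor S x u (c i u))

variable (I : Finset ι) (w : ι → R) (c : ι → β → ℕ) {S : Finset β} (x : β → R) {v : β}

theorem eval_truncSlice (hv : v ∉ S) (z : R) :
    (truncSlice I w c S x v).eval z = truncSum I w c S (Function.update x v z) := by
  simp only [truncSlice, truncSum, Polynomial.eval_finsetSum, Polynomial.eval_monomial]
  refine Finset.sum_congr rfl fun i _ => ?_
  rw [← Finset.mul_prod_erase Finset.univ
    (fun u => truncFactor S (Function.update x v z) u (c i u)) (Finset.mem_univ v)]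
  have h : ∏ u ∈ Finset.univ.erase v, truncFactor S (Function.update x v z) u (c i u) =
      ∏ u ∈ Finset.univ.erase v, truncFactor S x u (c i u) := by
    refine Finset.prod_congr rfl fun u hu => ?_
    simp [truncFactor, Finset.ne_of_mem_erase hu]
  rw [h]
  simp only [truncFactor, hv, if_false, Function.update_self]
  ring

theorem coeff_zero_add_coeff_one_truncSlice :
    (truncSlice I w c S x v).coeff 0 + (truncSlice I w c S x v).coeff 1 =
      truncSum I w c (insert v S) x := by
  simp only [truncSlice, truncSum, Polynomial.finsetSum_coeff, Polynomial.coeff_monomial,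
    ← Finset.sum_add_distrib]
  refine Finset.sum_congr rfl fun i _ => ?_
  have h : ∏ u ∈ Finset.univ.erase v, truncFactor (insert v S) x u (c i u) =
      ∏ u ∈ Finset.univ.erase v, truncFactor S x u (c i u) := by
    refine Finset.prod_congr rfl fun u hu => ?_
    simp [truncFactor, Finset.ne_of_mem_erase hu]
  rw [← Finset.mul_prod_erase _ _ (Finset.mem_univ v), h]
  simp only [truncFactor, Finset.mem_insert_self, if_true]
  rcases hk : c i v with _ | _ | k <;> simp

theorem natDegree_truncSlice_le {d : ℕ} (hc : ∀ i ∈ I, c i v ≤ d) :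
    (truncSlice I w c S x v).natDegree ≤ d :=
  Polynomial.natDegree_sum_le_of_forall_le _ _ fun i hi =>
    (Polynomial.natDegree_monomial_le _).trans (hc i hi)

theorem map_truncSlice {R' : Type*} [CommSemiring R'] (f : R →+* R') :
    (truncSlice I w c S x v).map f = truncSlice I (f ∘ w) c S (f ∘ x) v := by
  simp only [truncSlice, Polynomial.map_sum, Polynomial.map_monomial, map_mul, map_prod,
    Function.comp]
  refine Finset.sum_congr rfl fun i _ => ?_
  congr 2
  refine Finset.prod_congr rfl fun u _ => ?_
  unfold truncFactor
  split_ifs <;> simp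

theorem truncSum_ne_zero {w : ι → ℂ}
    (h : ∀ x : β → ℂ, (∀ v, x v ∈ upperCone) → truncSum I w c ∅ x ≠ 0) (S : Finset β)
    (x : β → ℂ) (hx : ∀ v, x v ∈ upperCone) : truncSum I w c S x ≠ 0 := by
  induction S using Finset.induction_on generalizing x with
  | empty => exact h x hx
  | insert v S hv ih =>
    rw [← coeff_zero_add_coeff_one_truncSlice]
    refine coeff_zero_add_coeff_one_ne_zero fun z hz => ?_
    rw [eval_truncSlice _ _ _ _ hv]
    refine ih _ fun u => ?_
    rcases eq_or_ne u v with rfl | hu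
    · simpa
    · simpa [hu] using hx u

theorem truncConst_pow_mul_le_truncSum {d : ℕ} (hd : 1 ≤ d) {θ L : ℝ} (h0 : 0 < θ) (h1 : θ < 1)
    (hL : 0 < L) {w : ι → ℝ} (hc : ∀ i ∈ I, ∀ v, c i v ≤ d)
    (hne : ∀ x : β → ℂ, (∀ v, x v ∈ upperCone) → truncSum I (fun i => (w i : ℂ)) c ∅ x ≠ 0)
    (hlow : ∀ x : β → ℝ, (∀ v, 0 < x v) → L * ∏ v, x v ^ θ ≤ truncSum I w c ∅ x)
    (S : Finset β) (x : β → ℝ) (hx : ∀ v, 0 < x v) :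
    truncConst d θ ^ S.card * (L * ∏ v ∈ Sᶜ, x v ^ θ) ≤ truncSum I w c S x := by
  have hC : 0 < truncConst d θ := by
    have hd' : (1 : ℝ) ≤ d := by exact_mod_cast hd
    have : 0 < (d - θ) / d := div_pos (by linarith) (by linarith)
    exact mul_pos (Real.rpow_pos_of_pos (by linarith) _) (Real.rpow_pos_of_pos this _)
  induction S using Finset.induction_on generalizing x with
  | empty => simpa using hlow x hx
  | insert v S hv ih =>
    rw [← coeff_zero_add_coeff_one_truncSlice, Finset.card_insert_of_notMem hv, pow_succ',
      mul_assoc]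
    have hP : 0 < ∏ u ∈ (insert v S)ᶜ, x u ^ θ :=
      Finset.prod_pos fun u _ => Real.rpow_pos_of_pos (hx u) _
    refine truncConst_mul_le hd h0 h1 (by positivity)
      (natDegree_truncSlice_le _ _ _ _ fun i hi => hc i hi v) (fun z hz => ?_) fun y hy => ?_
    · rw [map_truncSlice, eval_truncSlice _ _ _ _ hv]
      refine truncSum_ne_zero I c hne S _ fun u => ?_
      rcases eq_or_ne u v with rfl | hu
      · simpa
      · simpa [hu] using ofReal_mem_upperCone (hx u).le
    · rw [eval_truncSlice _ _ _ _ hv]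
      refine le_trans (le_of_eq ?_) (ih (Function.update x v y) fun u => ?_)
      · have hmem : v ∈ Sᶜ := by simpa
        rw [← Finset.mul_prod_erase _ _ hmem, Function.update_self, Finset.compl_insert]
        have : ∏ u ∈ Sᶜ.erase v, Function.update x v y u ^ θ = ∏ u ∈ Sᶜ.erase v, x u ^ θ :=
          Finset.prod_congr rfl fun u hu => by
            rw [Function.update_of_ne (Finset.ne_of_mem_erase hu)]
        rw [this]
        ring
      · rcases eq_or_ne u v with rfl | hu
        · simpa
        · simpa [hu] using hx u

end Truncation

theorem le_prod_one_add {α β : Type*} [Fintype α] [Fintype β] (r : α → β → Prop)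
    [∀ u, DecidablePred (r u)] {d : ℕ} (hd : 1 ≤ d)
    (hα : ∀ u, (Finset.univ.filter (r u)).card = d)
    (hβ : ∀ v, (Finset.univ.filter fun u => r u v).card = d)
    {t θ : ℝ} (ht : 0 < t) (h0 : 0 < θ) (h1 : θ < 1) (x : β → ℝ) (hx : ∀ v, 0 < x v) :
    ((1 - θ) ^ (-(1 - θ)) * (d * t / θ) ^ θ) ^ Fintype.card α * ∏ v, x v ^ θ ≤
      ∏ u, (1 + t * ∑ v with r u v, x v) := by
  have hd' : (0 : ℝ) < d := by exact_mod_cast hd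
  have h2 : ∏ v, x v ^ θ = ∏ u, ∏ v with r u v, x v ^ (θ / d) := by
    simp only [Finset.prod_filter]
    rw [Finset.prod_comm]
    refine Finset.prod_congr rfl fun v _ => ?_
    rw [← Finset.prod_filter, Finset.prod_const, hβ, ← Real.rpow_mul_natCast (hx v).le]
    congr 1
    field_simp
  rw [h2, ← Finset.card_univ, ← Finset.prod_const, ← Finset.prod_mul_distrib]
  have hA : 0 ≤ (1 - θ) ^ (-(1 - θ)) := Real.rpow_nonneg (by linarith) _
  refine Finset.prod_le_prod (fun u _ => ?_) fun u _ => ?_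
  · have := Finset.prod_nonneg fun v (_ : v ∈ Finset.univ.filter (r u)) =>
      Real.rpow_nonneg (hx v).le (θ / d)
    positivity
  · have hsum : 0 ≤ ∑ v with r u v, x v := Finset.sum_nonneg fun v _ => (hx v).le
    refine le_trans ?_ (rpow_le_one_add h0 h1 (mul_nonneg ht.le hsum))
    have hgm := Real.geom_mean_le_arith_mean_weighted (Finset.univ.filter (r u))
      (fun _ => (d : ℝ)⁻¹) x (fun _ _ => by positivity) (by simp [hα, hd'.ne'])
      fun v _ => (hx v).le
    rw [← Finset.mul_sum] at hgm
    have hg : ∏ v with r u v, x v ^ (θ / d) ≤ ((d : ℝ)⁻¹ * ∑ v with r u v, x v) ^ θ := by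
      have : ∏ v with r u v, x v ^ (θ / d) = (∏ v with r u v, x v ^ (d : ℝ)⁻¹) ^ θ := by
        rw [← Real.finsetProd_rpow _ _ fun v _ => Real.rpow_nonneg (hx v).le _]
        refine Finset.prod_congr rfl fun v _ => ?_
        rw [← Real.rpow_mul (hx v).le]
        congr 1
        ring
      rw [this]
      exact Real.rpow_le_rpow (Finset.prod_nonneg fun v _ => Real.rpow_nonneg (hx v).le _) hgm h0.le
    rw [mul_assoc]
    refine mul_le_mul_of_nonneg_left ?_ hA
    have e : t * ∑ v with r u v, x v = d * t * ((d : ℝ)⁻¹ * ∑ v with r u v, x v) := by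
      field_simp
    rw [e, mul_div_right_comm (d * t), Real.mul_rpow (by positivity) (by positivity)]
    gcongr

section Assignments

variable {α β : Type*} [Fintype α] [Fintype β] [DecidableEq α] [DecidableEq β]

/-- The partial functions from `α` to `β` whose graph is contained in the relation `r`. -/
def partialFuns (r : α → β → Prop) [∀ u, DecidablePred (r u)] : Finset (α → Option β) :=
  Fintype.piFinset fun u => Finset.insertNone (Finset.univ.filter (r u))

/-- The number of preimages of `v` under the partial function `φ`. -/
def fiberCard (φ : α → Option β) (v : β) : ℕ := (Finset.univ.filter fun u => φ u = some v).card

/-- The product of `t` over the domain of the partial function `φ`. -/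
def domWeight {R : Type*} [CommSemiring R] (t : R) (φ : α → Option β) : R :=
  ∏ u, (φ u).elim 1 fun _ => t

variable (r : α → β → Prop) [∀ u, DecidablePred (r u)]

theorem truncSum_partialFuns_empty {R : Type*} [CommSemiring R] (t : R) (x : β → R) :
    truncSum (partialFuns r) (domWeight t) fiberCard ∅ x =
      ∏ u, (1 + t * ∑ v with r u v, x v) := by
  have h : ∀ u, 1 + t * ∑ v with r u v, x v =
      ∑ o ∈ Finset.insertNone (Finset.univ.filter (r u)), o.elim 1 fun v => t * x v := by
    intro u
    rw [Finset.sum_insertNone, Finset.mul_sum]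
    rfl
  simp only [h, Finset.prod_univ_sum]
  refine Finset.sum_congr rfl fun φ _ => ?_
  have h2 : ∏ v, truncFactor ∅ x v (fiberCard φ v) = ∏ u, (φ u).elim 1 x := by
    have h3 : ∀ u, (φ u).elim 1 x = ∏ v, if φ u = some v then x v else 1 := by
      intro u
      rcases φ u with _ | v <;> simp
    simp only [h3]
    rw [Finset.prod_comm]
    refine Finset.prod_congr rfl fun v _ => ?_
    simp [truncFactor, fiberCard, Finset.prod_ite]
  rw [h2, domWeight, ← Finset.prod_mul_distrib]
  refine Finset.prod_congr rfl fun u _ => ?_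
  rcases φ u with _ | v <;> simp

theorem truncSum_partialFuns_univ (t : ℝ) (x : β → ℝ) :
    truncSum (partialFuns r) (domWeight t) fiberCard Finset.univ x =
      ∑ φ ∈ partialFuns r with ∀ v, fiberCard φ v ≤ 1, domWeight t φ := by
  rw [Finset.sum_filter]
  refine Finset.sum_congr rfl fun φ _ => ?_
  simp only [truncFactor, Finset.mem_univ, if_true, Finset.prod_ite_zero, Finset.prod_const_one,
    forall_const]
  split_ifs <;> simp

theorem pow_le_sum_domWeight {d : ℕ} (hd : 1 ≤ d)
    (hα : ∀ u, (Finset.univ.filter (r u)).card = d)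
    (hβ : ∀ v, (Finset.univ.filter fun u => r u v).card = d)
    {t θ : ℝ} (ht : 0 < t) (h0 : 0 < θ) (h1 : θ < 1) :
    truncConst d θ ^ Fintype.card β *
        ((1 - θ) ^ (-(1 - θ)) * (d * t / θ) ^ θ) ^ Fintype.card α ≤
      ∑ φ ∈ partialFuns r with ∀ v, fiberCard φ v ≤ 1, domWeight t φ := by
  have hA : 0 < (1 - θ) ^ (-(1 - θ)) := Real.rpow_pos_of_pos (by linarith) _
  have hd' : (0 : ℝ) < d := by exact_mod_cast hd
  have h := truncConst_pow_mul_le_truncSum (partialFuns r) fiberCard hd h0 h1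
    (L := ((1 - θ) ^ (-(1 - θ)) * (d * t / θ) ^ θ) ^ Fintype.card α)
    (w := domWeight t) (by positivity) (fun φ hφ v => ?_) (fun x hx => ?_) (fun x hx => ?_)
    Finset.univ (fun _ => 1) fun _ => one_pos
  · simpa [truncSum_partialFuns_univ] using h
  · rw [fiberCard, ← hβ v]
    refine Finset.card_le_card fun u hu => ?_
    have h1 := Fintype.mem_piFinset.1 hφ u
    rw [(Finset.mem_filter.1 hu).2] at h1
    simpa using h1
  · have e : (fun φ : α → Option β => ((domWeight t φ : ℝ) : ℂ)) = domWeight (t : ℂ) := by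
      funext φ
      rw [domWeight, domWeight, Complex.ofReal_prod]
      refine Finset.prod_congr rfl fun u _ => ?_
      rcases φ u with _ | v <;> simp
    rw [e, truncSum_partialFuns_empty]
    exact Finset.prod_ne_zero_iff.2 fun u _ => one_add_ne_zero_of_mem_upperCone
      (mul_mem_upperCone ht (upperCone.sum_mem fun v _ => hx v))
  · rw [truncSum_partialFuns_empty]
    exact le_prod_one_add r hd hα hβ ht h0 h1 x hx

end Assignments

theorem truncConst_mul_eq {d : ℕ} (hd : 1 ≤ d) {t θ : ℝ} (h0 : 0 < θ) (h1 : θ < 1)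
    (hθ : d * t / θ = ((d - θ) / d) / (1 - θ) ^ 2) :
    truncConst d θ * ((1 - θ) ^ (-(1 - θ)) * (d * t / θ) ^ θ) =
      ((d - θ) / d) ^ d / (1 - θ) ^ 2 := by
  have hd' : (1 : ℝ) ≤ d := by exact_mod_cast hd
  have hb : 0 < (d - θ) / d := div_pos (by linarith) (by linarith)
  have ha : 0 < 1 - θ := by linarith
  rw [hθ, truncConst, Real.rpow_sub hb, Real.rpow_natCast, Real.div_rpow hb.le (by positivity),
    Real.rpow_neg ha.le, Real.rpow_sub ha, Real.rpow_one, ← Real.rpow_natCast_mul ha.le,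
    mul_comm _ θ, Real.rpow_mul_natCast ha.le]
  have := Real.rpow_pos_of_pos hb θ
  have := Real.rpow_pos_of_pos ha θ
  field_simp

theorem sum_domWeight_le_matchGen {V : Type*} [Fintype V] [DecidableEq V] (G : SimpleGraph V)
    [DecidableRel G.Adj] (p : V → Prop) [DecidablePred p] {t : ℝ} (ht : 0 ≤ t) :
    ∑ φ ∈ partialFuns (fun (u : {v // p v}) (v : {v // ¬ p v}) => G.Adj u v)
      with ∀ v, fiberCard φ v ≤ 1, domWeight t φ ≤ matchGen G t := by
  classical
  set F := (partialFuns (fun (u : {v // p v}) (v : {v // ¬ p v}) => G.Adj u v)).filter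
    fun φ => ∀ v, fiberCard φ v ≤ 1
  let dom : ({v // p v} → Option {v // ¬ p v}) → Finset {v // p v} :=
    fun φ => Finset.univ.filter fun u => φ u ≠ none
  have hw : ∀ φ, domWeight t φ = t ^ (dom φ).card := by
    intro φ
    rw [← Finset.prod_const, Finset.prod_filter]
    refine Finset.prod_congr rfl fun u _ => ?_
    rcases φ u with _ | v <;> simp
  have hcard : ∀ φ ∈ F, (dom φ).card ∈ Finset.range (Fintype.card V + 1) := by
    intro φ _
    rw [Finset.mem_range, Nat.lt_succ_iff]
    exact (Finset.card_le_univ _).trans (Fintype.card_subtype_le p)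
  rw [← Finset.sum_fiberwise_of_maps_to hcard, matchGen]
  refine Finset.sum_le_sum fun k _ => ?_
  have : ∑ φ ∈ F with (dom φ).card = k, domWeight t φ =
      (F.filter fun φ => (dom φ).card = k).card * t ^ k := by
    rw [← nsmul_eq_mul, ← Finset.sum_const]
    refine Finset.sum_congr rfl fun φ hφ => ?_
    rw [hw, (Finset.mem_filter.1 hφ).2]
  rw [this]
  refine mul_le_mul_of_nonneg_right ?_ (by positivity)
  rw [matchCount, Nat.cast_le, ← Nat.card_eq_finsetCard]
  let edge : ({v // p v} → Option {v // ¬ p v}) → {v // p v} → Sym2 V :=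
    fun φ u => s(u, (φ u).elim u fun v => v)
  have hmem : ∀ φ (u : {v // p v}) (v : {v // ¬ p v}),
      s((u : V), (v : V)) ∈ (dom φ).image (edge φ) ↔ φ u = some v := by
    intro φ u v
    simp only [Finset.mem_image, dom, edge, Finset.mem_filter, Finset.mem_univ, true_and]
    constructor
    · rintro ⟨u', hu', he⟩
      obtain ⟨v', hv'⟩ := Option.ne_none_iff_exists'.1 hu'
      simp only [hv', Option.elim_some, Sym2.eq_iff] at he
      rcases he with ⟨h1, h2⟩ | ⟨h1, h2⟩
      · rw [← Subtype.ext h1, ← Subtype.ext h2, hv']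
      · exact absurd (h1 ▸ u'.2) v.2
    · intro h
      exact ⟨u, by simp [h], by simp [h]⟩
  have hform : ∀ φ, ∀ e ∈ (dom φ).image (edge φ), ∃ (u : {v // p v}) (v : {v // ¬ p v}),
      φ u = some v ∧ e = s((u : V), (v : V)) := by
    intro φ e he
    obtain ⟨u, hu, rfl⟩ := Finset.mem_image.1 he
    obtain ⟨v, hv⟩ := Option.ne_none_iff_exists'.1 (Finset.mem_filter.1 hu).2
    exact ⟨u, v, hv, by simp [edge, hv]⟩
  have hinj : ∀ φ, Set.InjOn (edge φ) (dom φ) := by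
    intro φ u hu u' hu' he
    obtain ⟨v, hv⟩ := Option.ne_none_iff_exists'.1 (Finset.mem_filter.1 hu).2
    obtain ⟨v', hv'⟩ := Option.ne_none_iff_exists'.1 (Finset.mem_filter.1 hu').2
    simp only [edge, hv, hv', Option.elim_some, Sym2.eq_iff] at he
    rcases he with ⟨h1, -⟩ | ⟨h1, -⟩
    · exact Subtype.ext h1
    · exact absurd (h1 ▸ u.2) v'.2
  refine Nat.card_le_card_of_injective
    (fun φ : ↥(F.filter fun φ => (dom φ).card = k) =>
      ⟨(dom φ.1).image (edge φ.1), ?_, ?_, ?_⟩) ?_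
  · intro e he
    obtain ⟨u, v, huv, rfl⟩ := hform _ _ he
    have h1 := Fintype.mem_piFinset.1
      (Finset.mem_filter.1 (Finset.mem_filter.1 φ.2).1).1 u
    rw [huv] at h1
    simpa using h1
  · rw [Finset.card_image_of_injOn (hinj _)]
    exact (Finset.mem_filter.1 φ.2).2
  · intro e he f hf hef w hwe hwf
    obtain ⟨u, v, huv, rfl⟩ := hform _ _ he
    obtain ⟨u', v', huv', rfl⟩ := hform _ _ hf
    have hone := (Finset.mem_filter.1 (Finset.mem_filter.1 φ.2).1).2
    have huu : u = u' → False := by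
      rintro rfl
      rw [huv] at huv'
      cases huv'
      exact hef rfl
    have hvv : v = v' → False := by
      rintro rfl
      exact huu (Finset.card_le_one.1 (hone v) u (by simpa using huv) u' (by simpa using huv'))
    rw [Sym2.mem_iff] at hwe hwf
    rcases hwe with rfl | rfl <;> rcases hwf with h | h
    · exact huu (Subtype.ext h)
    · exact v'.2 (h ▸ u.2)
    · exact v.2 (h ▸ u'.2)
    · exact hvv (Subtype.ext h)
  · intro φ ψ h
    have h' : (dom φ.1).image (edge φ.1) = (dom ψ.1).image (edge ψ.1) := congrArg Subtype.val h
    refine Subtype.ext (funext fun u => Option.ext fun v => ?_)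
    rw [← hmem, ← hmem, h']

/-- For a `d`-regular bipartite simple graph on `2n` vertices and `t > 0`,
`M(G,t) ≥ S_d(t)^n`, where `S_d(t) = (1/η_t²)((d-1)/(d-η_t))^(d-2)` and
`η_t = (√(1+4(d-1)t) - 1)/(2(d-1)t)`. -/
theorem matchGen_ge_tree {V : Type*} [Fintype V] (d n : ℕ) (hd : 2 ≤ d) (hn : 1 ≤ n)
    (G : SimpleGraph V) [DecidableRel G.Adj]
    (hcard : Fintype.card V = 2 * n)
    (hreg : G.IsRegularOfDegree d) (hbip : G.Colorable 2)
    (t : ℝ) (ht : 0 < t) (η S : ℝ)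
    (hη : η = (Real.sqrt (1 + 4 * ((d : ℝ) - 1) * t) - 1) / (2 * ((d : ℝ) - 1) * t))
    (hS : S = (1 / η ^ 2) * (((d : ℝ) - 1) / ((d : ℝ) - η)) ^ (d - 2)) :
    S ^ n ≤ matchGen G t := by
  classical
  obtain ⟨col⟩ := hbip
  let p : V → Prop := fun v => col v = 0
  have hadj : ∀ u v, G.Adj u v → (p u ↔ ¬ p v) := by
    intro u v h
    have := col.valid h
    simp only [p]
    omega
  let r : {v // p v} → {v // ¬ p v} → Prop := fun u v => G.Adj u v
  have hα : ∀ u, (Finset.univ.filter (r u)).card = d := by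
    intro u
    rw [← hreg u, ← G.card_neighborFinset_eq_degree]
    refine Finset.card_bij (fun v _ => v.1) (fun v hv => ?_) (fun _ _ _ _ h => Subtype.ext h)
      fun v hv => ?_
    · simpa [r] using hv
    · rw [G.mem_neighborFinset] at hv
      exact ⟨⟨v, (hadj _ _ hv).1 u.2⟩, by simpa [r] using hv, rfl⟩
  have hβ : ∀ v, (Finset.univ.filter fun u => r u v).card = d := by
    intro v
    rw [← hreg v, ← G.card_neighborFinset_eq_degree]
    refine Finset.card_bij (fun v _ => v.1) (fun v hv => ?_) (fun _ _ _ _ h => Subtype.ext h)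
      fun u hu => ?_
    · simpa [r, G.adj_comm] using hv
    · rw [G.mem_neighborFinset] at hu
      exact ⟨⟨u, (hadj _ _ hu.symm).2 v.2⟩, by simpa [r] using hu.symm, rfl⟩
  have hαβ : Fintype.card {v // p v} = Fintype.card {v // ¬ p v} := by
    have := Finset.sum_card_bipartiteAbove_eq_sum_card_bipartiteBelow r
      (s := Finset.univ) (t := Finset.univ)
    simp only [Finset.bipartiteAbove, Finset.bipartiteBelow, hα, hβ, Finset.sum_const,
      Finset.card_univ, smul_eq_mul] at this
    exact Nat.eq_of_mul_eq_mul_right (by omega) this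
  have hsum := Fintype.card_subtype_compl p
  have hle := Fintype.card_subtype_le p
  have hcβ : Fintype.card {v // ¬ p v} = n := by omega
  have hcα : Fintype.card {v // p v} = n := by omega
  have hd' : (2 : ℝ) ≤ d := by exact_mod_cast hd
  have hm : 0 < ((d : ℝ) - 1) * t := mul_pos (by linarith) ht
  have hη0 : 0 < η := by
    rw [hη]
    refine div_pos ?_ (by linarith)
    have : 1 < Real.sqrt (1 + 4 * ((d : ℝ) - 1) * t) := by
      rw [Real.lt_sqrt one_pos.le]
      linarith
    linarith
  have hquad : ((d : ℝ) - 1) * t * η ^ 2 = 1 - η := by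
    have hsq : (2 * (((d : ℝ) - 1) * t) * η + 1) ^ 2 = 1 + 4 * ((d : ℝ) - 1) * t := by
      rw [← Real.sq_sqrt (show 0 ≤ 1 + 4 * ((d : ℝ) - 1) * t by linarith)]
      congr 1
      rw [hη]
      have : (d : ℝ) - 1 ≠ 0 := by linarith
      field_simp
      ring
    have : 4 * (((d : ℝ) - 1) * t) * (((d : ℝ) - 1) * t * η ^ 2 - (1 - η)) = 0 := by
      linear_combination hsq
    rcases mul_eq_zero.1 this with h | h
    · linarith
    · linarith
  have hη1 : η < 1 := by
    have : 0 < ((d : ℝ) - 1) * t * η ^ 2 := by positivity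
    linarith
  have hdη : 0 < (d : ℝ) - η := by linarith
  have hd1 : 0 < (d : ℝ) - 1 := by linarith
  have hη1' : 0 < 1 - η := by linarith
  have e1 : 1 - d * (1 - η) / (d - η) = (d - 1) * η / (d - η) := by
    field_simp
    ring
  have e2 : ((d : ℝ) - d * (1 - η) / (d - η)) / d = (d - 1) / (d - η) := by
    field_simp
    ring
  have hθ0 : 0 < d * (1 - η) / (d - η) := by positivity
  have hθ1 : d * (1 - η) / (d - η) < 1 := by
    have : 0 < ((d : ℝ) - 1) * η / (d - η) := by positivity
    linarith
  have hconst := truncConst_mul_eq (d := d) (t := t) (by omega) hθ0 hθ1 (by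
    rw [e1, e2]
    field_simp
    linear_combination hquad)
  have hSeq : S = truncConst d (d * (1 - η) / (d - η)) *
      ((1 - d * (1 - η) / (d - η)) ^ (-(1 - d * (1 - η) / (d - η))) *
        (d * t / (d * (1 - η) / (d - η))) ^ (d * (1 - η) / (d - η))) := by
    rw [hconst, hS, e1, e2]
    obtain ⟨k, rfl⟩ := Nat.exists_eq_add_of_le hd
    rw [Nat.add_sub_cancel_left, pow_add, mul_comm ((_ : ℝ) ^ 2)]
    generalize (_ : ℝ) ^ k = X
    field_simp
  have hmain := pow_le_sum_domWeight r (by omega) hα hβ ht hθ0 hθ1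
  rw [hcα, hcβ, ← mul_pow, ← hSeq] at hmain
  exact hmain.trans (sum_domWeight_le_matchGen G p ht.le)
end

section
/- Let d ≥ 2 be an integer and t ≥ 0 a real number. Then ∫_{−2√(d−1)}^{2√(d−1)} (t·x²/(1+t·x²)) · f_d(x) dx = (2d²t + d − d·√(1+4(d−1)t)) / (2d²t + 2), where f_d is the Kesten–McKay density. -/
open Real Set Filter Topology MeasureTheory

/-- The fundamental theorem of calculus on an interval, for a nonnegative derivative on the open
interval of a function having limits at both endpoints. -/
theorem integral_eq_sub_of_hasDerivAt_of_nonneg_of_tendsto {f f' : ℝ → ℝ} {a b fa fb : ℝ}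
    (hab : a < b) (hderiv : ∀ x ∈ Ioo a b, HasDerivAt f (f' x) x)
    (hpos : ∀ x ∈ Ioo a b, 0 ≤ f' x)
    (ha : Tendsto f (𝓝[>] a) (𝓝 fa)) (hb : Tendsto f (𝓝[<] b) (𝓝 fb)) :
    ∫ y in a..b, f' y = fb - fa := by
  have hf : ContinuousOn f (Ioo a b) := fun z hz =>
    (hderiv z hz).continuousAt.continuousWithinAt
  refine intervalIntegral.integral_eq_sub_of_hasDerivAt_of_tendsto hab hderiv ?_ ha hb
  rw [intervalIntegrable_iff_integrableOn_Ioc_of_le hab.le]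
  refine intervalIntegral.integrableOn_deriv_of_nonneg
    (continuousOn_Icc_extendFrom_Ioo hf ha hb) (fun x hx => ?_) hpos
  refine (hderiv x hx).congr_of_eventuallyEq ?_
  filter_upwards [Ioo_mem_nhds hx.1 hx.2] with y hy using extendFrom_extends hf y hy

theorem hasDerivAt_mul_arctan_mul_div_sqrt (k : ℝ) {R x : ℝ} (hx : x ^ 2 < R) :
    HasDerivAt (fun y => k * arctan (k * (y / √(R - y ^ 2))))
      (k ^ 2 * R / (√(R - x ^ 2) * (R - x ^ 2 + k ^ 2 * x ^ 2))) x := by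
  have hpos : 0 < R - x ^ 2 := sub_pos.2 hx
  have hw : 0 < √(R - x ^ 2) := sqrt_pos.2 hpos
  have hsq : √(R - x ^ 2) ^ 2 = R - x ^ 2 := sq_sqrt hpos.le
  have hsqrt := (((hasDerivAt_id x).pow 2).const_sub R).sqrt hpos.ne'
  convert! ((((hasDerivAt_id x).div hsqrt hw.ne').const_mul k).arctan).const_mul k using 1
  simp only [id, Pi.pow_apply, Pi.div_apply]
  have hR : R = √(R - x ^ 2) ^ 2 + x ^ 2 := by rw [hsq]; ring
  rw [← hsq]
  set w := √(R - x ^ 2)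
  rw [sqrt_sq hw.le, hR]
  have h1 : w ^ 2 + k ^ 2 * x ^ 2 ≠ 0 := by positivity
  have h2 : 1 + (k * (x / w)) ^ 2 ≠ 0 := by positivity
  have h3 : w ^ 2 * (1 + (k * (x / w)) ^ 2) = w ^ 2 + k ^ 2 * x ^ 2 := by field_simp
  rw [← h3]
  field_simp
  ring

theorem tendsto_mul_arctan_mul_div_sqrt {k r : ℝ} (hk : 0 ≤ k) (hr : 0 < r) :
    Tendsto (fun y => k * arctan (k * (y / √(r ^ 2 - y ^ 2)))) (𝓝[<] r) (𝓝 (k * (π / 2))) := by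
  rcases hk.eq_or_lt with rfl | hk
  · simp
  refine Tendsto.const_mul k ((tendsto_arctan_atTop.mono_right nhdsWithin_le_nhds).comp ?_)
  refine Tendsto.const_mul_atTop hk ?_
  refine Tendsto.pos_mul_atTop hr (tendsto_id.mono_left nhdsWithin_le_nhds) ?_
  refine Tendsto.inv_tendsto_nhdsGT_zero (tendsto_nhdsWithin_iff.2 ⟨?_, ?_⟩)
  · have hc : Continuous fun y : ℝ => √(r ^ 2 - y ^ 2) := by fun_prop
    simpa using (hc.tendsto r).mono_left nhdsWithin_le_nhds
  · filter_upwards [Ioo_mem_nhdsLT (neg_lt_self hr)] with y hy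
    exact sqrt_pos.2 (sub_pos.2 (sq_lt_sq' hy.1 hy.2))

theorem tendsto_mul_arctan_mul_div_sqrt_neg {k r : ℝ} (hk : 0 ≤ k) (hr : 0 < r) :
    Tendsto (fun y => k * arctan (k * (y / √(r ^ 2 - y ^ 2)))) (𝓝[>] (-r))
      (𝓝 (-(k * (π / 2)))) := by
  refine ((tendsto_mul_arctan_mul_div_sqrt hk hr).comp
    (tendsto_neg_nhdsGT_neg (a := r))).neg.congr fun y => ?_
  simp [neg_div, arctan_neg]


/-- The density function of the infinite `d`-regular tree (the Kesten–McKay measure)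
integrated against `t x²/(1+t x²)` gives `p(𝕋_d, t)`. -/
theorem kestenMcKay_density_integral (d : ℕ) (hd : 2 ≤ d) (t : ℝ) (ht : 0 ≤ t) :
    ∫ x in (-(2 * Real.sqrt ((d : ℝ) - 1)))..(2 * Real.sqrt ((d : ℝ) - 1)),
        (t * x ^ 2 / (1 + t * x ^ 2)) *
          ((d : ℝ) * Real.sqrt (4 * ((d : ℝ) - 1) - x ^ 2) /
            (2 * Real.pi * ((d : ℝ) ^ 2 - x ^ 2)))
      = (2 * (d : ℝ) ^ 2 * t + (d : ℝ) - (d : ℝ) * Real.sqrt (1 + 4 * ((d : ℝ) - 1) * t))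
          / (2 * (d : ℝ) ^ 2 * t + 2) := by
  have hd' : (2 : ℝ) ≤ d := by exact_mod_cast hd
  generalize (d : ℝ) = D at hd'
  have hD : 0 < D := by linarith
  have hD1 : 0 < D - 1 := by linarith
  set r := 2 * √(D - 1)
  have hr : 0 < r := by positivity
  have hr2 : r ^ 2 = 4 * (D - 1) := by rw [mul_pow, sq_sqrt hD1.le]; norm_num
  have hκ : 0 ≤ 1 + 4 * (D - 1) * t := by positivity
  have he : 0 ≤ (D - 2) / D := div_nonneg (by linarith) hD.le
  have hC : 0 < 1 + t * D ^ 2 := by positivity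
  let H : ℝ → ℝ → ℝ := fun k y => k * arctan (k * (y / √(r ^ 2 - y ^ 2)))
  have hlt : ∀ x ∈ Ioo (-r) r, x ^ 2 < r ^ 2 := fun x hx => sq_lt_sq' hx.1 hx.2
  have hDx : ∀ x ∈ Ioo (-r) r, 0 < D ^ 2 - x ^ 2 := fun x hx => by
    nlinarith [hlt x hx, sq_nonneg (D - 2)]
  rw [integral_eq_sub_of_hasDerivAt_of_nonneg_of_tendsto
    (f := fun y => D / (2 * π * (1 + t * D ^ 2)) * ((t * D ^ 2 + 1) * H 1 y
      - t * D ^ 2 * H ((D - 2) / D) y - H √(1 + 4 * (D - 1) * t) y))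
    (neg_lt_self hr) ?_ ?_
    ((((tendsto_mul_arctan_mul_div_sqrt_neg zero_le_one hr).const_mul _).sub
      ((tendsto_mul_arctan_mul_div_sqrt_neg he hr).const_mul _)).sub
      (tendsto_mul_arctan_mul_div_sqrt_neg (sqrt_nonneg _) hr) |>.const_mul _)
    ((((tendsto_mul_arctan_mul_div_sqrt zero_le_one hr).const_mul _).sub
      ((tendsto_mul_arctan_mul_div_sqrt he hr).const_mul _)).sub
      (tendsto_mul_arctan_mul_div_sqrt (sqrt_nonneg _) hr) |>.const_mul _)]
  · have h2 : 2 * D ^ 2 * t + 2 ≠ 0 := by positivity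
    have := pi_ne_zero
    field_simp
    ring
  · intro x hx
    have hx2 := hlt x hx
    convert! (((((hasDerivAt_mul_arctan_mul_div_sqrt 1 hx2).const_mul (t * D ^ 2 + 1)).sub
      ((hasDerivAt_mul_arctan_mul_div_sqrt ((D - 2) / D) hx2).const_mul (t * D ^ 2))).sub
      (hasDerivAt_mul_arctan_mul_div_sqrt √(1 + 4 * (D - 1) * t) hx2)).const_mul
        (D / (2 * π * (1 + t * D ^ 2)))) using 1
    have hw : 0 < √(r ^ 2 - x ^ 2) := sqrt_pos.2 (sub_pos.2 hx2)
    have hsq : √(r ^ 2 - x ^ 2) ^ 2 = r ^ 2 - x ^ 2 := sq_sqrt (sub_pos.2 hx2).le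
    have h1 : r ^ 2 - x ^ 2 + 1 ^ 2 * x ^ 2 = r ^ 2 := by ring
    have h2 : r ^ 2 - x ^ 2 + ((D - 2) / D) ^ 2 * x ^ 2 = r ^ 2 * ((D ^ 2 - x ^ 2) / D ^ 2) := by
      rw [hr2]; field_simp; ring
    have h3 : r ^ 2 - x ^ 2 + (1 + 4 * (D - 1) * t) * x ^ 2 = r ^ 2 * (1 + t * x ^ 2) := by
      rw [hr2]; ring
    rw [sq_sqrt hκ, h1, h2, h3, ← hr2]
    have hx1 : 0 < 1 + t * x ^ 2 := by positivity
    have hx3 := hDx x hx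
    have hπ := pi_pos
    set w := √(r ^ 2 - x ^ 2)
    field_simp
    rw [hsq, hr2]
    ring
  · intro x hx
    have hx3 := hDx x hx
    positivity
end
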